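/- Schauder estimate in non-divergence form (Theorem B). Let s ∈ (0,1), γ ∈ [0,1) with γ < 2s, α ∈ (0,1] with 2s+α ∉ ℕ, and 0 < λ ≤ Λ, M > 0. Let (K_x)_{x∈ℝⁿ} be a family of symmetric Lévy measures, uniformly elliptic of order 2s with constants λ, Λ, and assume: for all x, x' ∈ ℝⁿ, all ρ > 0, and every φ : ℝⁿ → ℝ with [φ]_{C^γ(ℝⁿ)} ≤ 1 and φ(0) = 0, |∫_{B_{2ρ}∖B_ρ} φ d(K_x − K_{x'})| ≤ M |x−x'|^α ρ^{γ−2s}. In case α > γ, assume in addition sup_{x∈B₁} [K_x]_{α−γ} ≤ M. Let f ∈ C^α(B₁) and let u ∈ C^{2s+α}(B₁) ∩ C^γ(ℝⁿ) satisfy L(u,x) = f(x) for every x ∈ B₁. Then ‖u‖_{C^{2s+α}(B_{1/2})} ≤ C (‖f‖_{C^α(B₁)} + ‖u‖_{C^γ(ℝⁿ)}) for some C depending only on n, s, α, γ, λ, Λ, M. -/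

import Mathlib

open MeasureTheory Metric Set
open scoped ENNReal Topology RealInnerProductSpace

noncomputable section

abbrev Euc (n : ℕ) := EuclideanSpace ℝ (Fin n)

variable {n : ℕ}

def hDeg (σ : ℝ) : ℕ := ⌈σ⌉₊ - 1

def hSemiOn (σ : ℝ) (Ω A : Set (Euc n)) (u : Euc n → ℝ) : ℝ≥0∞ :=
  ⨆ (x : A) (y : A),
    ENNReal.ofReal
      (‖iteratedFDerivWithin ℝ (hDeg σ) u Ω ↑x - iteratedFDerivWithin ℝ (hDeg σ) u Ω ↑y‖ /
        ‖(x : Euc n) - (y : Euc n)‖ ^ (σ - (hDeg σ : ℝ)))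

def hSemi (σ : ℝ) (Ω : Set (Euc n)) (u : Euc n → ℝ) : ℝ≥0∞ := hSemiOn σ Ω Ω u

def hNormOn (σ : ℝ) (Ω A : Set (Euc n)) (u : Euc n → ℝ) : ℝ≥0∞ :=
  (∑ j ∈ Finset.range (hDeg σ + 1), ⨆ x : A, ENNReal.ofReal ‖iteratedFDerivWithin ℝ j u Ω ↑x‖) +
    hSemiOn σ Ω A u

def hNorm (σ : ℝ) (Ω : Set (Euc n)) (u : Euc n → ℝ) : ℝ≥0∞ := hNormOn σ Ω Ω u

def HolderMem (σ : ℝ) (Ω : Set (Euc n)) (u : Euc n → ℝ) : Prop :=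
  ContDiffOn ℝ (hDeg σ) u Ω ∧ hNorm σ Ω u ≠ ⊤

def HolderMemLoc (σ : ℝ) (Ω : Set (Euc n)) (u : Euc n → ℝ) : Prop :=
  ContDiffOn ℝ (hDeg σ) u Ω ∧
    ∀ A : Set (Euc n), IsCompact A → A ⊆ Ω → hNormOn σ Ω A u ≠ ⊤

def supNorm (Ω : Set (Euc n)) (u : Euc n → ℝ) : ℝ≥0∞ :=
  ⨆ x : Ω, ENNReal.ofReal |u ↑x|

def supNormW (τ : ℝ) (u : Euc n → ℝ) : ℝ≥0∞ :=
  ⨆ x : Euc n, ENNReal.ofReal (|u x| / (1 + ‖x‖ ^ τ))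

def IsLevyMeasure (K : Measure (Euc n)) : Prop :=
  K {0} = 0 ∧ (∫⁻ y, ENNReal.ofReal (min 1 (‖y‖ ^ 2)) ∂K) ≠ ⊤ ∧
    Measure.map (fun y => -y) K = K

def UnifElliptic (s lam Lam : ℝ) (K : Measure (Euc n)) : Prop :=
  (∀ r : ℝ, 0 < r →
    ENNReal.ofReal (r ^ (2 * s)) * K (ball 0 (2 * r) \ ball 0 r) ≤ ENNReal.ofReal Lam) ∧
  (∀ r : ℝ, 0 < r → ∀ e : Euc n, ‖e‖ = 1 →
    ENNReal.ofReal lam ≤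
      ENNReal.ofReal (r ^ (2 * s - 2)) * ∫⁻ y in ball 0 r, ENNReal.ofReal (⟪e, y⟫ ^ 2) ∂K)

def Lop (K : Euc n → Measure (Euc n)) (u : Euc n → ℝ) (x : Euc n) : ℝ :=
  (1 / 2) * ∫ y, (2 * u x - u (x + y) - u (x - y)) ∂(K x)

def LopTI (K : Measure (Euc n)) (u : Euc n → ℝ) (x : Euc n) : ℝ :=
  (1 / 2) * ∫ y, (2 * u x - u (x + y) - u (x - y)) ∂K

def SolvesPtwise (K : Euc n → Measure (Euc n)) (u f : Euc n → ℝ) (Ω : Set (Euc n)) : Prop :=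
  ∀ x ∈ Ω, Integrable (fun y => 2 * u x - u (x + y) - u (x - y)) (K x) ∧ Lop K u x = f x

def tvDiff (μ ν : Measure (Euc n)) (A : Set (Euc n)) : ℝ≥0∞ :=
  (μ.restrict A - ν.restrict A) Set.univ + (ν.restrict A - μ.restrict A) Set.univ

def kernelHolder (s θ : ℝ) (K : Measure (Euc n)) : ℝ≥0∞ :=
  ⨆ (ρ : ℝ) (_ : 0 < ρ) (x : Euc n) (x' : Euc n)
      (_ : x ∈ ball 0 (ρ / 2)) (_ : x' ∈ ball 0 (ρ / 2)) (_ : x ≠ x'),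
    ENNReal.ofReal (ρ ^ (2 * s + θ) / ‖x - x'‖ ^ θ) *
      tvDiff (Measure.map (fun y => x - y) K) (Measure.map (fun y => x' - y) K)
        (ball 0 (2 * ρ) \ ball 0 ρ)

def KantCond (s γ : ℝ) (μ ν : Measure (Euc n)) (c : ℝ) : Prop :=
  ∀ ρ : ℝ, 0 < ρ → ∀ φ : Euc n → ℝ, ContDiff ℝ (hDeg γ) φ →
    hSemi γ Set.univ φ ≤ 1 → φ 0 = 0 →
    |(∫ y in ball 0 (2 * ρ) \ ball 0 ρ, φ y ∂μ) -
        ∫ y in ball 0 (2 * ρ) \ ball 0 ρ, φ y ∂ν| ≤ c * ρ ^ (γ - 2 * s)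


/-- Second symmetric difference. -/
def cd2 (g : Euc n → ℝ) (x h : Euc n) : ℝ := g (x + h) + g (x - h) - 2 * g x

/-- Third central difference with step `2 h`. -/
def cd3 (g : Euc n → ℝ) (x h : Euc n) : ℝ :=
  g (x + (3 : ℝ) • h) - 3 * g (x + h) + 3 * g (x - h) - g (x - (3 : ℝ) • h)

/-- The constant produced by the doubling recursion. -/
def Cd (q σ : ℝ) : ℝ := 2 ^ σ + 1 / (1 - q * 2 ^ σ)

lemma Cd_pos {q σ : ℝ} (hqσ : q * 2 ^ σ < 1) : 0 < Cd q σ := by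
  have : 0 < 1 - q * (2 : ℝ) ^ σ := by linarith
  unfold Cd
  positivity

lemma le_rpow_of_doubling {F : Euc n → ℝ} {q b B σ τ : ℝ} (hq : 0 ≤ q) (hb : 0 ≤ b) (hB : 0 ≤ B)
    (hσ : 0 ≤ σ) (hτ : 0 < τ) (hqσ : q * 2 ^ σ < 1) (hF0 : F 0 ≤ 0)
    (hrec : ∀ h, ‖h‖ ≤ τ / 2 → F h ≤ q * F ((2 : ℝ) • h) + b * ‖h‖ ^ σ)
    (hbd : ∀ h, ‖h‖ ≤ τ → F h ≤ B) (h : Euc n) (hh : ‖h‖ ≤ τ) :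
    F h ≤ Cd q σ * (B / τ ^ σ + b) * ‖h‖ ^ σ := by
  have h1 : 0 < 1 - q * (2 : ℝ) ^ σ := by linarith
  have hCd := Cd_pos hqσ
  have hτσ : 0 < τ ^ σ := by positivity
  set C := Cd q σ * (B / τ ^ σ + b) with hC
  have hC0 : 0 ≤ C := by positivity
  have hCB : 2 ^ σ * (B / τ ^ σ) ≤ C := by
    rw [hC]
    have : (2 : ℝ) ^ σ ≤ Cd q σ := by
      unfold Cd
      have : 0 ≤ 1 / (1 - q * (2 : ℝ) ^ σ) := by positivity
      linarith
    have h2 : 0 ≤ B / τ ^ σ := by positivity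
    nlinarith
  have hCb : b ≤ C * (1 - q * 2 ^ σ) := by
    rw [hC]
    have : 1 / (1 - q * (2 : ℝ) ^ σ) ≤ Cd q σ := by
      unfold Cd
      have : 0 ≤ (2 : ℝ) ^ σ := by positivity
      linarith
    have h2 : 0 ≤ B / τ ^ σ := by positivity
    have h3 : 1 ≤ Cd q σ * (1 - q * 2 ^ σ) := by
      rwa [div_le_iff₀ h1] at this
    nlinarith
  have base : ∀ h : Euc n, ‖h‖ ≤ τ → τ < 2 * ‖h‖ → F h ≤ C * ‖h‖ ^ σ := by
    intro h hh hh2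
    calc F h ≤ B := hbd h hh
      _ = (B / τ ^ σ) * τ ^ σ := by field_simp
      _ ≤ (B / τ ^ σ) * (2 * ‖h‖) ^ σ := by gcongr
      _ = 2 ^ σ * (B / τ ^ σ) * ‖h‖ ^ σ := by
          rw [Real.mul_rpow (by norm_num) (norm_nonneg _)]; ring
      _ ≤ C * ‖h‖ ^ σ := by gcongr
  have key : ∀ k : ℕ, ∀ h : Euc n, ‖h‖ ≤ τ → τ < 2 ^ (k + 1) * ‖h‖ → F h ≤ C * ‖h‖ ^ σ := by
    intro k
    induction k with
    | zero => intro h hh hh2; exact base h hh (by simpa using hh2)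
    | succ k ih =>
      intro h hh hh2
      by_cases hc : τ < 2 * ‖h‖
      · exact base h hh hc
      push Not at hc
      have hn : ‖(2 : ℝ) • h‖ = 2 * ‖h‖ := by rw [norm_smul]; norm_num
      have := ih ((2 : ℝ) • h) (by rw [hn]; exact hc) (by rw [hn]; rw [pow_succ] at hh2; linarith)
      rw [hn, Real.mul_rpow (by norm_num) (norm_nonneg _)] at this
      calc F h ≤ q * F ((2 : ℝ) • h) + b * ‖h‖ ^ σ := hrec h (by linarith)
        _ ≤ q * (C * (2 ^ σ * ‖h‖ ^ σ)) + (C * (1 - q * 2 ^ σ)) * ‖h‖ ^ σ := by gcongr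
        _ = C * ‖h‖ ^ σ := by ring
  by_cases h0 : h = 0
  · subst h0
    exact hF0.trans (by positivity)
  have hpos : 0 < ‖h‖ := norm_pos_iff.mpr h0
  obtain ⟨k, hk⟩ := pow_unbounded_of_one_lt (τ / ‖h‖) (one_lt_two : (1 : ℝ) < 2)
  refine key k h hh ?_
  rw [div_lt_iff₀ hpos] at hk
  rw [pow_succ]
  nlinarith [pow_pos (two_pos : (0 : ℝ) < 2) k]

lemma quarter_mul_two_rpow_lt {σ : ℝ} (hσ : σ < 2) : (1 / 4 : ℝ) * 2 ^ σ < 1 := by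
  have : (2 : ℝ) ^ σ < 2 ^ (2 : ℝ) := Real.rpow_lt_rpow_of_exponent_lt one_lt_two hσ
  rw [show (2 : ℝ) ^ (2 : ℝ) = 4 by norm_num] at this
  linarith

lemma half_mul_two_rpow_lt {σ : ℝ} (hσ : σ < 1) : (1 / 2 : ℝ) * 2 ^ σ < 1 := by
  have : (2 : ℝ) ^ σ < 2 ^ (1 : ℝ) := Real.rpow_lt_rpow_of_exponent_lt one_lt_two hσ
  rw [Real.rpow_one] at this
  linarith

lemma cd2_le_of_cd3 {g : Euc n → ℝ} {x : Euc n} {σ τ b B : ℝ} (hσ : 0 ≤ σ) (hσ2 : σ < 2)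
    (hτ : 0 < τ) (hb : 0 ≤ b) (hB : 0 ≤ B)
    (h3 : ∀ h, ‖h‖ ≤ τ / 4 → |cd3 g (x + h) h| ≤ b * ‖h‖ ^ σ ∧ |cd3 g (x - h) h| ≤ b * ‖h‖ ^ σ)
    (h2 : ∀ k, ‖k‖ ≤ τ → |cd2 g x k| ≤ B) (k : Euc n) (hk : ‖k‖ ≤ τ) :
    |cd2 g x k| ≤ Cd (1 / 4) σ * (B / τ ^ σ + b) * ‖k‖ ^ σ := by
  refine le_rpow_of_doubling (F := fun k => |cd2 g x k|) (by norm_num) hb hB hσ hτ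
    (quarter_mul_two_rpow_lt hσ2) ?_ ?_ h2 k hk
  · simp [cd2]; ring_nf
  · intro h hh
    obtain ⟨ha, hb'⟩ := h3 ((1 / 2 : ℝ) • h) (by rw [norm_smul]; norm_num; linarith)
    have hn : ‖(1 / 2 : ℝ) • h‖ ^ σ ≤ ‖h‖ ^ σ := by
      apply Real.rpow_le_rpow (norm_nonneg _) _ hσ
      rw [norm_smul]; norm_num; linarith [norm_nonneg h]
    have e : cd2 g x ((2 : ℝ) • h) - 4 * cd2 g x h =
        cd3 g (x + (1 / 2 : ℝ) • h) ((1 / 2 : ℝ) • h) -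
          cd3 g (x - (1 / 2 : ℝ) • h) ((1 / 2 : ℝ) • h) := by
      simp only [cd2, cd3]
      have e1 : x + (1 / 2 : ℝ) • h + (3 : ℝ) • (1 / 2 : ℝ) • h = x + (2 : ℝ) • h := by module
      have e2 : x + (1 / 2 : ℝ) • h + (1 / 2 : ℝ) • h = x + h := by module
      have e3 : x + (1 / 2 : ℝ) • h - (1 / 2 : ℝ) • h = x := by module
      have e4 : x + (1 / 2 : ℝ) • h - (3 : ℝ) • (1 / 2 : ℝ) • h = x - h := by module
      have e5 : x - (1 / 2 : ℝ) • h + (3 : ℝ) • (1 / 2 : ℝ) • h = x + h := by module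
      have e6 : x - (1 / 2 : ℝ) • h + (1 / 2 : ℝ) • h = x := by module
      have e7 : x - (1 / 2 : ℝ) • h - (1 / 2 : ℝ) • h = x - h := by module
      have e8 : x - (1 / 2 : ℝ) • h - (3 : ℝ) • (1 / 2 : ℝ) • h = x - (2 : ℝ) • h := by module
      rw [e1, e2, e3, e4, e5, e6, e7, e8]
      ring
    have hbn : b * ‖(1 / 2 : ℝ) • h‖ ^ σ ≤ b * ‖h‖ ^ σ := by gcongr
    have hnn : 0 ≤ b * ‖h‖ ^ σ := by positivity
    rw [abs_le] at ha hb'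
    have a1 := abs_le.mp (le_refl |cd2 g x ((2 : ℝ) • h)|)
    show |cd2 g x h| ≤ 1 / 4 * |cd2 g x ((2 : ℝ) • h)| + b * ‖h‖ ^ σ
    rw [abs_le]
    constructor <;> linarith [ha.1, ha.2, hb'.1, hb'.2, a1.1, a1.2]

lemma diff_le_of_cd2 {g : Euc n → ℝ} {x : Euc n} {μ τ b B : ℝ} (hμ : 0 ≤ μ) (hμ1 : μ < 1)
    (hτ : 0 < τ) (hb : 0 ≤ b) (hB : 0 ≤ B)
    (h2 : ∀ k, ‖k‖ ≤ τ / 2 → |cd2 g (x + k) k| ≤ b * ‖k‖ ^ μ)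
    (h1 : ∀ k, ‖k‖ ≤ τ → |g (x + k) - g x| ≤ B) (k : Euc n) (hk : ‖k‖ ≤ τ) :
    |g (x + k) - g x| ≤ Cd (1 / 2) μ * (B / τ ^ μ + b) * ‖k‖ ^ μ := by
  refine le_rpow_of_doubling (F := fun k => |g (x + k) - g x|) (by norm_num) hb hB hμ hτ
    (half_mul_two_rpow_lt hμ1) (by simp) ?_ h1 k hk
  intro h hh
  have ha := h2 h hh
  have e : g (x + h) - g x = 1 / 2 * (g (x + (2 : ℝ) • h) - g x) - 1 / 2 * cd2 g (x + h) h := by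
    simp only [cd2]
    rw [show x + h + h = x + (2 : ℝ) • h by module, show x + h - h = x by module]
    ring
  show |g (x + h) - g x| ≤ 1 / 2 * |g (x + (2 : ℝ) • h) - g x| + b * ‖h‖ ^ μ
  have a1 := abs_le.mp (le_refl |g (x + (2 : ℝ) • h) - g x|)
  have hnn : 0 ≤ b * ‖h‖ ^ μ := by positivity
  rw [abs_le] at ha
  rw [e, abs_le]
  constructor <;> linarith [ha.1, ha.2, a1.1, a1.2]

lemma mul_rpow_le_mul_rpow_of_le {b β σ τ t : ℝ} (hb : 0 ≤ b) (hσβ : σ ≤ β) (hσ : 0 ≤ σ)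
    (ht : 0 ≤ t) (htτ : t ≤ τ) : b * t ^ β ≤ b * τ ^ (β - σ) * t ^ σ := by
  rcases eq_or_lt_of_le ht with h0 | h0
  · subst h0
    by_cases hβ : β = 0
    · subst hβ
      have : σ = 0 := le_antisymm hσβ hσ
      subst this
      simp
    · rw [Real.zero_rpow hβ, mul_zero]
      positivity
  · have : t ^ β = t ^ (β - σ) * t ^ σ := by rw [← Real.rpow_add h0]; ring_nf
    rw [this, mul_assoc]
    have : t ^ (β - σ) ≤ τ ^ (β - σ) := Real.rpow_le_rpow ht htτ (by linarith)
    gcongr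

lemma cd3_neg (g : Euc n → ℝ) (x h : Euc n) : cd3 g x (-h) = -cd3 g x h := by
  simp only [cd3, smul_neg, sub_neg_eq_add, ← sub_eq_add_neg]
  ring

lemma cd3_zero (g : Euc n → ℝ) (x : Euc n) : cd3 g x 0 = 0 := by
  simp [cd3]

lemma cd2_zero (g : Euc n → ℝ) (x : Euc n) : cd2 g x 0 = 0 := by
  simp [cd2]; ring

lemma cd3_comm (g : Euc n → ℝ) (x h k : Euc n) :
    cd3 (fun y => cd3 g y h) x k = cd3 (fun y => cd3 g y k) x h := by
  simp only [cd3]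
  have : ∀ p q : Euc n, x + p + q = x + q + p := fun p q => by abel
  have e2 : ∀ p q : Euc n, x + p - q = x - q + p := fun p q => by abel
  have e3 : ∀ p q : Euc n, x - p - q = x - q - p := fun p q => by abel
  rw [this k, this h ((3 : ℝ) • k), e2 k ((3 : ℝ) • h), e2 h ((3 : ℝ) • k), e2 k h, e2 h k, e3 k h,
    e3 ((3 : ℝ) • k) ((3 : ℝ) • h), e3 ((3 : ℝ) • k) h, e3 k ((3 : ℝ) • h),
    this ((3 : ℝ) • h) ((3 : ℝ) • k), this ((3 : ℝ) • h) k, ← e2 ((3 : ℝ) • k) ((3 : ℝ) • h),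
    e2 ((3 : ℝ) • h) ((3 : ℝ) • k), e2 ((3 : ℝ) • h) k, e2 ((3 : ℝ) • k) h, this h k]
  ring

lemma abs_cd3_le {g : Euc n → ℝ} {x h : Euc n} {B : ℝ}
    (hB : ∀ a : ℝ, |a| ≤ 3 → |g (x + a • h)| ≤ B) : |cd3 g x h| ≤ 8 * B := by
  have h1 := abs_le.mp (hB 3 (by norm_num))
  have h2 := abs_le.mp (hB 1 (by norm_num))
  have h3 := abs_le.mp (hB (-1) (by norm_num))
  have h4 := abs_le.mp (hB (-3) (by norm_num))
  rw [one_smul] at h2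
  rw [neg_smul, one_smul, ← sub_eq_add_neg] at h3
  rw [neg_smul, ← sub_eq_add_neg] at h4
  unfold cd3
  rw [abs_le]
  constructor <;> linarith [h1.1, h1.2, h2.1, h2.2, h3.1, h3.2, h4.1, h4.2]

lemma cd3_two_smul (g : Euc n → ℝ) (x h : Euc n) :
    cd3 g x ((2 : ℝ) • h) = cd3 g (x + (3 : ℝ) • h) h + 3 * cd3 g (x + h) h
      + 3 * cd3 g (x - h) h + cd3 g (x - (3 : ℝ) • h) h := by
  simp only [cd3]
  rw [show x + (3 : ℝ) • (2 : ℝ) • h = x + (6 : ℝ) • h by module,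
    show x - (3 : ℝ) • (2 : ℝ) • h = x - (6 : ℝ) • h by module,
    show x + (3 : ℝ) • h + (3 : ℝ) • h = x + (6 : ℝ) • h by module,
    show x + (3 : ℝ) • h + h = x + (4 : ℝ) • h by module,
    show x + (3 : ℝ) • h - h = x + (2 : ℝ) • h by module,
    show x + (3 : ℝ) • h - (3 : ℝ) • h = x by module,
    show x + h + (3 : ℝ) • h = x + (4 : ℝ) • h by module,
    show x + h + h = x + (2 : ℝ) • h by module,
    show x + h - h = x by module,
    show x + h - (3 : ℝ) • h = x - (2 : ℝ) • h by module,
    show x - h + (3 : ℝ) • h = x + (2 : ℝ) • h by module,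
    show x - h + h = x by module,
    show x - h - h = x - (2 : ℝ) • h by module,
    show x - h - (3 : ℝ) • h = x - (4 : ℝ) • h by module,
    show x - (3 : ℝ) • h + (3 : ℝ) • h = x by module,
    show x - (3 : ℝ) • h + h = x - (2 : ℝ) • h by module,
    show x - (3 : ℝ) • h - h = x - (4 : ℝ) • h by module,
    show x - (3 : ℝ) • h - (3 : ℝ) • h = x - (6 : ℝ) • h by module]
  ring

/-- The dyadic annulus `B_{2ρ} ∖ B_ρ`. -/
def ann (ρ : ℝ) : Set (Euc n) := ball 0 (2 * ρ) \ ball 0 ρ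

lemma mem_ann {ρ : ℝ} {y : Euc n} : y ∈ ann ρ ↔ ‖y‖ < 2 * ρ ∧ ρ ≤ ‖y‖ := by
  simp [ann]

lemma measurableSet_ann (ρ : ℝ) : MeasurableSet (ann ρ : Set (Euc n)) :=
  measurableSet_ball.diff measurableSet_ball

/-- The geometric constant bounding `∑ 2^{-jε}`. -/
def geo (ε : ℝ) : ℝ := (1 - (1 / 2 : ℝ) ^ ε)⁻¹

lemma half_rpow_lt_one {ε : ℝ} (hε : 0 < ε) : (1 / 2 : ℝ) ^ ε < 1 :=
  Real.rpow_lt_one (by norm_num) (by norm_num) hε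

lemma geo_pos {ε : ℝ} (hε : 0 < ε) : 0 < geo ε :=
  inv_pos.mpr (by linarith [half_rpow_lt_one hε])

lemma iUnion_ann_near {r : ℝ} (hr : 0 < r) :
    (⋃ j : ℕ, ann (r * (1 / 2) ^ (j + 1))) = (ball (0 : Euc n) r \ {0}) := by
  ext y
  simp only [mem_iUnion, mem_ann, mem_sdiff, mem_ball_zero_iff, mem_singleton_iff]
  constructor
  · rintro ⟨j, h1, h2⟩
    refine ⟨lt_of_lt_of_le h1 ?_, ?_⟩
    · have : (1 / 2 : ℝ) ^ j ≤ 1 := pow_le_one₀ (by norm_num) (by norm_num)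
      rw [pow_succ]
      nlinarith
    · rintro rfl
      rw [norm_zero] at h2
      have : 0 < r * (1 / 2) ^ (j + 1) := by positivity
      linarith
  · rintro ⟨h1, h2⟩
    have hy : 0 < ‖y‖ := norm_pos_iff.mpr h2
    have hex : ∃ j : ℕ, r * (1 / 2) ^ (j + 1) ≤ ‖y‖ := by
      obtain ⟨k, hk⟩ := exists_pow_lt_of_lt_one (div_pos hy hr) (by norm_num : (1 / 2 : ℝ) < 1)
      rw [lt_div_iff₀ hr] at hk
      refine ⟨k, ?_⟩
      rw [pow_succ]
      nlinarith [pow_pos (by norm_num : (0 : ℝ) < 1 / 2) k]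
    classical
    refine ⟨Nat.find hex, ?_, Nat.find_spec hex⟩
    rcases Nat.eq_zero_or_pos (Nat.find hex) with h0 | h0
    · rw [h0]; norm_num; linarith
    · have := Nat.find_min hex (m := Nat.find hex - 1) (by omega)
      rw [Nat.sub_add_cancel h0] at this
      push Not at this
      rw [pow_succ]
      linarith

lemma iUnion_ann_far {r : ℝ} (hr : 0 < r) :
    (⋃ j : ℕ, ann (r * 2 ^ j)) = (ball (0 : Euc n) r)ᶜ := by
  ext y
  simp only [mem_iUnion, mem_ann, mem_compl_iff, mem_ball_zero_iff, not_lt]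
  constructor
  · rintro ⟨j, h1, h2⟩
    have : (1 : ℝ) ≤ 2 ^ j := one_le_pow₀ (by norm_num)
    nlinarith
  · intro h1
    obtain ⟨k, hk1, hk2⟩ := exists_nat_pow_near (x := ‖y‖ / r) (y := 2)
      (by rw [le_div_iff₀ hr]; linarith) one_lt_two
    refine ⟨k, ?_, ?_⟩
    · rw [div_lt_iff₀ hr, pow_succ] at hk2
      linarith
    · rw [le_div_iff₀ hr] at hk1
      linarith

lemma disjoint_ann {a b : ℝ} (h : 2 * a ≤ b) : Disjoint (ann a : Set (Euc n)) (ann b) := by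
  rw [Set.disjoint_left]
  intro y hy1 hy2
  rw [mem_ann] at hy1 hy2
  linarith

lemma pairwise_disjoint_near {r : ℝ} (hr : 0 < r) :
    Pairwise (Function.onFun Disjoint fun j : ℕ => (ann (r * (1 / 2) ^ (j + 1)) : Set (Euc n))) := by
  have key : ∀ i j : ℕ, i < j → 2 * (r * (1 / 2) ^ (j + 1)) ≤ r * (1 / 2) ^ (i + 1) := by
    intro i j hij
    have : (1 / 2 : ℝ) ^ j ≤ (1 / 2) ^ (i + 1) :=
      pow_le_pow_of_le_one (by norm_num) (by norm_num) hij
    rw [pow_succ (1 / 2 : ℝ) j]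
    nlinarith
  intro i j hij
  rcases lt_or_gt_of_ne hij with h | h
  · exact (disjoint_ann (key i j h)).symm
  · exact disjoint_ann (key j i h)

lemma pairwise_disjoint_far {r : ℝ} (hr : 0 < r) :
    Pairwise (Function.onFun Disjoint fun j : ℕ => (ann (r * 2 ^ j) : Set (Euc n))) := by
  have key : ∀ i j : ℕ, i < j → 2 * (r * 2 ^ i) ≤ r * 2 ^ j := by
    intro i j hij
    have : (2 : ℝ) ^ (i + 1) ≤ 2 ^ j := pow_le_pow_right₀ (by norm_num) hij
    rw [pow_succ] at this
    nlinarith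
  intro i j hij
  rcases lt_or_gt_of_ne hij with h | h
  · exact disjoint_ann (key i j h)
  · exact (disjoint_ann (key j i h)).symm

lemma hasSum_near {r ε : ℝ} (hr : 0 < r) (hε : 0 < ε) :
    HasSum (fun j : ℕ => (r * (1 / 2) ^ (j + 1)) ^ ε) (r ^ ε * ((1 / 2) ^ ε * geo ε)) := by
  have h := ((hasSum_geometric_of_lt_one (by positivity : (0 : ℝ) ≤ (1 / 2) ^ ε)
    (half_rpow_lt_one hε)).mul_left ((1 / 2 : ℝ) ^ ε)).mul_left (r ^ ε)
  refine (congrArg (fun f => HasSum f _) (funext fun j => ?_)).mpr h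
  rw [Real.mul_rpow hr.le (by positivity), ← pow_succ', ← Real.rpow_natCast, ← Real.rpow_natCast,
    ← Real.rpow_mul (by norm_num), ← Real.rpow_mul (by norm_num), mul_comm ε]

lemma hasSum_far {r ε : ℝ} (hr : 0 < r) (hε : 0 < ε) :
    HasSum (fun j : ℕ => (r * 2 ^ j) ^ (-ε)) (r ^ (-ε) * geo ε) := by
  have h := ((hasSum_geometric_of_lt_one (by positivity : (0 : ℝ) ≤ (1 / 2) ^ ε)
    (half_rpow_lt_one hε))).mul_left (r ^ (-ε))
  refine (congrArg (fun f => HasSum f _) (funext fun j => ?_)).mpr h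
  rw [Real.mul_rpow hr.le (by positivity), ← Real.rpow_natCast, ← Real.rpow_natCast,
    ← Real.rpow_mul (by norm_num), ← Real.rpow_mul (by norm_num), one_div,
    Real.inv_rpow (by norm_num), ← Real.rpow_neg (by norm_num)]
  ring_nf

lemma near_sum_le {r ε : ℝ} (hr : 0 < r) (hε : 0 < ε) :
    r ^ ε * ((1 / 2 : ℝ) ^ ε * geo ε) ≤ r ^ ε * geo ε := by
  have := geo_pos hε
  have h1 := (half_rpow_lt_one hε).le
  gcongr
  nlinarith

/-- The upper growth condition in the definition of uniform ellipticity. -/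
def UpperGrowth (s Lam : ℝ) (K : Measure (Euc n)) : Prop :=
  ∀ r : ℝ, 0 < r → ENNReal.ofReal (r ^ (2 * s)) * K (ann r) ≤ ENNReal.ofReal Lam

lemma UpperGrowth.ann_le {s Lam : ℝ} {K : Measure (Euc n)} (hK : UpperGrowth s Lam K)
    {r : ℝ} (hr : 0 < r) : K (ann r) ≤ ENNReal.ofReal (Lam * r ^ (-(2 * s))) := by
  have h := hK r hr
  have hp : 0 < r ^ (2 * s) := by positivity
  have h2 : K (ann r) = ENNReal.ofReal (r ^ (-(2 * s))) * (ENNReal.ofReal (r ^ (2 * s)) * K (ann r)) := by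
    rw [← mul_assoc, ← ENNReal.ofReal_mul (by positivity), ← Real.rpow_add hr]
    simp
  rw [h2, mul_comm Lam, ENNReal.ofReal_mul (by positivity)]
  gcongr

lemma UpperGrowth.compl_ball_le {s Lam : ℝ} {K : Measure (Euc n)} (hK : UpperGrowth s Lam K)
    (hs : 0 < s) (hL : 0 ≤ Lam) {r : ℝ} (hr : 0 < r) :
    K (ball 0 r)ᶜ ≤ ENNReal.ofReal (Lam * geo (2 * s) * r ^ (-(2 * s))) := by
  have h := (hasSum_far hr (by positivity : 0 < 2 * s)).mul_left Lam
  rw [← iUnion_ann_far hr, measure_iUnion (pairwise_disjoint_far hr)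
    (fun j => measurableSet_ann _), show Lam * geo (2 * s) * r ^ (-(2 * s)) =
      Lam * (r ^ (-(2 * s)) * geo (2 * s)) by ring, ← h.tsum_eq,
    ENNReal.ofReal_tsum_of_nonneg (fun j => by positivity) h.summable]
  exact ENNReal.tsum_le_tsum fun j => hK.ann_le (by positivity)

lemma UpperGrowth.lintegral_ball_le {s Lam σ : ℝ} {K : Measure (Euc n)}
    (hK : UpperGrowth s Lam K) (hs : 0 < s) (hσ : 2 * s < σ) (hL : 0 ≤ Lam) {r : ℝ} (hr : 0 < r) :
    ∫⁻ y in ball 0 r, ENNReal.ofReal (‖y‖ ^ σ) ∂K ≤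
      ENNReal.ofReal (2 ^ σ * Lam * geo (σ - 2 * s) * r ^ (σ - 2 * s)) := by
  have hσ0 : 0 < σ := by linarith
  have hε : 0 < σ - 2 * s := by linarith
  have h := (hasSum_near hr hε).mul_left (2 ^ σ * Lam)
  have e1 : ∫⁻ y in ball 0 r, ENNReal.ofReal (‖y‖ ^ σ) ∂K =
      ∫⁻ y in ball 0 r \ {0}, ENNReal.ofReal (‖y‖ ^ σ) ∂K := by
    rw [← lintegral_indicator measurableSet_ball,
      ← lintegral_indicator (measurableSet_ball.diff (measurableSet_singleton 0))]
    congr 1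
    ext y
    by_cases hy : y = 0
    · subst hy
      simp [Real.zero_rpow hσ0.ne', Set.indicator]
    · simp [Set.indicator, hy]
  have e2 : ENNReal.ofReal (2 ^ σ * Lam * (r ^ (σ - 2 * s) * ((1 / 2) ^ (σ - 2 * s) * geo (σ - 2 * s))))
      ≤ ENNReal.ofReal (2 ^ σ * Lam * geo (σ - 2 * s) * r ^ (σ - 2 * s)) := by
    apply ENNReal.ofReal_le_ofReal
    have := near_sum_le hr hε
    calc _ ≤ 2 ^ σ * Lam * (r ^ (σ - 2 * s) * geo (σ - 2 * s)) := by gcongr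
      _ = _ := by ring
  refine le_trans ?_ e2
  rw [e1, ← iUnion_ann_near hr, lintegral_iUnion (fun j => measurableSet_ann _)
    (pairwise_disjoint_near hr), ← h.tsum_eq,
    ENNReal.ofReal_tsum_of_nonneg (fun j => by positivity) h.summable]
  refine ENNReal.tsum_le_tsum fun j => ?_
  set ρ := r * (1 / 2) ^ (j + 1) with hρ
  have hρ0 : 0 < ρ := by positivity
  calc ∫⁻ y in ann ρ, ENNReal.ofReal (‖y‖ ^ σ) ∂K
      ≤ ∫⁻ y in ann ρ, ENNReal.ofReal ((2 * ρ) ^ σ) ∂K := by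
        refine setLIntegral_mono measurable_const fun y hy => ?_
        rw [mem_ann] at hy
        apply ENNReal.ofReal_le_ofReal
        exact Real.rpow_le_rpow (norm_nonneg _) hy.1.le hσ0.le
    _ = ENNReal.ofReal ((2 * ρ) ^ σ) * K (ann ρ) := by rw [setLIntegral_const]
    _ ≤ ENNReal.ofReal ((2 * ρ) ^ σ) * ENNReal.ofReal (Lam * ρ ^ (-(2 * s))) := by
        gcongr; exact hK.ann_le hρ0
    _ = ENNReal.ofReal (2 ^ σ * Lam * ρ ^ (σ - 2 * s)) := by
        rw [← ENNReal.ofReal_mul (by positivity), Real.mul_rpow (by norm_num) hρ0.le,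
          show σ - 2 * s = σ + -(2 * s) by ring, Real.rpow_add hρ0]
        ring_nf

lemma abs_integral_iUnion_sub_le {μ ν : Measure (Euc n)} {φ : Euc n → ℝ} {A : ℕ → Set (Euc n)}
    {a : ℕ → ℝ} {S : ℝ} (hA : ∀ j, MeasurableSet (A j)) (hd : Pairwise (Function.onFun Disjoint A))
    (hμ : IntegrableOn φ (⋃ j, A j) μ) (hν : IntegrableOn φ (⋃ j, A j) ν)
    (ha : ∀ j, |(∫ y in A j, φ y ∂μ) - ∫ y in A j, φ y ∂ν| ≤ a j) (hS : HasSum a S) :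
    |(∫ y in ⋃ j, A j, φ y ∂μ) - ∫ y in ⋃ j, A j, φ y ∂ν| ≤ S := by
  have h := (hasSum_integral_iUnion hA hd hμ).sub (hasSum_integral_iUnion hA hd hν)
  rw [← h.tsum_eq, ← Real.norm_eq_abs]
  exact tsum_of_norm_bounded hS ha

lemma UpperGrowth.compl_ball_lt_top {s Lam : ℝ} {K : Measure (Euc n)} (hK : UpperGrowth s Lam K)
    (hs : 0 < s) (hL : 0 ≤ Lam) {r : ℝ} (hr : 0 < r) : K (ball 0 r)ᶜ < ⊤ :=
  (hK.compl_ball_le hs hL hr).trans_lt ENNReal.ofReal_lt_top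

lemma UpperGrowth.real_compl_ball_le {s Lam : ℝ} {K : Measure (Euc n)} (hK : UpperGrowth s Lam K)
    (hs : 0 < s) (hL : 0 ≤ Lam) {r : ℝ} (hr : 0 < r) :
    K.real (ball 0 r)ᶜ ≤ Lam * geo (2 * s) * r ^ (-(2 * s)) := by
  have := geo_pos (by positivity : 0 < 2 * s)
  exact ENNReal.toReal_le_of_le_ofReal (by positivity) (hK.compl_ball_le hs hL hr)

lemma measurable_norm_rpow (σ : ℝ) : Measurable fun y : Euc n => ‖y‖ ^ σ :=
  measurable_norm.pow_const σ

lemma UpperGrowth.integrableOn_rpow {s Lam σ : ℝ} {K : Measure (Euc n)}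
    (hK : UpperGrowth s Lam K) (hs : 0 < s) (hσ : 2 * s < σ) (hL : 0 ≤ Lam) {r : ℝ} (hr : 0 < r) :
    IntegrableOn (fun y => ‖y‖ ^ σ) (ball 0 r) K := by
  refine ⟨(measurable_norm_rpow σ).aestronglyMeasurable, ?_⟩
  rw [hasFiniteIntegral_iff_ofReal (by filter_upwards with y; positivity)]
  exact (hK.lintegral_ball_le hs hσ hL hr).trans_lt ENNReal.ofReal_lt_top

lemma UpperGrowth.integral_rpow_le {s Lam σ : ℝ} {K : Measure (Euc n)}
    (hK : UpperGrowth s Lam K) (hs : 0 < s) (hσ : 2 * s < σ) (hL : 0 ≤ Lam) {r : ℝ} (hr : 0 < r) :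
    ∫ y in ball 0 r, ‖y‖ ^ σ ∂K ≤ 2 ^ σ * Lam * geo (σ - 2 * s) * r ^ (σ - 2 * s) := by
  have := geo_pos (by linarith : 0 < σ - 2 * s)
  rw [integral_eq_lintegral_of_nonneg_ae (by filter_upwards with y; positivity)
    (measurable_norm_rpow σ).aestronglyMeasurable]
  exact ENNReal.toReal_le_of_le_ofReal (by positivity) (hK.lintegral_ball_le hs hσ hL hr)

lemma UpperGrowth.integrable_of_le {s Lam σ : ℝ} {K : Measure (Euc n)}
    (hK : UpperGrowth s Lam K) (hs : 0 < s) (hσ : 2 * s < σ) (hL : 0 ≤ Lam) {r B B' : ℝ}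
    (hr : 0 < r) {g : Euc n → ℝ} (hg : Continuous g) (h1 : ∀ y, ‖y‖ < r → |g y| ≤ B * ‖y‖ ^ σ)
    (h2 : ∀ y, |g y| ≤ B') : Integrable g K := by
  rw [← integrableOn_univ, ← Set.union_compl_self (ball (0 : Euc n) r)]
  refine IntegrableOn.union ?_ ?_
  · refine Integrable.mono' ((hK.integrableOn_rpow hs hσ hL hr).const_mul B)
      hg.aestronglyMeasurable ?_
    filter_upwards [ae_restrict_mem measurableSet_ball] with y hy
    exact h1 y (by simpa using hy)
  · exact Measure.integrableOn_of_bounded (hK.compl_ball_lt_top hs hL hr).ne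
      hg.aestronglyMeasurable (M := B') (by filter_upwards with y; exact h2 y)

lemma integral_neg_eq_of_symm {K : Measure (Euc n)} (hK : Measure.map (fun y => -y) K = K)
    (g : Euc n → ℝ) : ∫ y, g (-y) ∂K = ∫ y, g y ∂K := by
  conv_rhs => rw [← hK]
  exact ((MeasurableEquiv.neg (Euc n)).measurableEmbedding.integral_map (g := g)).symm

lemma exists_cone_mass (n : ℕ) {s lam Lam : ℝ} (hs : 0 < s) (hs1 : s < 1) (hlam : 0 < lam)
    (hL : 0 < Lam) :
    ∃ c > 0, ∃ c' > 0, ∀ K : Measure (Euc n), Measure.map (fun y => -y) K = K →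
      UnifElliptic s lam Lam K → ∀ r > 0, ∀ e : Euc n, ‖e‖ = 1 →
        ENNReal.ofReal (c' * r ^ (-(2 * s))) ≤ K {y | ‖y‖ < r ∧ c * r ≤ ⟪e, y⟫} := by
  have hg := geo_pos (by linarith : 0 < 1 + s - 2 * s)
  set Ca := 2 ^ (1 + s) * Lam * geo (1 + s - 2 * s) with hCa
  have hCa0 : 0 < Ca := by positivity
  have h1s : 0 < 1 - s := by linarith
  refine ⟨(lam / (2 * Ca)) ^ (1 / (1 - s)), by positivity, lam / 8, by positivity, ?_⟩
  set c := (lam / (2 * Ca)) ^ (1 / (1 - s)) with hc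
  have hc0 : 0 < c := by positivity
  have hcs : c ^ (1 - s) * Ca = lam / 2 := by
    rw [hc, ← Real.rpow_mul (by positivity), one_div_mul_cancel h1s.ne', Real.rpow_one]
    field_simp
  intro K hsym hK r hr e he
  have hup : UpperGrowth s Lam K := hK.1
  have hlow := hK.2 r hr e he
  set G : Set (Euc n) := {y | ‖y‖ < r ∧ c * r ≤ ⟪e, y⟫} with hG
  set G' : Set (Euc n) := {y | ‖y‖ < r ∧ c * r ≤ -⟪e, y⟫} with hG'
  have hin : Measurable fun y : Euc n => ⟪e, y⟫ := measurable_const.inner measurable_id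
  have hmG : MeasurableSet G :=
    (measurableSet_lt measurable_norm measurable_const).inter
      (measurableSet_le measurable_const hin)
  have hmG' : MeasurableSet G' :=
    (measurableSet_lt measurable_norm measurable_const).inter
      (measurableSet_le measurable_const hin.neg)
  have hGG' : K G' = K G := by
    conv_rhs => rw [← hsym]
    rw [Measure.map_apply measurable_neg hmG]
    congr 1
    ext y
    simp [hG, hG']
  by_contra hcon
  push Not at hcon
  have hpt : ∀ y ∈ ball (0 : Euc n) r, ENNReal.ofReal (⟪e, y⟫ ^ 2) ≤
      ENNReal.ofReal ((c * r) ^ (1 - s)) * ENNReal.ofReal (‖y‖ ^ (1 + s)) +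
        (G.indicator (fun _ => ENNReal.ofReal (r ^ 2)) y +
          G'.indicator (fun _ => ENNReal.ofReal (r ^ 2)) y) := by
    intro y hy
    rw [mem_ball_zero_iff] at hy
    have hin : |⟪e, y⟫| ≤ ‖y‖ := by
      have := abs_real_inner_le_norm e y
      rwa [he, one_mul] at this
    have hr2 : ⟪e, y⟫ ^ 2 ≤ r ^ 2 := by
      rw [← sq_abs]; gcongr; linarith
    by_cases h1 : y ∈ G
    · rw [Set.indicator_of_mem h1]
      exact (ENNReal.ofReal_le_ofReal hr2).trans (le_add_left (le_add_right le_rfl))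
    by_cases h2 : y ∈ G'
    · rw [Set.indicator_of_mem h2]
      exact (ENNReal.ofReal_le_ofReal hr2).trans (le_add_left (le_add_left le_rfl))
    refine le_add_right ?_
    rw [← ENNReal.ofReal_mul (by positivity)]
    apply ENNReal.ofReal_le_ofReal
    have h3 : |⟪e, y⟫| ≤ c * r := by
      simp only [hG, hG', mem_ofPred_eq, not_and, not_le] at h1 h2
      rw [abs_le]
      constructor <;> linarith [h1 hy, h2 hy]
    calc ⟪e, y⟫ ^ 2 = |⟪e, y⟫| ^ (1 - s) * |⟪e, y⟫| ^ (1 + s) := by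
          rw [← Real.rpow_add_of_nonneg (abs_nonneg _) (by linarith) (by linarith),
            show 1 - s + (1 + s) = 2 by ring, Real.rpow_two, sq_abs]
      _ ≤ (c * r) ^ (1 - s) * ‖y‖ ^ (1 + s) := by
          gcongr
  have hintg := setLIntegral_mono' (μ := K) measurableSet_ball hpt
  have hmeas : Measurable fun y : Euc n => ENNReal.ofReal ((c * r) ^ (1 - s)) *
      ENNReal.ofReal (‖y‖ ^ (1 + s)) := ((measurable_norm_rpow _).ennreal_ofReal).const_mul _
  rw [lintegral_add_left hmeas, lintegral_add_left (measurable_const.indicator hmG),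
    lintegral_const_mul _ ((measurable_norm_rpow _).ennreal_ofReal),
    lintegral_indicator hmG, lintegral_indicator hmG', setLIntegral_const, setLIntegral_const] at hintg
  have hb1 := hup.lintegral_ball_le hs (by linarith : 2 * s < 1 + s) hL.le hr
  have hb2 : (K.restrict (ball 0 r)) G ≤ K G := Measure.restrict_apply_le _ _
  have hb3 : (K.restrict (ball 0 r)) G' ≤ K G := hGG' ▸ Measure.restrict_apply_le _ _
  have hfin : ENNReal.ofReal lam ≤ ENNReal.ofReal (r ^ (2 * s - 2)) *
      (ENNReal.ofReal ((c * r) ^ (1 - s)) * ENNReal.ofReal (Ca * r ^ (1 + s - 2 * s)) +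
        (ENNReal.ofReal (r ^ 2) * ENNReal.ofReal (lam / 8 * r ^ (-(2 * s))) +
          ENNReal.ofReal (r ^ 2) * ENNReal.ofReal (lam / 8 * r ^ (-(2 * s))))) := by
    refine hlow.trans ?_
    gcongr
    refine hintg.trans ?_
    gcongr
    · exact hb2.trans hcon.le
    · exact hb3.trans hcon.le
  rw [← ENNReal.ofReal_mul (by positivity), ← ENNReal.ofReal_mul (by positivity),
    ← ENNReal.ofReal_add (by positivity) (by positivity),
    ← ENNReal.ofReal_add (by positivity) (by positivity), ← ENNReal.ofReal_mul (by positivity),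
    ENNReal.ofReal_le_ofReal_iff (by positivity)] at hfin
  have e1 : r ^ (2 * s - 2) * ((c * r) ^ (1 - s) * (Ca * r ^ (1 + s - 2 * s))) = lam / 2 := by
    rw [← hcs, Real.mul_rpow hc0.le hr.le]
    have : r ^ (2 * s - 2) * (r ^ (1 - s) * r ^ (1 + s - 2 * s)) = 1 := by
      rw [← Real.rpow_add hr, ← Real.rpow_add hr]
      ring_nf
      exact Real.rpow_zero r
    linear_combination (c ^ (1 - s) * Ca) * this
  have e2 : r ^ (2 * s - 2) * (r ^ 2 * (lam / 8 * r ^ (-(2 * s)))) = lam / 8 := by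
    have : r ^ (2 * s - 2) * (r ^ 2 * r ^ (-(2 * s))) = 1 := by
      rw [← Real.rpow_two, ← Real.rpow_add hr, ← Real.rpow_add hr]
      ring_nf
      exact Real.rpow_zero r
    linear_combination (lam / 8) * this
  rw [mul_add, mul_add, e1, e2] at hfin
  linarith

section TotalVariation

lemma restrict_add_sub_eq {μ ν : Measure (Euc n)} [IsFiniteMeasure μ] [IsFiniteMeasure ν]
    {t : Set (Euc n)} (ht : MeasurableSet t) (h : μ.restrict t ≤ ν.restrict t) :
    (μ + (ν - μ)).restrict t = (ν + (μ - ν)).restrict t := by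
  rw [Measure.restrict_add, Measure.restrict_add,
    Measure.restrict_sub_eq_restrict_sub_restrict ht,
    Measure.restrict_sub_eq_restrict_sub_restrict ht, Measure.sub_eq_zero_of_le h, add_zero,
    add_comm, Measure.sub_add_cancel_of_le h]

lemma add_sub_eq_add_sub (μ ν : Measure (Euc n)) [IsFiniteMeasure μ] [IsFiniteMeasure ν] :
    μ + (ν - μ) = ν + (μ - ν) := by
  obtain ⟨t, ht⟩ := exists_isHahnDecomposition μ ν
  rw [← Measure.restrict_add_restrict_compl (μ := μ + (ν - μ)) ht.measurableSet,
    ← Measure.restrict_add_restrict_compl (μ := ν + (μ - ν)) ht.measurableSet,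
    restrict_add_sub_eq ht.measurableSet ht.le_on,
    ← restrict_add_sub_eq ht.measurableSet.compl ht.ge_on_compl]

lemma abs_setIntegral_sub_le_tvDiff {μ ν : Measure (Euc n)} {A : Set (Euc n)} (hμ : μ A ≠ ⊤)
    (hν : ν A ≠ ⊤) {g : Euc n → ℝ} (hg : Continuous g) {B : ℝ} (hB : ∀ y, |g y| ≤ B) :
    |(∫ y in A, g y ∂μ) - ∫ y in A, g y ∂ν| ≤ B * (tvDiff μ ν A).toReal := by
  have : IsFiniteMeasure (μ.restrict A) := ⟨by simpa using hμ.lt_top⟩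
  have : IsFiniteMeasure (ν.restrict A) := ⟨by simpa using hν.lt_top⟩
  have : IsFiniteMeasure (μ.restrict A - ν.restrict A) := isFiniteMeasure_of_le _ Measure.sub_le
  have : IsFiniteMeasure (ν.restrict A - μ.restrict A) := isFiniteMeasure_of_le _ Measure.sub_le
  have hi : ∀ m : Measure (Euc n), IsFiniteMeasure m → Integrable g m := fun m _ =>
    Integrable.of_bound hg.aestronglyMeasurable B (by filter_upwards with y; exact hB y)
  have h : ∫ y, g y ∂(μ.restrict A + (ν.restrict A - μ.restrict A)) =
      ∫ y, g y ∂(ν.restrict A + (μ.restrict A - ν.restrict A)) := by rw [add_sub_eq_add_sub]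
  rw [integral_add_measure (hi _ inferInstance) (hi _ inferInstance),
    integral_add_measure (hi _ inferInstance) (hi _ inferInstance)] at h
  have hb : ∀ m : Measure (Euc n), IsFiniteMeasure m → |∫ y, g y ∂m| ≤ B * m.real univ := fun m _ =>
    norm_integral_le_of_norm_le_const (f := g) (by filter_upwards with y; exact hB y)
  have h1 := abs_le.mp (hb (μ.restrict A - ν.restrict A) inferInstance)
  have h2 := abs_le.mp (hb (ν.restrict A - μ.restrict A) inferInstance)
  unfold tvDiff
  rw [ENNReal.toReal_add (measure_ne_top _ _) (measure_ne_top _ _), mul_add]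
  simp only [Measure.real] at h1 h2
  rw [abs_le]
  constructor <;> linarith [h1.1, h1.2, h2.1, h2.2]

end TotalVariation

/-- A Lipschitz cutoff, equal to `0` on `B_r` and to `1` outside `B_{2r}`. -/
def chi (r : ℝ) (y : Euc n) : ℝ := max 0 (min 1 (‖y‖ / r - 1))

section Cutoff

lemma chi_nonneg (r : ℝ) (y : Euc n) : 0 ≤ chi r y := le_max_left _ _

lemma chi_le_one (r : ℝ) (y : Euc n) : chi r y ≤ 1 := max_le zero_le_one (min_le_left _ _)

lemma chi_eq_zero {r : ℝ} (hr : 0 < r) {y : Euc n} (hy : ‖y‖ ≤ r) : chi r y = 0 := by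
  have : ‖y‖ / r ≤ 1 := (div_le_one hr).mpr hy
  exact max_eq_left ((min_le_right _ _).trans (by linarith))

lemma chi_eq_one {r : ℝ} (hr : 0 < r) {y : Euc n} (hy : 2 * r ≤ ‖y‖) : chi r y = 1 := by
  have : 2 ≤ ‖y‖ / r := (le_div_iff₀ hr).mpr hy
  rw [chi, min_eq_left (by linarith), max_eq_right zero_le_one]

lemma chi_neg (r : ℝ) (y : Euc n) : chi r (-y) = chi r y := by simp [chi]

lemma continuous_chi (r : ℝ) : Continuous (chi r : Euc n → ℝ) := by
  unfold chi; fun_prop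

lemma abs_chi_sub_le {r : ℝ} (hr : 0 < r) (y y' : Euc n) :
    |chi r y - chi r y'| ≤ ‖y - y'‖ / r := by
  have h1 : |chi r y - chi r y'| ≤ |(‖y‖ / r - 1) - (‖y'‖ / r - 1)| := by
    unfold chi
    refine (abs_max_sub_max_le_max _ _ _ _).trans (max_le (by simp) ?_)
    refine (abs_min_sub_min_le_max _ _ _ _).trans (max_le (by simp) le_rfl)
  refine h1.trans ?_
  rw [show (‖y‖ / r - 1) - (‖y'‖ / r - 1) = (‖y‖ - ‖y'‖) / r by ring, abs_div, abs_of_pos hr]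
  gcongr
  exact abs_norm_sub_norm_le _ _

end Cutoff

section Differences

variable {γ D : ℝ} {u : Euc n → ℝ}

lemma rpow_mul_le_of_one_le {γ c t : ℝ} (hγ1 : γ ≤ 1) (hc : 1 ≤ c) (ht : 0 ≤ t) :
    (c * t) ^ γ ≤ c * t ^ γ := by
  rw [Real.mul_rpow (by linarith) ht]
  gcongr
  calc c ^ γ ≤ c ^ (1 : ℝ) := Real.rpow_le_rpow_of_exponent_le hc hγ1
    _ = c := Real.rpow_one c

lemma abs_cd2_le_of_holder
    (hu : ∀ x y, |u x - u y| ≤ D * ‖x - y‖ ^ γ) (x h : Euc n) :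
    |cd2 u x h| ≤ 2 * D * ‖h‖ ^ γ := by
  have h1 := hu (x + h) x
  have h2 := hu (x - h) x
  rw [add_sub_cancel_left] at h1
  rw [sub_sub_cancel_left, norm_neg] at h2
  rw [show cd2 u x h = (u (x + h) - u x) + (u (x - h) - u x) by unfold cd2; ring]
  refine (abs_add_le _ _).trans ?_
  linarith

lemma abs_cd3_le_of_holder (hγ1 : γ ≤ 1) (hD : 0 ≤ D)
    (hu : ∀ x y, |u x - u y| ≤ D * ‖x - y‖ ^ γ) (x h : Euc n) :
    |cd3 u x h| ≤ 12 * D * ‖h‖ ^ γ := by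
  have h1 := hu (x + (3 : ℝ) • h) (x - (3 : ℝ) • h)
  have h2 := hu (x + h) (x - h)
  rw [show x + (3 : ℝ) • h - (x - (3 : ℝ) • h) = (6 : ℝ) • h by module, norm_smul] at h1
  rw [show x + h - (x - h) = (2 : ℝ) • h by module, norm_smul] at h2
  rw [show cd3 u x h = (u (x + (3 : ℝ) • h) - u (x - (3 : ℝ) • h)) - 3 * (u (x + h) - u (x - h)) by
    unfold cd3; ring]
  have e1 := rpow_mul_le_of_one_le hγ1 (by norm_num : (1 : ℝ) ≤ 6) (norm_nonneg h)
  have e2 := rpow_mul_le_of_one_le hγ1 (by norm_num : (1 : ℝ) ≤ 2) (norm_nonneg h)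
  simp only [Real.norm_ofNat] at h1 h2
  have f1 := h1.trans (mul_le_mul_of_nonneg_left e1 hD)
  have f2 := h2.trans (mul_le_mul_of_nonneg_left e2 hD)
  have := abs_sub (u (x + (3 : ℝ) • h) - u (x - (3 : ℝ) • h)) (3 * (u (x + h) - u (x - h)))
  rw [abs_mul, abs_of_pos (by norm_num : (0 : ℝ) < 3)] at this
  linarith

lemma cd3_eq_cd2_sub (u : Euc n → ℝ) (x h : Euc n) :
    cd3 u x h = cd2 u (x + h) ((2 : ℝ) • h) - cd2 u (x - h) ((2 : ℝ) • h) := by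
  unfold cd2 cd3
  rw [show x + h + (2 : ℝ) • h = x + (3 : ℝ) • h by module,
    show x + h - (2 : ℝ) • h = x - h by module,
    show x - h + (2 : ℝ) • h = x + h by module,
    show x - h - (2 : ℝ) • h = x - (3 : ℝ) • h by module]
  ring

end Differences

section Far

lemma UpperGrowth.abs_integral_le_of_far {s Lam : ℝ} {K : Measure (Euc n)}
    (hK : UpperGrowth s Lam K) (hs : 0 < s) (hL : 0 ≤ Lam) {r B : ℝ} (hr : 0 < r)
    {g : Euc n → ℝ} (h0 : ∀ y, ‖y‖ < r → g y = 0) (hB : ∀ y, |g y| ≤ B) :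
    |∫ y, g y ∂K| ≤ B * (Lam * geo (2 * s) * r ^ (-(2 * s))) := by
  have hB0 : 0 ≤ B := (abs_nonneg _).trans (hB 0)
  rw [← setIntegral_eq_integral_of_forall_compl_eq_zero (s := (ball (0 : Euc n) r)ᶜ)
    (fun y hy => h0 y (by simpa using hy))]
  refine (norm_setIntegral_le_of_norm_le_const (f := g) (hK.compl_ball_lt_top hs hL hr)
    (fun y _ => hB y)).trans ?_
  gcongr
  exact hK.real_compl_ball_le hs hL hr

lemma UpperGrowth.integrable_of_far {s Lam : ℝ} {K : Measure (Euc n)}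
    (hK : UpperGrowth s Lam K) (hs : 0 < s) (hL : 0 ≤ Lam) {r B : ℝ} (hr : 0 < r)
    {g : Euc n → ℝ} (hg : Continuous g) (h0 : ∀ y, ‖y‖ < r → g y = 0) (hB : ∀ y, |g y| ≤ B) :
    Integrable g K :=
  hK.integrable_of_le (σ := 2 * s + 1) (B := 0) hs (by linarith) hL hr hg
    (fun y hy => by rw [h0 y hy]; simp) hB

lemma tvDiff_le_of_kernelHolder {s θ M : ℝ} (hM : 0 ≤ M) {K : Measure (Euc n)}
    (hK : kernelHolder s θ K ≤ ENNReal.ofReal M) {h : Euc n} (hh : h ≠ 0) {ρ : ℝ} (hρ : 0 < ρ)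
    (hhρ : ‖h‖ < ρ / 2) :
    (tvDiff (Measure.map (fun y => h - y) K) (Measure.map (fun y => -h - y) K) (ann ρ)).toReal ≤
      M * (2 * ‖h‖) ^ θ * ρ ^ (-(2 * s + θ)) := by
  have hne : h ≠ -h := fun h' => hh (by
    have h2 : (2 : ℝ) • h = 0 := by rw [two_smul]; nth_rewrite 2 [h']; exact add_neg_cancel h
    exact (smul_eq_zero.mp h2).resolve_left two_ne_zero)
  have hn : 0 < ‖h‖ := norm_pos_iff.mpr hh
  have h2 : ENNReal.ofReal (ρ ^ (2 * s + θ) / ‖h - -h‖ ^ θ) *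
      tvDiff (Measure.map (fun y => h - y) K) (Measure.map (fun y => -h - y) K) (ann ρ) ≤
      ENNReal.ofReal M := by
    refine le_trans ?_ hK
    unfold kernelHolder
    refine le_iSup_of_le ρ (le_iSup_of_le hρ (le_iSup_of_le h (le_iSup_of_le (-h)
      (le_iSup_of_le (by simpa using hhρ) (le_iSup_of_le (by simpa using hhρ)
        (le_iSup_of_le hne le_rfl))))))
  rw [show h - -h = (2 : ℝ) • h by module, norm_smul, Real.norm_ofNat] at h2
  refine ENNReal.toReal_le_of_le_ofReal (by positivity) ?_
  set q := ρ ^ (2 * s + θ) / (2 * ‖h‖) ^ θ with hq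
  have hq0 : 0 < q := by positivity
  have e : ENNReal.ofReal (q⁻¹) * ENNReal.ofReal q = 1 := by
    rw [← ENNReal.ofReal_mul (by positivity), inv_mul_cancel₀ hq0.ne', ENNReal.ofReal_one]
  calc tvDiff (Measure.map (fun y => h - y) K) (Measure.map (fun y => -h - y) K) (ann ρ)
      = ENNReal.ofReal (q⁻¹) * (ENNReal.ofReal q *
        tvDiff (Measure.map (fun y => h - y) K) (Measure.map (fun y => -h - y) K) (ann ρ)) := by
        rw [← mul_assoc, e, one_mul]
    _ ≤ ENNReal.ofReal (q⁻¹) * ENNReal.ofReal M := by gcongr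
    _ = _ := by
        rw [← ENNReal.ofReal_mul (by positivity)]
        congr 1
        rw [hq, inv_div, Real.rpow_neg hρ.le]
        ring

/-- Translating a far-away weight against a kernel that is Hölder continuous in total variation. -/
lemma abs_integral_map_sub_le {s θ Lam M : ℝ} (hs : 0 < s) (hθ : 0 < θ) (hL : 0 ≤ Lam)
    (hM : 0 ≤ M) {K : Measure (Euc n)}
    (hup : UpperGrowth s Lam K) (hK : kernelHolder s θ K ≤ ENNReal.ofReal M) {h : Euc n} (hh : h ≠ 0)
    {r B : ℝ} (hr : 0 < r) (hhr : ‖h‖ ≤ r / 4) {g : Euc n → ℝ} (hg : Continuous g)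
    (h0 : ∀ y, ‖y‖ < r → g y = 0) (hB : ∀ y, |g y| ≤ B) :
    |(∫ y, g (h - y) ∂K) - ∫ y, g (-h - y) ∂K| ≤
      B * (M * (2 * ‖h‖) ^ θ) * (r ^ (-(2 * s + θ)) * geo (2 * s + θ)) := by
  have hB0 : 0 ≤ B := (abs_nonneg _).trans (hB 0)
  have hemb : ∀ a : Euc n, MeasurableEmbedding (fun y : Euc n => a - y) := fun a =>
    (Homeomorph.subLeft a).measurableEmbedding
  have hintg : ∀ a : Euc n, ‖a‖ ≤ r / 4 → Integrable g (Measure.map (fun y => a - y) K) := by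
    intro a ha
    rw [(hemb a).integrable_map_iff]
    refine hup.integrable_of_far hs hL (r := r / 2) (by positivity) (by fun_prop)
      (fun y hy => h0 _ ?_) (fun y => hB _)
    have := norm_sub_le a y
    simp only at *
    linarith
  have hfin : ∀ a : Euc n, ‖a‖ ≤ r / 4 → ∀ ρ, r ≤ ρ → Measure.map (fun y => a - y) K (ann ρ) ≠ ⊤ := by
    intro a ha ρ hρ
    rw [(hemb a).map_apply]
    refine ((measure_mono ?_).trans_lt (hup.compl_ball_lt_top hs hL (half_pos hr))).ne
    intro y hy
    rw [mem_preimage, mem_ann] at hy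
    have := norm_sub_le a y
    simp only [mem_compl_iff, mem_ball_zero_iff, not_lt]
    linarith
  have hhn : ‖-h‖ ≤ r / 4 := by rwa [norm_neg]
  rw [← (hemb h).integral_map g, ← (hemb (-h)).integral_map g]
  have hz : ∀ y, y ∉ (⋃ j : ℕ, ann (r * 2 ^ j)) → g y = 0 := by
    intro y hy
    rw [iUnion_ann_far hr] at hy
    exact h0 y (by simpa using hy)
  rw [← setIntegral_eq_integral_of_forall_compl_eq_zero (μ := Measure.map (fun y => h - y) K) hz,
    ← setIntegral_eq_integral_of_forall_compl_eq_zero (μ := Measure.map (fun y => -h - y) K) hz]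
  have hgeo : ∀ j : ℕ, r ≤ r * 2 ^ j := fun j =>
    le_mul_of_one_le_right hr.le (one_le_pow₀ (by norm_num))
  refine abs_integral_iUnion_sub_le (fun j => measurableSet_ann _) (pairwise_disjoint_far hr)
    (hintg h hhr).integrableOn (hintg _ hhn).integrableOn (fun j => ?_)
    ((hasSum_far hr (by positivity : 0 < 2 * s + θ)).mul_left _)
  refine (abs_setIntegral_sub_le_tvDiff (hfin h hhr _ (hgeo j)) (hfin _ hhn _ (hgeo j)) hg hB).trans ?_
  rw [mul_assoc]
  gcongr
  refine tvDiff_le_of_kernelHolder hM hK hh (by positivity) ?_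
  have := hgeo j
  linarith

/-- The far part of the operator applied to a third difference. -/
lemma exists_far_bound (n : ℕ) {s γ α Lam M : ℝ} (hs : 0 < s) (hs1 : s < 1) (hγ : 0 ≤ γ) (hγ1 : γ < 1)
    (hα : 0 < α) (hα1 : α ≤ 1) (hL : 0 ≤ Lam) (hM : 0 ≤ M) :
    ∃ C ≥ 0, ∀ K : Measure (Euc n), Measure.map (fun y => -y) K = K → UpperGrowth s Lam K →
      (γ < α → kernelHolder s (α - γ) K ≤ ENNReal.ofReal M) → ∀ u : Euc n → ℝ, Continuous u →
      ∀ D ≥ 0, (∀ x y, |u x - u y| ≤ D * ‖x - y‖ ^ γ) → ∀ r > 0, r ≤ 1 → ∀ h : Euc n,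
      ‖h‖ ≤ r / 8 → ∀ z, |∫ y, chi r y * cd3 u (z + y) h ∂K| ≤ C * D * (r ^ 4)⁻¹ * ‖h‖ ^ α := by
  have hg := geo_pos (by positivity : 0 < 2 * s)
  have hpow : ∀ r : ℝ, 0 < r → r ≤ 1 → ∀ p : ℝ, p ≤ 4 → r ^ (-p) ≤ (r ^ 4)⁻¹ := by
    intro r hr hr1 p hp
    rw [← Real.rpow_natCast, ← Real.rpow_neg hr.le]
    exact Real.rpow_le_rpow_of_exponent_ge hr hr1 (by push_cast; linarith)
  rcases le_or_gt α γ with hαγ | hαγ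
  · refine ⟨12 * (Lam * geo (2 * s)), by positivity, ?_⟩
    intro K hsym hup _ u hu D hD hhol r hr hr1 h hh z
    have h1 := hup.abs_integral_le_of_far hs hL (g := fun y => chi r y * cd3 u (z + y) h)
      (B := 12 * D * ‖h‖ ^ γ) hr (fun y hy => by simp only [chi_eq_zero hr hy.le, zero_mul])
      (fun y => by
        rw [abs_mul, abs_of_nonneg (chi_nonneg _ _)]
        exact (mul_le_of_le_one_left (abs_nonneg _) (chi_le_one _ _)).trans
          (abs_cd3_le_of_holder hγ1.le hD hhol _ _))
    refine h1.trans ?_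
    have h2 : ‖h‖ ^ γ ≤ ‖h‖ ^ α :=
      Real.rpow_le_rpow_of_exponent_ge' (norm_nonneg h) (by linarith) hα.le hαγ
    have h3 := hpow r hr hr1 (2 * s) (by linarith)
    calc 12 * D * ‖h‖ ^ γ * (Lam * geo (2 * s) * r ^ (-(2 * s)))
        ≤ 12 * D * ‖h‖ ^ α * (Lam * geo (2 * s) * (r ^ 4)⁻¹) := by gcongr
      _ = _ := by ring
  · set θ := α - γ with hθ
    have hθ0 : 0 < θ := by linarith
    have hg2 := geo_pos (by positivity : 0 < 2 * s + θ)
    refine ⟨64 * (Lam * geo (2 * s)) + 64 * M * geo (2 * s + θ), by positivity, ?_⟩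
    intro K hsym hup hKh u hu D hD hhol r hr hr1 h hh z
    rcases eq_or_ne h 0 with rfl | hne
    · simp only [cd3_zero, mul_zero, integral_zero, abs_zero]
      positivity
    have hn : 0 < ‖h‖ := norm_pos_iff.mpr hne
    set v := fun x => cd2 u x ((2 : ℝ) • h) with hv
    have hvc : Continuous v := by rw [hv]; unfold cd2; fun_prop
    have hvb : ∀ x, |v x| ≤ 4 * D * ‖h‖ ^ γ := by
      intro x
      have h1 := abs_cd2_le_of_holder hhol x ((2 : ℝ) • h)
      have h2 := rpow_mul_le_of_one_le hγ1.le (by norm_num : (1 : ℝ) ≤ 2) (norm_nonneg h)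
      rw [norm_smul, Real.norm_ofNat] at h1
      nlinarith
    have hcc := continuous_chi (n := n) r
    have hbd : ∀ c x, |c| ≤ 1 → |c * v x| ≤ 4 * D * ‖h‖ ^ γ := by
      intro c x hc
      rw [abs_mul]
      exact (mul_le_of_le_one_left (abs_nonneg _) hc).trans (hvb x)
    have hchi : ∀ y : Euc n, |chi r y| ≤ 1 := fun y => by
      rw [abs_of_nonneg (chi_nonneg _ _)]; exact chi_le_one _ _
    have hr2 : 0 < r / 2 := by positivity
    have hz : ∀ y a : Euc n, ‖a‖ ≤ r / 4 → ‖y‖ < r / 2 → chi r (y + a) = 0 := by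
      intro y a ha hy
      refine chi_eq_zero hr ((norm_add_le _ _).trans (by linarith))
    have hn2 : ‖(2 : ℝ) • h‖ ≤ r / 4 := by rw [norm_smul, Real.norm_ofNat]; linarith
    have i1 : Integrable (fun y => chi r y * v (z + y + h)) K :=
      hup.integrable_of_far hs hL hr2 (by fun_prop)
        (fun y hy => by rw [chi_eq_zero hr (by linarith), zero_mul]) (fun y => hbd _ _ (hchi _))
    have i2 : Integrable (fun y => chi r y * v (z + y - h)) K :=
      hup.integrable_of_far hs hL hr2 (by fun_prop)
        (fun y hy => by rw [chi_eq_zero hr (by linarith), zero_mul]) (fun y => hbd _ _ (hchi _))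
    have i3 : Integrable (fun y => chi r (y + (2 : ℝ) • h) * v (z + y + h)) K :=
      hup.integrable_of_far hs hL hr2 (by fun_prop)
        (fun y hy => by rw [hz y _ hn2 hy, zero_mul]) (fun y => hbd _ _ (hchi _))
    set g := fun w => chi r (w + h) * v (z + w) with hgdef
    have eg1 : ∫ y, g (h - y) ∂K = ∫ y, chi r (y + (2 : ℝ) • h) * v (z + y + h) ∂K := by
      rw [← integral_neg_eq_of_symm hsym (fun y => g (h - y))]
      congr 1
      ext y
      simp only [hgdef]
      rw [show h - -y + h = y + (2 : ℝ) • h by module, show z + (h - -y) = z + y + h by module]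
    have eg2 : ∫ y, g (-h - y) ∂K = ∫ y, chi r y * v (z + y - h) ∂K := by
      rw [← integral_neg_eq_of_symm hsym (fun y => g (-h - y))]
      congr 1
      ext y
      simp only [hgdef]
      rw [show -h - -y + h = y by module, show z + (-h - -y) = z + y - h by module]
    have hsplit : ∫ y, chi r y * cd3 u (z + y) h ∂K =
        (∫ y, (chi r y - chi r (y + (2 : ℝ) • h)) * v (z + y + h) ∂K) +
          ((∫ y, g (h - y) ∂K) - ∫ y, g (-h - y) ∂K) := by
      rw [eg1, eg2, ← integral_sub i3 i2, ← integral_add]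
      · congr 1
        ext y
        rw [cd3_eq_cd2_sub]
        simp only [hv]
        ring
      · simp only [sub_mul]
        exact i1.sub i3
      · exact i3.sub i2
    have b1 : |∫ y, (chi r y - chi r (y + (2 : ℝ) • h)) * v (z + y + h) ∂K| ≤
        (2 * ‖h‖ / r * (4 * D * ‖h‖ ^ γ)) * (Lam * geo (2 * s) * (r / 2) ^ (-(2 * s))) := by
      refine hup.abs_integral_le_of_far hs hL hr2
        (fun y hy => by rw [hz y _ hn2 hy, chi_eq_zero hr (by linarith), sub_zero, zero_mul])
        (fun y => ?_)
      rw [abs_mul]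
      gcongr
      · refine (abs_chi_sub_le hr _ _).trans_eq ?_
        rw [sub_add_cancel_left, norm_neg, norm_smul, Real.norm_ofNat]
      · exact hvb _
    have b2 := abs_integral_map_sub_le hs hθ0 hL hM hup (hKh hαγ) hne hr2 (by linarith)
      (g := g) (by rw [hgdef]; fun_prop)
      (fun y hy => by
        simp only [hgdef]
        rw [hz y h (by linarith) hy, zero_mul]) (fun y => hbd _ _ (hchi _))
    rw [hsplit]
    refine (abs_add_le _ _).trans ?_
    have c1 : ‖h‖ * ‖h‖ ^ γ ≤ ‖h‖ ^ α := by
      rw [← Real.rpow_one_add' hn.le (by linarith)]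
      exact Real.rpow_le_rpow_of_exponent_ge hn (by linarith) (by linarith)
    have c2 : ‖h‖ ^ γ * (2 * ‖h‖) ^ θ ≤ 2 * ‖h‖ ^ α := by
      have := rpow_mul_le_of_one_le (by linarith : θ ≤ 1) one_le_two hn.le
      calc ‖h‖ ^ γ * (2 * ‖h‖) ^ θ ≤ ‖h‖ ^ γ * (2 * ‖h‖ ^ θ) := by gcongr
        _ = 2 * (‖h‖ ^ γ * ‖h‖ ^ θ) := by ring
        _ = 2 * ‖h‖ ^ α := by rw [← Real.rpow_add hn]; congr 2; linarith
    have c5 : ∀ p : ℝ, p ≤ 3 → (r / 2) ^ (-p) ≤ 8 * r ^ (-p) := by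
      intro p hp
      rw [Real.div_rpow hr.le zero_le_two, Real.rpow_neg zero_le_two, div_inv_eq_mul, mul_comm]
      gcongr
      calc (2 : ℝ) ^ p ≤ 2 ^ (3 : ℝ) := Real.rpow_le_rpow_of_exponent_le one_le_two hp
        _ = 8 := by norm_num
    have c3 : (r / 2) ^ (-(2 * s)) / r ≤ 8 * (r ^ 4)⁻¹ := by
      calc (r / 2) ^ (-(2 * s)) / r ≤ 8 * r ^ (-(2 * s)) / r := by
            gcongr; exact c5 _ (by linarith)
        _ = 8 * r ^ (-(2 * s + 1)) := by
            rw [neg_add, ← sub_eq_add_neg, Real.rpow_sub_one hr.ne']; ring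
        _ ≤ _ := by gcongr; exact hpow r hr hr1 _ (by linarith)
    have c4 : (r / 2) ^ (-(2 * s + θ)) ≤ 8 * (r ^ 4)⁻¹ :=
      (c5 _ (by linarith)).trans (by gcongr; exact hpow r hr hr1 _ (by linarith))
    have t1 : (2 * ‖h‖ / r * (4 * D * ‖h‖ ^ γ)) * (Lam * geo (2 * s) * (r / 2) ^ (-(2 * s))) ≤
        64 * (Lam * geo (2 * s)) * D * (r ^ 4)⁻¹ * ‖h‖ ^ α := by
      calc _ = 8 * D * (Lam * geo (2 * s)) * (‖h‖ * ‖h‖ ^ γ) * ((r / 2) ^ (-(2 * s)) / r) := by ring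
        _ ≤ 8 * D * (Lam * geo (2 * s)) * (‖h‖ ^ α) * (8 * (r ^ 4)⁻¹) := by gcongr
        _ = _ := by ring
    have t2 : 4 * D * ‖h‖ ^ γ * (M * (2 * ‖h‖) ^ θ) *
        ((r / 2) ^ (-(2 * s + θ)) * geo (2 * s + θ)) ≤
        64 * M * geo (2 * s + θ) * D * (r ^ 4)⁻¹ * ‖h‖ ^ α := by
      calc _ = 4 * D * M * geo (2 * s + θ) * (‖h‖ ^ γ * (2 * ‖h‖) ^ θ) *
            (r / 2) ^ (-(2 * s + θ)) := by ring
        _ ≤ 4 * D * M * geo (2 * s + θ) * (2 * ‖h‖ ^ α) * (8 * (r ^ 4)⁻¹) := by gcongr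
        _ = _ := by ring
    exact (add_le_add (b1.trans t1) (b2.trans t2)).trans_eq (by ring)

end Far

section Seminorm

lemma hDeg_eq_zero {σ : ℝ} (hσ : σ ≤ 1) : hDeg σ = 0 := by
  have : ⌈σ⌉₊ ≤ 1 := Nat.ceil_le.mpr (by simpa using hσ)
  unfold hDeg
  omega

lemma norm_iteratedFDerivWithin_zero_sub (u : Euc n → ℝ) (Ω : Set (Euc n)) (x y : Euc n) :
    ‖iteratedFDerivWithin ℝ 0 u Ω x - iteratedFDerivWithin ℝ 0 u Ω y‖ = |u x - u y| := by
  rw [iteratedFDerivWithin_zero_eq_comp, Function.comp_apply, Function.comp_apply, ← map_sub,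
    LinearIsometryEquiv.norm_map, Real.norm_eq_abs]

lemma hSemi_le_of_abs_sub_le {σ C : ℝ} (hσ : σ ≤ 1) {Ω : Set (Euc n)} {u : Euc n → ℝ} (hC : 0 ≤ C)
    (h : ∀ x ∈ Ω, ∀ y ∈ Ω, |u x - u y| ≤ C * ‖x - y‖ ^ σ) :
    hSemi σ Ω u ≤ ENNReal.ofReal C := by
  refine iSup₂_le fun x y => ENNReal.ofReal_le_ofReal ?_
  rw [hDeg_eq_zero hσ, norm_iteratedFDerivWithin_zero_sub, Nat.cast_zero, sub_zero]
  exact div_le_of_le_mul₀ (by positivity) hC (h x x.2 y y.2)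

lemma abs_sub_le_of_hSemi_le {σ C : ℝ} (hσ : σ ≤ 1) {Ω : Set (Euc n)} {u : Euc n → ℝ} (hC : 0 ≤ C)
    (h : hSemi σ Ω u ≤ ENNReal.ofReal C) {x y : Euc n} (hx : x ∈ Ω) (hy : y ∈ Ω) :
    |u x - u y| ≤ C * ‖x - y‖ ^ σ := by
  rcases eq_or_ne x y with rfl | hxy
  · rw [sub_self, abs_zero]; positivity
  have h1 := (le_iSup₂_of_le (f := fun (x : Ω) (y : Ω) => ENNReal.ofReal
      (‖iteratedFDerivWithin ℝ (hDeg σ) u Ω ↑x - iteratedFDerivWithin ℝ (hDeg σ) u Ω ↑y‖ /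
        ‖(x : Euc n) - (y : Euc n)‖ ^ (σ - (hDeg σ : ℝ)))) ⟨x, hx⟩ ⟨y, hy⟩ le_rfl).trans h
  rw [ENNReal.ofReal_le_ofReal_iff hC, hDeg_eq_zero hσ, norm_iteratedFDerivWithin_zero_sub,
    Nat.cast_zero, sub_zero] at h1
  have : 0 < ‖x - y‖ := norm_pos_iff.mpr (sub_ne_zero.mpr hxy)
  exact (div_le_iff₀ (by positivity)).mp h1

end Seminorm

section Retraction

/-- The radial retraction onto the closed ball of radius `R`. -/
def retr (R : ℝ) (y : Euc n) : Euc n := (R / max R ‖y‖) • y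

lemma retr_of_le {R : ℝ} (hR : 0 < R) {y : Euc n} (hy : ‖y‖ ≤ R) : retr R y = y := by
  rw [retr, max_eq_left hy, div_self hR.ne', one_smul]

lemma norm_retr_le {R : ℝ} (hR : 0 < R) (y : Euc n) : ‖retr R y‖ ≤ R := by
  have hm : 0 < max R ‖y‖ := lt_max_of_lt_left hR
  rw [retr, norm_smul, Real.norm_of_nonneg (by positivity), div_mul_eq_mul_div, div_le_iff₀ hm]
  gcongr
  exact le_max_right _ _

lemma norm_retr_sub_le {R : ℝ} (hR : 0 < R) (y y' : Euc n) :
    ‖retr R y - retr R y'‖ ≤ 2 * ‖y - y'‖ := by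
  have hm : 0 < max R ‖y‖ := lt_max_of_lt_left hR
  have hm' : 0 < max R ‖y'‖ := lt_max_of_lt_left hR
  have e : retr R y - retr R y' = (R / max R ‖y‖) • (y - y') +
      (R / max R ‖y‖ - R / max R ‖y'‖) • y' := by
    unfold retr; module
  have ha : R / max R ‖y‖ ≤ 1 := (div_le_one hm).mpr (le_max_left _ _)
  have hb : ‖y'‖ / max R ‖y'‖ ≤ 1 := (div_le_one hm').mpr (le_max_right _ _)
  have hmm : |max R ‖y'‖ - max R ‖y‖| ≤ ‖y - y'‖ := by
    refine (abs_max_sub_max_le_max _ _ _ _).trans (max_le (by simp) ?_)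
    rw [norm_sub_rev]
    exact abs_norm_sub_norm_le _ _
  rw [e]
  refine (norm_add_le _ _).trans ?_
  rw [norm_smul, norm_smul, Real.norm_of_nonneg (by positivity), Real.norm_eq_abs, two_mul]
  gcongr
  · exact mul_le_of_le_one_left (norm_nonneg _) ha
  · have : R / max R ‖y‖ - R / max R ‖y'‖ =
        (R / max R ‖y‖) * (max R ‖y'‖ - max R ‖y‖) / max R ‖y'‖ := by
      field_simp
    rw [this, abs_div, abs_mul, abs_of_pos hm', abs_of_nonneg (by positivity : 0 ≤ R / max R ‖y‖),
      div_mul_eq_mul_div, mul_div_assoc]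
    calc R / max R ‖y‖ * |max R ‖y'‖ - max R ‖y‖| * (‖y'‖ / max R ‖y'‖)
        ≤ 1 * ‖y - y'‖ * 1 := by gcongr
      _ = ‖y - y'‖ := by ring

lemma continuous_retr {R : ℝ} (hR : 0 < R) : Continuous (retr R : Euc n → Euc n) := by
  unfold retr
  exact (continuous_const.div (by fun_prop) fun y => (lt_max_of_lt_left hR).ne').smul continuous_id

end Retraction

section Kantorovich

/-- The Kantorovich condition on an annulus only needs a local Hölder bound. -/
lemma KantCond.abs_annulus_le {s γ c : ℝ} (hγ : 0 ≤ γ) (hγ1 : γ < 1) {μ ν : Measure (Euc n)}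
    (hK : KantCond s γ μ ν c) {φ : Euc n → ℝ} (hφ : Continuous φ) (hφ0 : φ 0 = 0) {τ a : ℝ}
    (hτ : 0 < τ) (ha : 0 ≤ a)
    (h : ∀ y y', ‖y‖ ≤ 2 * τ → ‖y'‖ ≤ 2 * τ → |φ y - φ y'| ≤ a * ‖y - y'‖ ^ γ) :
    |(∫ y in ann τ, φ y ∂μ) - ∫ y in ann τ, φ y ∂ν| ≤ 2 * a * (c * τ ^ (γ - 2 * s)) := by
  have hτ2 : 0 < 2 * τ := by positivity
  rcases ha.eq_or_lt with rfl | ha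
  · have h0 : ∀ m : Measure (Euc n), ∫ y in ann τ, φ y ∂m = 0 := by
      intro m
      refine setIntegral_eq_zero_of_forall_eq_zero fun y hy => ?_
      have := h y 0 (mem_ann.mp hy).1.le (by simpa using hτ2.le)
      rw [hφ0, zero_mul, sub_zero] at this
      exact abs_nonpos_iff.mp this
    simp [h0]
  set ψ : Euc n → ℝ := fun y => (2 * a)⁻¹ * φ (retr (2 * τ) y) with hψ
  have hψc : Continuous ψ := (hφ.comp (continuous_retr hτ2)).const_mul _
  have hψh : hSemi γ Set.univ ψ ≤ 1 := by
    rw [← ENNReal.ofReal_one]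
    refine hSemi_le_of_abs_sub_le hγ1.le zero_le_one fun x _ y _ => ?_
    have h1 := h _ _ (norm_retr_le hτ2 x) (norm_retr_le hτ2 y)
    have h2 : ‖retr (2 * τ) x - retr (2 * τ) y‖ ^ γ ≤ 2 * ‖x - y‖ ^ γ :=
      (Real.rpow_le_rpow (norm_nonneg _) (norm_retr_sub_le hτ2 x y) hγ).trans
        (rpow_mul_le_of_one_le hγ1.le one_le_two (norm_nonneg _))
    rw [hψ]
    simp only
    rw [← mul_sub, abs_mul, abs_of_pos (by positivity : 0 < (2 * a)⁻¹), inv_mul_le_iff₀ (by positivity)]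
    calc _ ≤ a * (2 * ‖x - y‖ ^ γ) := h1.trans (by gcongr)
      _ = _ := by ring
  have hψ0 : ψ 0 = 0 := by
    simp [hψ, retr, hφ0]
  have key := hK τ hτ ψ (by rw [hDeg_eq_zero hγ1.le]; exact contDiff_zero.mpr hψc) hψh hψ0
  have e : ∀ m : Measure (Euc n), ∫ y in ball 0 (2 * τ) \ ball 0 τ, ψ y ∂m =
      (2 * a)⁻¹ * ∫ y in ann τ, φ y ∂m := by
    intro m
    rw [← integral_const_mul]
    refine setIntegral_congr_fun (measurableSet_ann τ) fun y hy => ?_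
    simp only [hψ]
    rw [retr_of_le hτ2 (mem_ann.mp hy).1.le]
  rw [e, e, ← mul_sub, abs_mul, abs_of_pos (by positivity : 0 < (2 * a)⁻¹),
    inv_mul_le_iff₀ (by positivity)] at key
  exact key

lemma KantCond.abs_integral_sub_le {s γ σ c : ℝ} (hγ : 0 ≤ γ) (hγ1 : γ < 1)
    (hγs : γ < 2 * s) (hσ : 2 * s < σ) (hc : 0 ≤ c) {μ ν : Measure (Euc n)}
    (hμ0 : μ {0} = 0) (hν0 : ν {0} = 0) (hK : KantCond s γ μ ν c) {φ : Euc n → ℝ}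
    (hφ : Continuous φ) (hφ0 : φ 0 = 0) (hμ : Integrable φ μ) (hν : Integrable φ ν) {r B D : ℝ}
    (hr : 0 < r) (hB : 0 ≤ B) (hD : 0 ≤ D)
    (hnear : ∀ τ, 0 < τ → 2 * τ ≤ r → ∀ y y', ‖y‖ ≤ 2 * τ → ‖y'‖ ≤ 2 * τ →
      |φ y - φ y'| ≤ B * τ ^ (σ - γ) * ‖y - y'‖ ^ γ)
    (hfar : ∀ y y', |φ y - φ y'| ≤ D * ‖y - y'‖ ^ γ) :
    |(∫ y, φ y ∂μ) - ∫ y, φ y ∂ν| ≤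
      2 * c * (B * r ^ (σ - 2 * s) * geo (σ - 2 * s) + D * r ^ (γ - 2 * s) * geo (2 * s - γ)) := by
  have n1 : |(∫ y in ball 0 r \ {0}, φ y ∂μ) - ∫ y in ball 0 r \ {0}, φ y ∂ν| ≤
      2 * B * c * (r ^ (σ - 2 * s) * ((1 / 2) ^ (σ - 2 * s) * geo (σ - 2 * s))) := by
    rw [← iUnion_ann_near hr]
    refine abs_integral_iUnion_sub_le (fun j => measurableSet_ann _) (pairwise_disjoint_near hr)
      hμ.integrableOn hν.integrableOn (fun j => ?_)
      ((hasSum_near hr (by linarith : 0 < σ - 2 * s)).mul_left _)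
    set τ := r * (1 / 2) ^ (j + 1) with hτ
    have hτ0 : 0 < τ := by positivity
    have hτr : 2 * τ ≤ r := by
      have : (1 / 2 : ℝ) ^ j ≤ 1 := pow_le_one₀ (by norm_num) (by norm_num)
      rw [hτ, pow_succ]
      nlinarith
    refine (hK.abs_annulus_le hγ hγ1 hφ hφ0 hτ0 (by positivity) (hnear τ hτ0 hτr)).trans_eq ?_
    rw [show σ - 2 * s = (σ - γ) + (γ - 2 * s) by ring, Real.rpow_add hτ0]
    ring
  have n2 : |(∫ y in (ball 0 r)ᶜ, φ y ∂μ) - ∫ y in (ball 0 r)ᶜ, φ y ∂ν| ≤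
      2 * D * c * (r ^ (-(2 * s - γ)) * geo (2 * s - γ)) := by
    rw [← iUnion_ann_far hr]
    refine abs_integral_iUnion_sub_le (fun j => measurableSet_ann _) (pairwise_disjoint_far hr)
      hμ.integrableOn hν.integrableOn (fun j => ?_)
      ((hasSum_far hr (by linarith : 0 < 2 * s - γ)).mul_left _)
    have hτ0 : 0 < r * 2 ^ j := by positivity
    refine (hK.abs_annulus_le hγ hγ1 hφ hφ0 hτ0 hD fun y y' _ _ => hfar y y').trans_eq ?_
    rw [neg_sub]
    ring
  have hsplit : ∀ m : Measure (Euc n), m {0} = 0 → Integrable φ m →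
      ∫ y, φ y ∂m = (∫ y in ball 0 r \ {0}, φ y ∂m) + ∫ y in (ball 0 r)ᶜ, φ y ∂m := by
    intro m hm hi
    rw [← integral_add_compl measurableSet_ball hi]
    congr 1
    refine setIntegral_congr_set ?_
    exact (sdiff_null_ae_eq_self hm).symm
  rw [hsplit μ hμ0 hμ, hsplit ν hν0 hν]
  have n3 := near_sum_le hr (by linarith : 0 < σ - 2 * s)
  have n4 : 2 * B * c * (r ^ (σ - 2 * s) * ((1 / 2) ^ (σ - 2 * s) * geo (σ - 2 * s))) ≤
      2 * B * c * (r ^ (σ - 2 * s) * geo (σ - 2 * s)) := by gcongr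
  rw [neg_sub] at n2
  rw [abs_le] at n1 n2 ⊢
  constructor <;> nlinarith [n1.1, n1.2, n2.1, n2.2]

end Kantorovich

section Step

lemma exists_mul_rpow_le {p ε C b : ℝ} (hp : 0 < p) (hε : 0 < ε) (hC : 0 ≤ C) (hb : 0 < b) :
    ∃ t > 0, t ≤ b ∧ C * t ^ p ≤ ε := by
  refine ⟨min b ((ε / (C + 1)) ^ (1 / p)), lt_min hb (by positivity), min_le_left _ _, ?_⟩
  calc C * (min b ((ε / (C + 1)) ^ (1 / p))) ^ p ≤ C * ((ε / (C + 1)) ^ (1 / p)) ^ p := by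
        gcongr; exact min_le_right _ _
    _ = C / (C + 1) * ε := by
        rw [← Real.rpow_mul (by positivity), one_div_mul_cancel hp.ne', Real.rpow_one]; ring
    _ ≤ 1 * ε := by gcongr; exact (div_le_one (by positivity)).mpr (by linarith)
    _ = ε := one_mul ε

/-- Cone mass condition: the part of `K` in `B_r` lying in a slab in direction `e`. -/
def ConeMass (s c c' : ℝ) (K : Measure (Euc n)) : Prop :=
  ∀ r > 0, ∀ e : Euc n, ‖e‖ = 1 →
    ENNReal.ofReal (c' * r ^ (-(2 * s))) ≤ K {y | ‖y‖ < r ∧ c * r ≤ ⟪e, y⟫}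

/-- Near a point where `W` almost attains its maximum, and where the operator is almost
nonpositive, one can move by a definite amount in any direction to another such point. -/
lemma exists_step (n : ℕ) {s σ Lam c c' C0 r δ' : ℝ} (hs : 0 < s) (hσ : 2 * s < σ) (hL : 0 < Lam)
    (hc : 0 < c) (hc' : 0 < c') (hC0 : 0 ≤ C0) (hr : 0 < r) (hr1 : r ≤ 1) (hδ' : 0 < δ') :
    ∃ δ > 0, ∀ K : Measure (Euc n), UpperGrowth s Lam K → ConeMass s c c' K →
      ∀ ρ > 0, ∀ η W : Euc n → ℝ, ∀ z : Euc n,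
      (∀ y, 0 ≤ η y) → (∀ y, η y ≤ 1) → (∀ y, ‖y‖ ≤ ρ → η y = 1) →
      (∀ y, η y ≠ 0 → W (z + y) ≤ 1 + δ) → (∀ y, η y ≠ 0 → W (z - y) ≤ 1 + δ) → 1 - δ ≤ W z →
      (∀ y, ‖y‖ ≤ ρ → |cd2 W z y| ≤ C0 * (‖y‖ / ρ) ^ σ) →
      Integrable (fun y => η y * (2 * W z - W (z + y) - W (z - y))) K →
      (1 / 2) * ∫ y, η y * (2 * W z - W (z + y) - W (z - y)) ∂K ≤ δ * ρ ^ (-(2 * s)) →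
      ∀ e : Euc n, ‖e‖ = 1 → ∃ y, ‖y‖ < r * ρ ∧ c * (r * ρ) ≤ ⟪e, y⟫ ∧ 1 - δ' ≤ W (z + y) := by
  have hg1 := geo_pos (by linarith : 0 < σ - 2 * s)
  have hg2 := geo_pos (by positivity : 0 < 2 * s)
  set A := δ' / 8 * (c' * r ^ (-(2 * s))) with hA
  have hA0 : 0 < A := by positivity
  set Ca := 2 ^ σ * Lam * geo (σ - 2 * s) with hCa
  set Lg := Lam * geo (2 * s) with hLg
  obtain ⟨t, ht0, ht1, htA⟩ := exists_mul_rpow_le (C := C0 * Ca) (by linarith : 0 < σ - 2 * s) hA0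
    (by positivity) one_pos
  have hq : 0 < 4 * Lg * t ^ (-(2 * s)) := by positivity
  refine ⟨min (δ' / 6) (min (A / 2) (A / (4 * Lg * t ^ (-(2 * s))))), by positivity, ?_⟩
  set δ := min (δ' / 6) (min (A / 2) (A / (4 * Lg * t ^ (-(2 * s))))) with hδ
  have hδ0 : 0 < δ := by positivity
  have hδ1 : δ ≤ δ' / 6 := min_le_left _ _
  have hδ2 : δ ≤ A / 2 := (min_le_right _ _).trans (min_le_left _ _)
  have hδ3 : δ * (4 * Lg * t ^ (-(2 * s))) ≤ A :=
    (le_div_iff₀ hq).mp ((min_le_right _ _).trans (min_le_right _ _))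
  clear_value δ
  intro K hup hcone ρ hρ η W z hη0 hη1 hηρ hW1 hW2 hWz hcd hintg hle e he
  by_contra! hcon
  set G : Set (Euc n) := {y | ‖y‖ < r * ρ ∧ c * (r * ρ) ≤ ⟪e, y⟫} with hG
  have hin : Measurable fun y : Euc n => ⟪e, y⟫ := measurable_const.inner measurable_id
  have hmG : MeasurableSet G :=
    (measurableSet_lt measurable_norm measurable_const).inter
      (measurableSet_le measurable_const hin)
  have hKG : K G < ⊤ := by
    refine (measure_mono ?_).trans_lt (hup.compl_ball_lt_top hs hL.le
      (by positivity : 0 < c * (r * ρ)))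
    intro y hy
    have h1 := real_inner_le_norm e y
    rw [he, one_mul] at h1
    simpa using hy.2.trans h1
  have htρ : 0 < t * ρ := by positivity
  set m1 : Euc n → ℝ := (ball (0 : Euc n) (t * ρ)).indicator (fun y => C0 * ρ ^ (-σ) * ‖y‖ ^ σ) with hm1
  set m2 : Euc n → ℝ := (ball (0 : Euc n) (t * ρ))ᶜ.indicator (fun _ => 4 * δ) with hm2
  have im1 : Integrable m1 K :=
    IntegrableOn.integrable_indicator ((hup.integrableOn_rpow hs hσ hL.le htρ).const_mul _)
      measurableSet_ball
  have im2 : Integrable m2 K :=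
    (integrableOn_const (hup.compl_ball_lt_top hs hL.le htρ).ne).integrable_indicator
      measurableSet_ball.compl
  have iG : Integrable (G.indicator fun _ => δ' / 2) K :=
    (integrableOn_const hKG.ne).integrable_indicator hmG
  have hpt : ∀ y, G.indicator (fun _ => δ' / 2) y ≤
      η y * (2 * W z - W (z + y) - W (z - y)) + (m1 y + m2 y) := by
    intro y
    have hm1' : 0 ≤ m1 y := Set.indicator_nonneg (fun y _ => by positivity) y
    have hm2' : 0 ≤ m2 y := Set.indicator_nonneg (fun y _ => by positivity) y
    by_cases hyG : y ∈ G
    · rw [Set.indicator_of_mem hyG]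
      have hyρ : ‖y‖ ≤ ρ := hyG.1.le.trans (mul_le_of_le_one_left hρ.le hr1)
      have h1 := hcon y hyG.1 hyG.2
      have h2 := hW2 y (by rw [hηρ y hyρ]; exact one_ne_zero)
      rw [hηρ y hyρ]
      linarith
    rw [Set.indicator_of_notMem hyG]
    by_cases hyt : y ∈ ball (0 : Euc n) (t * ρ)
    · have hyt' : ‖y‖ < t * ρ := by simpa using hyt
      have hyρ : ‖y‖ ≤ ρ := hyt'.le.trans (mul_le_of_le_one_left hρ.le ht1)
      have h1 := (abs_le.mp (hcd y hyρ)).2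
      have h2 : m1 y = C0 * (‖y‖ / ρ) ^ σ := by
        rw [hm1, Set.indicator_of_mem hyt, Real.div_rpow (norm_nonneg _) hρ.le, Real.rpow_neg hρ.le]
        ring
      rw [hηρ y hyρ, h2]
      unfold cd2 at h1
      linarith
    · have h2 : m2 y = 4 * δ := by rw [hm2, Set.indicator_of_mem (by exact hyt)]
      rw [h2]
      rcases eq_or_ne (η y) 0 with h0 | h0
      · rw [h0]; linarith
      · have h3 := hW1 y h0
        have h4 := hW2 y h0
        have h5 := hη0 y
        have h6 := hη1 y
        nlinarith
  have hI := integral_mono iG (hintg.add (im1.add im2)) hpt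
  have hI1 : ∫ y, (η y * (2 * W z - W (z + y) - W (z - y)) + (m1 y + m2 y)) ∂K =
      (∫ y, η y * (2 * W z - W (z + y) - W (z - y)) ∂K) + ((∫ y, m1 y ∂K) + ∫ y, m2 y ∂K) := by
    rw [← integral_add im1 im2]
    exact integral_add hintg (im1.add im2)
  have hI := hI.trans_eq hI1
  rw [ integral_indicator hmG, setIntegral_const,
    hm1, hm2, integral_indicator measurableSet_ball, integral_indicator measurableSet_ball.compl,
    setIntegral_const, integral_const_mul, smul_eq_mul, smul_eq_mul] at hI
  have hp : 0 < ρ ^ (-(2 * s)) := by positivity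
  have b1 : c' * (r * ρ) ^ (-(2 * s)) ≤ K.real G :=
    (ENNReal.ofReal_le_iff_le_toReal hKG.ne).mp (hcone _ (by positivity) e he)
  have b2 := hup.integral_rpow_le hs hσ hL.le htρ
  have b3 := hup.real_compl_ball_le hs hL.le htρ
  rw [Real.mul_rpow hr.le hρ.le] at b1
  have b2' : C0 * ρ ^ (-σ) * ∫ y in ball (0 : Euc n) (t * ρ), ‖y‖ ^ σ ∂K ≤ A * ρ ^ (-(2 * s)) := by
    calc _ ≤ C0 * ρ ^ (-σ) * (Ca * (t * ρ) ^ (σ - 2 * s)) := by gcongr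
      _ = C0 * Ca * t ^ (σ - 2 * s) * (ρ ^ (-σ) * ρ ^ (σ - 2 * s)) := by
          rw [Real.mul_rpow ht0.le hρ.le]; ring
      _ = C0 * Ca * t ^ (σ - 2 * s) * ρ ^ (-(2 * s)) := by
          rw [← Real.rpow_add hρ]; congr 2; ring
      _ ≤ _ := by gcongr
  have b3' : K.real (ball (0 : Euc n) (t * ρ))ᶜ * (4 * δ) ≤ A * ρ ^ (-(2 * s)) := by
    calc _ ≤ Lg * (t * ρ) ^ (-(2 * s)) * (4 * δ) := by gcongr
      _ = δ * (4 * Lg * t ^ (-(2 * s))) * ρ ^ (-(2 * s)) := by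
          rw [Real.mul_rpow ht0.le hρ.le]; ring
      _ ≤ _ := by gcongr
  have b4 : 4 * A * ρ ^ (-(2 * s)) ≤ K.real G * (δ' / 2) := by
    calc _ = c' * (r ^ (-(2 * s)) * ρ ^ (-(2 * s))) * (δ' / 2) := by rw [hA]; ring
      _ ≤ _ := by gcongr
  nlinarith

end Step

section Propagation

/-- A function `W ≤ 1 + δ` which is almost a supersolution at scale `ρ` in a ball around `x0`. -/
structure NearMax (s σ Lam c c' C0 : ℝ) (K : Euc n → Measure (Euc n)) (η W : Euc n → ℝ)
    (x0 : Euc n) (R ρ δ : ℝ) : Prop where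
  upper : ∀ z ∈ closedBall x0 R, UpperGrowth s Lam (K z)
  cone : ∀ z ∈ closedBall x0 R, ConeMass s c c' (K z)
  weight_nonneg : ∀ y, 0 ≤ η y
  weight_le_one : ∀ y, η y ≤ 1
  weight_eq_one : ∀ y, ‖y‖ ≤ ρ → η y = 1
  le_add : ∀ z ∈ closedBall x0 R, ∀ y, η y ≠ 0 → W (z + y) ≤ 1 + δ
  le_sub : ∀ z ∈ closedBall x0 R, ∀ y, η y ≠ 0 → W (z - y) ≤ 1 + δ
  cd2_le : ∀ z ∈ closedBall x0 R, ∀ y, ‖y‖ ≤ ρ → |cd2 W z y| ≤ C0 * (‖y‖ / ρ) ^ σ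
  integrable : ∀ z ∈ closedBall x0 R,
    Integrable (fun y => η y * (2 * W z - W (z + y) - W (z - y))) (K z)
  op_le : ∀ z ∈ closedBall x0 R, 0 ≤ W z →
    (1 / 2) * ∫ y, η y * (2 * W z - W (z + y) - W (z - y)) ∂(K z) ≤ δ * ρ ^ (-(2 * s))

variable {s σ Lam c c' C0 : ℝ}

lemma NearMax.mono {K : Euc n → Measure (Euc n)} {η W : Euc n → ℝ} {x0 : Euc n} {R ρ δ δ' : ℝ}
    (h : NearMax s σ Lam c c' C0 K η W x0 R ρ δ) (hρ : 0 < ρ) (hδ : δ ≤ δ') :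
    NearMax s σ Lam c c' C0 K η W x0 R ρ δ' :=
  { h with
    le_add := fun z hz y hy => (h.le_add z hz y hy).trans (by linarith)
    le_sub := fun z hz y hy => (h.le_sub z hz y hy).trans (by linarith)
    op_le := fun z hz hW => (h.op_le z hz hW).trans (by gcongr) }

lemma exists_chain (n : ℕ) {r : ℝ} (hs : 0 < s) (hσ : 2 * s < σ) (hL : 0 < Lam)
    (hc : 0 < c) (hc' : 0 < c') (hC0 : 0 ≤ C0) (hr : 0 < r) (hr1 : r ≤ 1) (m : ℕ) :
    ∀ δ' > 0, δ' ≤ 1 → ∃ δ > 0, δ ≤ δ' ∧ ∀ (K : Euc n → Measure (Euc n)) (η W : Euc n → ℝ)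
      (x0 p : Euc n) (R ρ : ℝ), 0 < ρ → NearMax s σ Lam c c' C0 K η W x0 (2 * (R * ρ)) ρ δ →
      1 - δ ≤ W x0 → ‖x0 - p‖ ≤ R * ρ → ∃ z, 1 - δ' ≤ W z ∧ ‖z - p‖ ≤ ‖x0 - p‖ ∧
        (‖z - p‖ ≤ r / c * ρ ∨ ‖z - p‖ ^ 2 ≤ ‖x0 - p‖ ^ 2 - m * (r * ρ) ^ 2) := by
  induction m with
  | zero =>
    intro δ' hδ' _
    exact ⟨δ', hδ', le_rfl, fun K η W x0 p R ρ _ _ hW _ => ⟨x0, hW, le_rfl, Or.inr (by simp)⟩⟩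
  | succ m ih =>
    intro δ' hδ' hδ'1
    obtain ⟨δ1, hδ1, hstep⟩ := exists_step n (C0 := C0) hs hσ hL hc hc' hC0 hr hr1 hδ'
    obtain ⟨δ, hδ, hδle, hih⟩ := ih (min δ1 δ') (lt_min hδ1 hδ') ((min_le_right _ _).trans hδ'1)
    have hδδ1 := hδle.trans (min_le_left _ _)
    have hδδ' := hδle.trans (min_le_right _ _)
    refine ⟨δ, hδ, hδδ', ?_⟩
    intro K η W x0 p R ρ hρ hN hW0 hp
    obtain ⟨z, hWz, hzp, hz⟩ := hih K η W x0 p R ρ hρ hN hW0 hp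
    have hWz1 : 1 - δ1 ≤ W z := by linarith [min_le_left δ1 δ']
    have hWz' : 1 - δ' ≤ W z := by linarith [min_le_right δ1 δ']
    rcases le_or_gt ‖z - p‖ (r / c * ρ) with hclose | hfar
    · exact ⟨z, hWz', hzp, Or.inl hclose⟩
    rcases hz with hz | hz
    · exact ⟨z, hWz', hzp, Or.inl hz⟩
    have hzB : z ∈ closedBall x0 (2 * (R * ρ)) := by
      rw [mem_closedBall, dist_eq_norm]
      have := norm_sub_le_norm_sub_add_norm_sub z p x0
      rw [norm_sub_rev p x0] at this
      linarith
    have hN1 := hN.mono hρ hδδ1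
    have hpos : 0 < ‖z - p‖ := lt_of_le_of_lt (by positivity) hfar
    have hpos' : 0 < ‖p - z‖ := by rwa [norm_sub_rev]
    obtain ⟨y, hy1, hy2, hy3⟩ := hstep (K z) (hN.upper z hzB) (hN.cone z hzB) ρ hρ η W z
      hN.weight_nonneg hN.weight_le_one hN.weight_eq_one (hN1.le_add z hzB) (hN1.le_sub z hzB)
      hWz1 (hN.cd2_le z hzB) (hN.integrable z hzB) (hN1.op_le z hzB (by linarith))
      (‖p - z‖⁻¹ • (p - z)) (by rw [norm_smul, norm_inv, norm_norm, inv_mul_cancel₀ hpos'.ne'])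
    have hin : ⟪z - p, y⟫ ≤ -(r / c * ρ * (c * (r * ρ))) := by
      rw [real_inner_smul_left, inv_mul_eq_div, le_div_iff₀ hpos'] at hy2
      rw [← neg_sub p z, inner_neg_left]
      rw [norm_sub_rev] at hfar
      have : r / c * ρ * (c * (r * ρ)) ≤ ‖p - z‖ * (c * (r * ρ)) := by gcongr
      linarith
    have hsq : ‖z + y - p‖ ^ 2 ≤ ‖z - p‖ ^ 2 - (r * ρ) ^ 2 := by
      rw [show z + y - p = (z - p) + y by abel, norm_add_sq_real]
      have h1 : ‖y‖ ^ 2 ≤ (r * ρ) ^ 2 := by gcongr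
      have h2 : r / c * ρ * (c * (r * ρ)) = (r * ρ) ^ 2 := by field_simp
      linarith
    refine ⟨z + y, hy3, ?_, Or.inr ?_⟩
    · refine le_trans ?_ hzp
      rw [← sq_le_sq₀ (norm_nonneg _) (norm_nonneg _)]
      nlinarith [sq_nonneg (r * ρ)]
    · push_cast
      linarith

lemma exists_propagation (n : ℕ) {C1 μ R : ℝ} (hs : 0 < s) (hσ : 2 * s < σ) (hL : 0 < Lam)
    (hc : 0 < c) (hc' : 0 < c') (hC0 : 0 ≤ C0) (hC1 : 0 ≤ C1) (hμ : 0 < μ) :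
    ∃ δ > 0, δ ≤ 1 / 4 ∧ ∀ (K : Euc n → Measure (Euc n)) (η W : Euc n → ℝ) (x0 : Euc n) (ρ : ℝ), 0 < ρ →
      NearMax s σ Lam c c' C0 K η W x0 (2 * (R * ρ)) ρ δ → 1 - δ ≤ W x0 →
      (∀ p ∈ closedBall x0 (R * ρ), ∀ k, ‖k‖ ≤ ρ → |W (p + k) - W p| ≤ C1 * (‖k‖ / ρ) ^ μ) →
      ∀ p ∈ closedBall x0 (R * ρ), 1 / 2 ≤ W p := by
  obtain ⟨t, ht, ht1, htC⟩ := exists_mul_rpow_le hμ (by norm_num : (0 : ℝ) < 1 / 4) hC1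
    (by positivity : 0 < min 1 (1 / c))
  have hr : 0 < t * c := by positivity
  have hr1 : t * c ≤ 1 := (le_div_iff₀ hc).mp (ht1.trans (min_le_right _ _))
  obtain ⟨m, hm⟩ := exists_nat_gt (R ^ 2 / (t * c) ^ 2)
  rw [div_lt_iff₀ (by positivity)] at hm
  obtain ⟨δ, hδ, hδ4, hch⟩ := exists_chain n (C0 := C0) hs hσ hL hc hc' hC0 hr hr1 m (1 / 4)
    (by norm_num) (by norm_num)
  refine ⟨δ, hδ, hδ4, ?_⟩
  intro K η W x0 ρ hρ hN hW0 hW1 p hp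
  rw [mem_closedBall, dist_comm, dist_eq_norm] at hp
  obtain ⟨z, hz1, hz2, hz3⟩ := hch K η W x0 p R ρ hρ hN hW0 hp
  have hz : ‖z - p‖ ≤ t * ρ := by
    rcases hz3 with h | h
    · rwa [mul_div_cancel_right₀ _ hc.ne'] at h
    · exfalso
      have h1 : ‖x0 - p‖ ^ 2 ≤ (R * ρ) ^ 2 := by gcongr
      have h2 : 0 ≤ ‖z - p‖ ^ 2 := by positivity
      have h3 : R ^ 2 * ρ ^ 2 < m * (t * c) ^ 2 * ρ ^ 2 := by gcongr
      nlinarith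
  have hzρ : ‖z - p‖ ≤ ρ := hz.trans (mul_le_of_le_one_left hρ.le (ht1.trans (min_le_left _ _)))
  have h1 := hW1 p (by rwa [mem_closedBall, dist_comm, dist_eq_norm]) (z - p) hzρ
  rw [add_sub_cancel] at h1
  have h2 : C1 * (‖z - p‖ / ρ) ^ μ ≤ 1 / 4 := by
    refine le_trans ?_ htC
    gcongr
    exact (div_le_iff₀ hρ).mpr hz
  have := (abs_le.mp (h1.trans h2)).2
  linarith

end Propagation

section Local

/-- Third differences of `u` are controlled near `x0` at scale `d`. -/
def LocBound (β A d : ℝ) (x0 : Euc n) (u : Euc n → ℝ) : Prop :=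
  ∀ x, ‖x - x0‖ ≤ d / 2 → ∀ h, ‖h‖ ≤ d / 32 → |cd3 u x h| ≤ 16 * A * ‖h‖ ^ β

variable {β σ γ A D d : ℝ} {x0 : Euc n} {u : Euc n → ℝ}

lemma abs_cd2_le (hD : ∀ x, |u x| ≤ D) (x h : Euc n) : |cd2 u x h| ≤ 4 * D := by
  have h1 := abs_le.mp (hD (x + h))
  have h2 := abs_le.mp (hD (x - h))
  have h3 := abs_le.mp (hD x)
  unfold cd2
  rw [abs_le]
  constructor <;> linarith [h1.1, h1.2, h2.1, h2.2, h3.1, h3.2]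

lemma LocBound.cd2_le (h : LocBound β A d x0 u) (hσ : 0 ≤ σ) (hσ2 : σ < 2) (hσβ : σ ≤ β)
    (hA : 0 ≤ A) (hd : 0 < d) (hD : ∀ x, |u x| ≤ D) {x : Euc n} (hx : ‖x - x0‖ ≤ d / 4) {k : Euc n}
    (hk : ‖k‖ ≤ d / 8) :
    |cd2 u x k| ≤ 256 * Cd (1 / 4) σ * (D * d ^ (-σ) + A * d ^ (β - σ)) * ‖k‖ ^ σ := by
  have hD0 : 0 ≤ D := (abs_nonneg _).trans (hD 0)
  have hCd : 0 < Cd (1 / 4) σ := Cd_pos (quarter_mul_two_rpow_lt hσ2)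
  have hτ : 0 < d / 8 := by positivity
  have h3 : ∀ h', ‖h'‖ ≤ d / 8 / 4 → |cd3 u (x + h') h'| ≤ 16 * A * (d / 8) ^ (β - σ) * ‖h'‖ ^ σ ∧
      |cd3 u (x - h') h'| ≤ 16 * A * (d / 8) ^ (β - σ) * ‖h'‖ ^ σ := by
    intro h' hh'
    have e := mul_rpow_le_mul_rpow_of_le (b := 16 * A) (by positivity) hσβ hσ (norm_nonneg h')
      (by linarith : ‖h'‖ ≤ d / 8)
    constructor
    · refine (h _ ?_ _ (by linarith)).trans e
      rw [add_sub_right_comm]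
      exact (norm_add_le _ _).trans (by linarith)
    · refine (h _ ?_ _ (by linarith)).trans e
      rw [sub_right_comm]
      exact (norm_sub_le _ _).trans (by linarith)
  have key := cd2_le_of_cd3 hσ hσ2 hτ (by positivity) (by positivity) h3
    (fun k _ => abs_cd2_le hD x k) k hk
  refine key.trans ?_
  have e1 : 4 * D / (d / 8) ^ σ ≤ 256 * (D * d ^ (-σ)) := by
    rw [Real.div_rpow hd.le (by norm_num), Real.rpow_neg hd.le, div_div_eq_mul_div]
    have : (8 : ℝ) ^ σ ≤ 64 := by
      calc (8 : ℝ) ^ σ ≤ 8 ^ (2 : ℝ) := Real.rpow_le_rpow_of_exponent_le (by norm_num) hσ2.le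
        _ = 64 := by norm_num
    calc 4 * D * 8 ^ σ / d ^ σ ≤ 4 * D * 64 / d ^ σ := by gcongr
      _ = _ := by ring
  have e2 : 16 * A * (d / 8) ^ (β - σ) ≤ 256 * (A * d ^ (β - σ)) := by
    have : (d / 8) ^ (β - σ) ≤ d ^ (β - σ) := by
      apply Real.rpow_le_rpow hτ.le (by linarith) (by linarith)
    have h0 : 0 ≤ A * d ^ (β - σ) := by positivity
    calc 16 * A * (d / 8) ^ (β - σ) ≤ 16 * A * d ^ (β - σ) := by gcongr
      _ ≤ _ := by linarith
  calc _ ≤ Cd (1 / 4) σ * (256 * (D * d ^ (-σ)) + 256 * (A * d ^ (β - σ))) * ‖k‖ ^ σ := by gcongr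
    _ = _ := by ring

lemma cd2_cd2 (u : Euc n → ℝ) (x w k : Euc n) :
    cd2 (cd2 u x) w k = cd2 u (x + w) k + cd2 u (x - w) k := by
  unfold cd2
  rw [show x + (w + k) = x + w + k by abel, show x - (w + k) = x - w - k by abel,
    show x + (w - k) = x + w - k by abel, show x - (w - k) = x - w + k by abel]
  ring

/-- From second differences of `u` to Hölder continuity of `y ↦ cd2 u x y`. -/
lemma cd2_holder_of_cd2_le {B τ : ℝ} (hγ : 0 ≤ γ) (hγ1 : γ < 1) (hγσ : γ ≤ σ) (hσ2 : σ < 2)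
    (hB : 0 ≤ B) {x : Euc n} (hτ : 0 < τ)
    (h : ∀ w, ‖w‖ ≤ 4 * τ → ∀ k, ‖k‖ ≤ 6 * τ → |cd2 u (x + w) k| ≤ B * ‖k‖ ^ σ) {y y' : Euc n}
    (hy : ‖y‖ ≤ 2 * τ) (hy' : ‖y'‖ ≤ 2 * τ) :
    |cd2 u x y - cd2 u x y'| ≤ 104 * Cd (1 / 2) γ * (B * τ ^ (σ - γ)) * ‖y - y'‖ ^ γ := by
  have hCd : 0 < Cd (1 / 2) γ := Cd_pos (half_mul_two_rpow_lt hγ1)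
  have hσ : 0 ≤ σ := hγ.trans hγσ
  have h2 : ∀ k, ‖k‖ ≤ 4 * τ / 2 → |cd2 (cd2 u x) (y' + k) k| ≤
      2 * B * (4 * τ) ^ (σ - γ) * ‖k‖ ^ γ := by
    intro k hk
    have e := mul_rpow_le_mul_rpow_of_le (b := 2 * B) (by positivity) hγσ hγ (norm_nonneg k)
      (by linarith : ‖k‖ ≤ 4 * τ)
    refine le_trans ?_ e
    have hw : ‖y' + k‖ ≤ 4 * τ := (norm_add_le _ _).trans (by linarith)
    rw [cd2_cd2, sub_eq_add_neg]
    have a1 := h (y' + k) hw k (by linarith)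
    have a2 := h (-(y' + k)) (by rwa [norm_neg]) k (by linarith)
    exact (abs_add_le _ _).trans (by linarith)
  have hbd : ∀ k, ‖k‖ ≤ 6 * τ → |cd2 u x k| ≤ B * (6 * τ) ^ σ := by
    intro k hk
    have := h 0 (by simpa using by positivity) k hk
    rw [add_zero] at this
    exact this.trans (by gcongr)
  have h1 : ∀ k, ‖k‖ ≤ 4 * τ → |cd2 u x (y' + k) - cd2 u x y'| ≤ 2 * (B * (6 * τ) ^ σ) := by
    intro k hk
    have a1 := hbd (y' + k) ((norm_add_le _ _).trans (by linarith))
    have a2 := hbd y' (by linarith)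
    exact (abs_sub _ _).trans (by linarith)
  have key := diff_le_of_cd2 (g := cd2 u x) (x := y') hγ hγ1 (by positivity : 0 < 4 * τ)
    (by positivity) (by positivity) h2 h1 (y - y') ((norm_sub_le _ _).trans (by linarith))
  rw [add_sub_cancel] at key
  refine key.trans ?_
  have e1 : 2 * (B * (6 * τ) ^ σ) / (4 * τ) ^ γ ≤ 72 * (B * τ ^ (σ - γ)) := by
    rw [div_le_iff₀ (by positivity), Real.mul_rpow (by norm_num) hτ.le,
      Real.mul_rpow (by norm_num) hτ.le]
    have c1 : (6 : ℝ) ^ σ ≤ 36 := by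
      calc (6 : ℝ) ^ σ ≤ 6 ^ (2 : ℝ) := Real.rpow_le_rpow_of_exponent_le (by norm_num) hσ2.le
        _ = 36 := by norm_num
    have c2 : (1 : ℝ) ≤ 4 ^ γ := Real.one_le_rpow (by norm_num) hγ
    have c3 : τ ^ σ = τ ^ (σ - γ) * τ ^ γ := by rw [← Real.rpow_add hτ]; congr 1; ring
    calc 2 * (B * (6 ^ σ * τ ^ σ)) ≤ 2 * (B * (36 * τ ^ σ)) := by gcongr
      _ = 72 * (B * τ ^ (σ - γ)) * (1 * τ ^ γ) := by rw [c3]; ring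
      _ ≤ _ := by gcongr
  have e2 : 2 * B * (4 * τ) ^ (σ - γ) ≤ 32 * (B * τ ^ (σ - γ)) := by
    rw [Real.mul_rpow (by norm_num) hτ.le]
    have c1 : (4 : ℝ) ^ (σ - γ) ≤ 16 := by
      calc (4 : ℝ) ^ (σ - γ) ≤ 4 ^ (2 : ℝ) :=
            Real.rpow_le_rpow_of_exponent_le (by norm_num) (by linarith)
        _ = 16 := by norm_num
    calc _ ≤ 2 * B * (16 * τ ^ (σ - γ)) := by gcongr
      _ = _ := by ring
  calc _ ≤ Cd (1 / 2) γ * (72 * (B * τ ^ (σ - γ)) + 32 * (B * τ ^ (σ - γ))) * ‖y - y'‖ ^ γ := by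
        gcongr
    _ = _ := by ring

end Local

section Problem

/-- The parameters of the equation; `c` and `c'` are the constants in the cone mass condition and
`σ` is an auxiliary exponent between `2s` and `2s + α`. -/
structure SchauderParams where
  (s γ α σ Lam M c c' : ℝ)
  s_pos : 0 < s
  s_lt_one : s < 1
  γ_nonneg : 0 ≤ γ
  γ_lt_one : γ < 1
  γ_lt : γ < 2 * s
  α_pos : 0 < α
  α_le_one : α ≤ 1
  lt_σ : 2 * s < σ
  σ_lt_two : σ < 2
  σ_le : σ ≤ 2 * s + α
  Lam_pos : 0 < Lam
  M_pos : 0 < M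
  c_pos : 0 < c
  c'_pos : 0 < c'

/-- The equation in the unit ball, with all data normalised by `D`. -/
structure SchauderProblem (P : SchauderParams) (K : Euc n → Measure (Euc n)) (u f : Euc n → ℝ)
    (D : ℝ) : Prop where
  symm : ∀ x, Measure.map (fun y => -y) (K x) = K x
  zero : ∀ x, K x {0} = 0
  upper : ∀ x, UpperGrowth P.s P.Lam (K x)
  cone : ∀ x, ConeMass P.s P.c P.c' (K x)
  kant : ∀ x x' : Euc n, KantCond P.s P.γ (K x) (K x') (P.M * ‖x - x'‖ ^ P.α)
  kernel : P.γ < P.α → ∀ x ∈ ball (0 : Euc n) 1,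
    kernelHolder P.s (P.α - P.γ) (K x) ≤ ENNReal.ofReal P.M
  cont : Continuous u
  bdd : ∀ x, |u x| ≤ D
  holder : ∀ x y, |u x - u y| ≤ D * ‖x - y‖ ^ P.γ
  rhs : ∀ x ∈ ball (0 : Euc n) 1, ∀ y ∈ ball (0 : Euc n) 1, |f x - f y| ≤ D * ‖x - y‖ ^ P.α
  eq : ∀ x ∈ ball (0 : Euc n) 1, LopTI (K x) u x = f x

lemma SchauderProblem.nonneg {P : SchauderParams} {K : Euc n → Measure (Euc n)}
    {u f : Euc n → ℝ} {D : ℝ} (h : SchauderProblem P K u f D) : 0 ≤ D :=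
  (abs_nonneg _).trans (h.bdd 0)

lemma LopTI_eq (K : Measure (Euc n)) (u : Euc n → ℝ) (x : Euc n) :
    LopTI K u x = (1 / 2) * ∫ y, -cd2 u x y ∂K := by
  unfold LopTI cd2
  congr 2
  ext y
  ring

lemma rpow_neg_le_inv_pow {r p : ℝ} (hr : 0 < r) (hr1 : r ≤ 1) (hp : p ≤ 4) :
    r ^ (-p) ≤ (r ^ 4)⁻¹ := by
  rw [← Real.rpow_natCast, ← Real.rpow_neg hr.le]
  exact Real.rpow_le_rpow_of_exponent_ge hr hr1 (by push_cast; linarith)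

lemma SchauderProblem.integrable_cd2 {P : SchauderParams} {K : Euc n → Measure (Euc n)}
    {u f : Euc n → ℝ} {D : ℝ} (h : SchauderProblem P K u f D) {x0 : Euc n} {d A : ℝ} (hd : 0 < d)
    (hA : 0 ≤ A) (hloc : LocBound (2 * P.s + P.α) A d x0 u) {x : Euc n} (hx : ‖x - x0‖ ≤ d / 4)
    (z : Euc n) : Integrable (fun y => cd2 u x y) (K z) := by
  have hs := P.s_pos
  have hσ := P.lt_σ
  have hc := h.cont
  refine (h.upper z).integrable_of_le hs hσ P.Lam_pos.le (r := d / 8)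
    (B := 256 * Cd (1 / 4) P.σ * (D * d ^ (-P.σ) + A * d ^ (2 * P.s + P.α - P.σ))) (by positivity)
    (by unfold cd2; fun_prop) (fun y hy => ?_) (abs_cd2_le h.bdd x)
  exact hloc.cd2_le (by linarith) P.σ_lt_two P.σ_le hA hd h.bdd hx hy.le

/-- Freezing the kernel at a different point. -/
lemma exists_frozen_bound (n : ℕ) (P : SchauderParams) :
    ∃ C ≥ 0, ∀ (K : Euc n → Measure (Euc n)) (u f : Euc n → ℝ) (D : ℝ), SchauderProblem P K u f D →
      ∀ (x0 : Euc n) (d A κ : ℝ), 0 < d → d ≤ 1 → (∀ x, ‖x - x0‖ ≤ d / 2 → x ∈ ball (0 : Euc n) 1) →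
      0 ≤ A → LocBound (2 * P.s + P.α) A d x0 u → 0 < κ → κ ≤ 1 / 32 →
      ∀ z x, ‖x - x0‖ ≤ d / 8 →
      |LopTI (K z) u x - f x| ≤
        C * ‖z - x‖ ^ P.α * (κ ^ (P.σ - 2 * P.s) * A + D * ((κ * d) ^ 4)⁻¹) := by
  obtain ⟨s, γ, α, σ, Lam, M, c, c', hs, hs1, hγ, hγ1, hγs, hα, hα1, hσ, hσ2, hσβ, hL, hM, -, -⟩ := P
  have hg1 := geo_pos (by linarith : 0 < σ - 2 * s)
  have hg2 := geo_pos (by linarith : 0 < 2 * s - γ)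
  have hC1 : 0 < Cd (1 / 4) σ := Cd_pos (quarter_mul_two_rpow_lt hσ2)
  have hC2 : 0 < Cd (1 / 2) γ := Cd_pos (half_mul_two_rpow_lt hγ1)
  set a := 104 * Cd (1 / 2) γ * (256 * Cd (1 / 4) σ) * geo (σ - 2 * s) with ha
  set b := 2 * geo (2 * s - γ) with hb
  refine ⟨M * (a + b), by positivity, ?_⟩
  intro K u f D hP x0 d A κ hd hd1 hball hA hloc hκ hκ1 z x hx
  have hintg := fun z => (hP.integrable_cd2 hd hA hloc (x := x) (by linarith) z).neg
  have hD := hP.nonneg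
  have hcd := hP.cont
  have hbd := hP.bdd
  have hhol := hP.holder
  simp only at *
  have hr : 0 < κ * d := by positivity
  have hrd : κ * d ≤ 1 / 32 * d := by gcongr
  have hr1 : κ * d ≤ 1 := by linarith
  set B0 := 256 * Cd (1 / 4) σ * (D * d ^ (-σ) + A * d ^ (2 * s + α - σ)) with hB0
  have hB0' : 0 ≤ B0 := by positivity
  have key := (hP.kant z x).abs_integral_sub_le hγ hγ1 hγs hσ (by positivity) (hP.zero z) (hP.zero x)
    (φ := fun y => -cd2 u x y) (by unfold cd2; fun_prop) (by simp [cd2_zero]) (hintg z) (hintg x)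
    (r := κ * d) (B := 104 * Cd (1 / 2) γ * B0) (D := 2 * D) hr (by positivity) (by positivity)
    (fun τ hτ hτr y y' hy hy' => by
      rw [neg_sub_neg, abs_sub_comm]
      have := cd2_holder_of_cd2_le (u := u) (x := x) hγ hγ1 (by linarith) hσ2 hB0' hτ
        (fun w hw k hk => hloc.cd2_le (by linarith) hσ2 hσβ hA hd hbd
          (by
            rw [add_sub_right_comm]
            exact (norm_add_le _ _).trans (by linarith)) (by linarith)) hy hy'
      refine this.trans_eq (by ring))
    (fun y y' => by
      rw [neg_sub_neg, abs_sub_comm]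
      have h1 := hhol (x + y) (x + y')
      have h2 := hhol (x - y) (x - y')
      rw [add_sub_add_left_eq_sub] at h1
      rw [sub_sub_sub_cancel_left, norm_sub_rev] at h2
      rw [show cd2 u x y - cd2 u x y' = (u (x + y) - u (x + y')) + (u (x - y) - u (x - y')) by
        unfold cd2; ring]
      exact (abs_add_le _ _).trans (by linarith))
  have hfx : f x = LopTI (K x) u x := (hP.eq x (hball x (by linarith))).symm
  rw [hfx, LopTI_eq, LopTI_eq, ← mul_sub, abs_mul, abs_of_pos (by norm_num : (0 : ℝ) < 1 / 2)]
  have e1 : d ^ (-σ) * (κ * d) ^ (σ - 2 * s) ≤ ((κ * d) ^ 4)⁻¹ := by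
    have : d ^ (-σ) ≤ (κ * d) ^ (-σ) :=
      Real.rpow_le_rpow_of_nonpos hr (by linarith) (by linarith)
    calc _ ≤ (κ * d) ^ (-σ) * (κ * d) ^ (σ - 2 * s) := by gcongr
      _ = (κ * d) ^ (-(2 * s)) := by rw [← Real.rpow_add hr]; congr 1; ring
      _ ≤ _ := rpow_neg_le_inv_pow hr hr1 (by linarith)
  have e2 : d ^ (2 * s + α - σ) * (κ * d) ^ (σ - 2 * s) ≤ κ ^ (σ - 2 * s) := by
    rw [Real.mul_rpow hκ.le hd.le, mul_left_comm, ← Real.rpow_add hd]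
    refine mul_le_of_le_one_right (by positivity) (Real.rpow_le_one hd.le hd1 (by linarith))
  have e3 : (κ * d) ^ (γ - 2 * s) ≤ ((κ * d) ^ 4)⁻¹ := by
    rw [← neg_sub]
    exact rpow_neg_le_inv_pow hr hr1 (by linarith)
  have hE : 0 ≤ κ ^ (σ - 2 * s) * A := by positivity
  have e4 : B0 * (κ * d) ^ (σ - 2 * s) ≤
      256 * Cd (1 / 4) σ * (κ ^ (σ - 2 * s) * A + D * ((κ * d) ^ 4)⁻¹) := by
    calc B0 * (κ * d) ^ (σ - 2 * s) = 256 * Cd (1 / 4) σ *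
          (A * (d ^ (2 * s + α - σ) * (κ * d) ^ (σ - 2 * s)) +
            D * (d ^ (-σ) * (κ * d) ^ (σ - 2 * s))) := by
          rw [hB0]; ring
      _ ≤ 256 * Cd (1 / 4) σ * (A * κ ^ (σ - 2 * s) + D * ((κ * d) ^ 4)⁻¹) := by gcongr
      _ = _ := by ring
  calc _ ≤ 1 / 2 * (2 * (M * ‖z - x‖ ^ α) * (104 * Cd (1 / 2) γ * B0 * (κ * d) ^ (σ - 2 * s) *
        geo (σ - 2 * s) + 2 * D * (κ * d) ^ (γ - 2 * s) * geo (2 * s - γ))) := by gcongr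
    _ = M * ‖z - x‖ ^ α * (104 * Cd (1 / 2) γ * geo (σ - 2 * s) * (B0 * (κ * d) ^ (σ - 2 * s)) +
        b * (D * (κ * d) ^ (γ - 2 * s))) := by rw [hb]; ring
    _ ≤ M * ‖z - x‖ ^ α * (104 * Cd (1 / 2) γ * geo (σ - 2 * s) *
        (256 * Cd (1 / 4) σ * (κ ^ (σ - 2 * s) * A + D * ((κ * d) ^ 4)⁻¹)) +
        b * (κ ^ (σ - 2 * s) * A + D * ((κ * d) ^ 4)⁻¹)) := by
      gcongr
      linarith [mul_le_mul_of_nonneg_left e3 hD]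
    _ = _ := by rw [ha]; ring

end Problem

section Operator

lemma integral_third_difference {μ : Measure (Euc n)} {a b c d : Euc n → ℝ} (ha : Integrable a μ)
    (hb : Integrable b μ) (hc : Integrable c μ) (hd : Integrable d μ) :
    ∫ y, (a y - 3 * b y + 3 * c y - d y) ∂μ =
      (∫ y, a y ∂μ) - 3 * (∫ y, b y ∂μ) + 3 * (∫ y, c y ∂μ) - ∫ y, d y ∂μ := by
  have i1 : Integrable (fun y => a y - 3 * b y) μ := ha.sub (hb.const_mul 3)
  have i2 : Integrable (fun y => a y - 3 * b y + 3 * c y) μ := i1.add (hc.const_mul 3)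
  rw [integral_sub i2 hd, integral_add i1 (hc.const_mul 3), integral_sub ha (hb.const_mul 3),
    integral_const_mul, integral_const_mul]

lemma integral_second_difference {μ : Measure (Euc n)} {a b c : Euc n → ℝ} (ha : Integrable a μ)
    (hb : Integrable b μ) (hc : Integrable c μ) :
    ∫ y, (2 * a y - b y - c y) ∂μ = 2 * (∫ y, a y ∂μ) - (∫ y, b y ∂μ) - ∫ y, c y ∂μ := by
  have i1 : Integrable (fun y => 2 * a y - b y) μ := (ha.const_mul 2).sub hb
  rw [integral_sub i1 hc, integral_sub (ha.const_mul 2) hb, integral_const_mul]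

/-- The truncated operator acting on third differences of a solution. -/
lemma exists_truncated_op_bound (n : ℕ) (P : SchauderParams) :
    ∃ C ≥ 0, ∀ (K : Euc n → Measure (Euc n)) (u f : Euc n → ℝ) (D : ℝ), SchauderProblem P K u f D →
      ∀ (x0 : Euc n) (d A κ : ℝ), 0 < d → d ≤ 1 → (∀ x, ‖x - x0‖ ≤ d / 2 → x ∈ ball (0 : Euc n) 1) →
      0 ≤ A → LocBound (2 * P.s + P.α) A d x0 u → 0 < κ → κ ≤ 1 / 32 →
      ∀ h z, ‖h‖ ≤ κ * d / 8 → ‖z - x0‖ ≤ d / 16 →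
      Integrable (fun y => (1 - chi (κ * d) y) *
        (2 * cd3 u z h - cd3 u (z + y) h - cd3 u (z - y) h)) (K z) ∧
      (0 ≤ cd3 u z h →
        (1 / 2) * ∫ y, (1 - chi (κ * d) y) *
          (2 * cd3 u z h - cd3 u (z + y) h - cd3 u (z - y) h) ∂(K z) ≤
        C * ‖h‖ ^ P.α * (κ ^ (P.σ - 2 * P.s) * A + D * ((κ * d) ^ 4)⁻¹)) := by
  obtain ⟨C1, hC1, hfrozen⟩ := exists_frozen_bound n P
  obtain ⟨C2, hC2, hfar⟩ := exists_far_bound n P.s_pos P.s_lt_one P.γ_nonneg P.γ_lt_one P.α_pos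
    P.α_le_one P.Lam_pos.le P.M_pos.le
  refine ⟨24 * C1 + 12 + C2, by positivity, ?_⟩
  intro K u f D hP x0 d A κ hd hd1 hball hA hloc hκ hκ1 h z hh hz
  have hD := hP.nonneg
  have hα := P.α_pos
  have hr : 0 < κ * d := by positivity
  have hrd : κ * d ≤ 1 / 32 * d := by gcongr
  have hr1 : κ * d ≤ 1 := by linarith
  have hcu := hP.cont
  have hcχ := continuous_chi (n := n) (κ * d)
  set E := κ ^ (P.σ - 2 * P.s) * A + D * ((κ * d) ^ 4)⁻¹ with hE
  have hE0 : 0 ≤ E := by positivity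
  have hDE : D * ((κ * d) ^ 4)⁻¹ ≤ E := by
    rw [hE]
    have : 0 ≤ κ ^ (P.σ - 2 * P.s) * A := by positivity
    linarith
  have hDE' : D ≤ E := by
    have : 1 ≤ ((κ * d) ^ 4)⁻¹ := (one_le_inv₀ (by positivity)).mpr (pow_le_one₀ hr.le hr1)
    nlinarith
  have hxt : ∀ t : ℝ, |t| ≤ 3 → ‖z + t • h - x0‖ ≤ d / 8 := by
    intro t ht
    rw [add_sub_right_comm]
    have : ‖t • h‖ ≤ 3 * ‖h‖ := by rw [norm_smul, Real.norm_eq_abs]; gcongr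
    exact (norm_add_le _ _).trans (by linarith)
  have hpow : ∀ c : ℝ, 1 ≤ c → (c * ‖h‖) ^ P.α ≤ c * ‖h‖ ^ P.α := fun c hc =>
    rpow_mul_le_of_one_le P.α_le_one hc (norm_nonneg h)
  have herr : ∀ t : ℝ, |t| ≤ 3 → |LopTI (K z) u (z + t • h) - f (z + t • h)| ≤
      3 * C1 * ‖h‖ ^ P.α * E := by
    intro t ht
    refine (hfrozen K u f D hP x0 d A κ hd hd1 hball hA hloc hκ hκ1 z _ (hxt t ht)).trans ?_
    have : ‖z - (z + t • h)‖ ≤ 3 * ‖h‖ := by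
      rw [sub_add_cancel_left, norm_neg, norm_smul, Real.norm_eq_abs]; gcongr
    calc _ ≤ C1 * (3 * ‖h‖) ^ P.α * E := by gcongr
      _ ≤ C1 * (3 * ‖h‖ ^ P.α) * E := by gcongr; exact hpow 3 (by norm_num)
      _ = _ := by ring
  have hmem : ∀ t : ℝ, |t| ≤ 3 → z + t • h ∈ ball (0 : Euc n) 1 := fun t ht =>
    hball _ ((hxt t ht).trans (by linarith))
  have hf : ∀ t t' : ℝ, |t| ≤ 3 → |t'| ≤ 3 → 1 ≤ |t - t'| →
      |f (z + t • h) - f (z + t' • h)| ≤ |t - t'| * (E * ‖h‖ ^ P.α) := by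
    intro t t' ht ht' htt
    refine (hP.rhs _ (hmem t ht) _ (hmem t' ht')).trans ?_
    rw [add_sub_add_left_eq_sub, ← sub_smul, norm_smul, Real.norm_eq_abs]
    calc _ ≤ E * (|t - t'| * ‖h‖ ^ P.α) := by gcongr; exact hpow _ htt
      _ = _ := by ring
  have hintg : ∀ t : ℝ, |t| ≤ 3 → Integrable (fun y => -cd2 u (z + t • h) y) (K z) := fun t ht =>
    (hP.integrable_cd2 hd hA hloc (x := z + t • h) ((hxt t ht).trans (by linarith)) z).neg
  have a3 : |(3 : ℝ)| ≤ 3 := by norm_num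
  have a1 : |(1 : ℝ)| ≤ 3 := by norm_num
  have a1' : |(-1 : ℝ)| ≤ 3 := by norm_num
  have a3' : |(-3 : ℝ)| ≤ 3 := by norm_num
  set g : Euc n → ℝ := fun y => 2 * cd3 u z h - cd3 u (z + y) h - cd3 u (z - y) h with hg
  have hgeq : g = fun y => -cd2 u (z + (3 : ℝ) • h) y - 3 * -cd2 u (z + (1 : ℝ) • h) y
      + 3 * -cd2 u (z + (-1 : ℝ) • h) y - -cd2 u (z + (-3 : ℝ) • h) y := by
    ext y
    simp only [hg, cd2, cd3]
    rw [show z + (1 : ℝ) • h = z + h by module, show z + (-1 : ℝ) • h = z - h by module,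
      show z + (-3 : ℝ) • h = z - (3 : ℝ) • h by module,
      show z + y + (3 : ℝ) • h = z + (3 : ℝ) • h + y by module,
      show z - y + (3 : ℝ) • h = z + (3 : ℝ) • h - y by module,
      show z + y - (3 : ℝ) • h = z - (3 : ℝ) • h + y by module,
      show z - y - (3 : ℝ) • h = z - (3 : ℝ) • h - y by module,
      show z + y + h = z + h + y by module, show z - y + h = z + h - y by module,
      show z + y - h = z - h + y by module, show z - y - h = z - h - y by module]
    ring
  have i3 := hintg 3 a3
  have i1 := hintg 1 a1
  have i1' := hintg (-1) a1'
  have i3' := hintg (-3) a3'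
  have hgint : Integrable g (K z) := by
    rw [hgeq]
    exact ((i3.sub (i1.const_mul 3)).add (i1'.const_mul 3)).sub i3'
  have hgval : (1 / 2) * ∫ y, g y ∂(K z) = LopTI (K z) u (z + (3 : ℝ) • h)
      - 3 * LopTI (K z) u (z + (1 : ℝ) • h) + 3 * LopTI (K z) u (z + (-1 : ℝ) • h)
      - LopTI (K z) u (z + (-3 : ℝ) • h) := by
    rw [hgeq, integral_third_difference i3 i1 i1' i3']
    simp only [LopTI_eq]
    ring
  have hgabs : (1 / 2) * ∫ y, g y ∂(K z) ≤ (24 * C1 + 12) * ‖h‖ ^ P.α * E := by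
    rw [hgval]
    have e1 := (abs_le.mp (herr 3 a3)).2
    have e2 := (abs_le.mp (herr 1 a1)).1
    have e3 := (abs_le.mp (herr (-1) a1')).2
    have e4 := (abs_le.mp (herr (-3) a3')).1
    have e5 := (abs_le.mp (hf 3 (-3) a3 a3' (by norm_num))).2
    have e6 := (abs_le.mp (hf 1 (-1) a1 a1' (by norm_num))).1
    rw [show |(3 : ℝ) - -3| = 6 by norm_num] at e5
    rw [show |(1 : ℝ) - -1| = 2 by norm_num] at e6
    linarith
  have hχ1 : ∀ y : Euc n, |chi (κ * d) y| ≤ 1 := fun y => by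
    rw [abs_of_nonneg (chi_nonneg _ _)]; exact chi_le_one _ _
  have hub : ∀ x, |cd3 u x h| ≤ 8 * D := fun x => abs_cd3_le fun a _ => hP.bdd _
  have hχint : ∀ v : Euc n → ℝ, Continuous v → (∀ y, |v y| ≤ 8 * D) →
      Integrable (fun y => chi (κ * d) y * v y) (K z) := by
    intro v hv hvb
    refine (hP.upper z).integrable_of_far P.s_pos P.Lam_pos.le (B := 8 * D) hr (by fun_prop)
      (fun y hy => by rw [chi_eq_zero hr hy.le, zero_mul]) fun y => ?_
    rw [abs_mul]
    exact (mul_le_of_le_one_left (abs_nonneg _) (hχ1 y)).trans (hvb y)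
  have c0 : Continuous fun x => cd3 u x h := by unfold cd3; fun_prop
  have j0 := hχint (fun _ => cd3 u z h) continuous_const (fun _ => hub z)
  have j1 := hχint (fun y => cd3 u (z + y) h) (c0.comp (by fun_prop)) (fun _ => hub _)
  have j2 := hχint (fun y => cd3 u (z - y) h) (c0.comp (by fun_prop)) (fun _ => hub _)
  have jg : Integrable (fun y => chi (κ * d) y * g y) (K z) := by
    have := ((j0.const_mul 2).sub j1).sub j2
    refine this.congr (Filter.Eventually.of_forall fun y => ?_)
    simp only [Pi.sub_apply, hg]
    ring
  have hsplit : ∫ y, (1 - chi (κ * d) y) * g y ∂(K z) =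
      (∫ y, g y ∂(K z)) - ∫ y, chi (κ * d) y * g y ∂(K z) := by
    rw [← integral_sub hgint jg]
    congr 1
    ext y
    ring
  refine ⟨?_, fun hwz => ?_⟩
  · refine (hgint.sub jg).congr (Filter.Eventually.of_forall fun y => ?_)
    simp only [Pi.sub_apply]
    ring
  rw [hsplit]
  have hfar1 := hfar (K z) (hP.symm z) (hP.upper z)
    (fun hlt => hP.kernel hlt z (hball z (hz.trans (by linarith)))) u hcu D hD hP.holder (κ * d) hr
    hr1 h hh z
  have hχg : ∫ y, chi (κ * d) y * g y ∂(K z) = 2 * (∫ y, chi (κ * d) y * cd3 u z h ∂(K z))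
      - 2 * ∫ y, chi (κ * d) y * cd3 u (z + y) h ∂(K z) := by
    have hsym : ∫ y, chi (κ * d) y * cd3 u (z - y) h ∂(K z) =
        ∫ y, chi (κ * d) y * cd3 u (z + y) h ∂(K z) := by
      rw [← integral_neg_eq_of_symm (hP.symm z)]
      simp only [chi_neg, sub_neg_eq_add]
    have : ∫ y, chi (κ * d) y * g y ∂(K z) = 2 * (∫ y, chi (κ * d) y * cd3 u z h ∂(K z))
        - (∫ y, chi (κ * d) y * cd3 u (z + y) h ∂(K z))
        - ∫ y, chi (κ * d) y * cd3 u (z - y) h ∂(K z) := by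
      rw [← integral_second_difference j0 j1 j2]
      congr 1
      ext y
      simp only [hg]
      ring
    rw [this, hsym]
    ring
  have hnn : 0 ≤ ∫ y, chi (κ * d) y * cd3 u z h ∂(K z) :=
    integral_nonneg fun y => mul_nonneg (chi_nonneg _ _) hwz
  have hfar2 : C2 * D * ((κ * d) ^ 4)⁻¹ * ‖h‖ ^ P.α ≤ C2 * ‖h‖ ^ P.α * E := by
    calc _ = C2 * ‖h‖ ^ P.α * (D * ((κ * d) ^ 4)⁻¹) := by ring
      _ ≤ _ := by gcongr
  have := (abs_le.mp hfar1).2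
  rw [hχg]
  linarith

end Operator

section ThirdDifference

variable {β σ μ A d : ℝ} {x0 h : Euc n} {u : Euc n → ℝ}

/-- The normalised third difference of `u` with step `h`. -/
def nd3 (β A : ℝ) (u : Euc n → ℝ) (h z : Euc n) : ℝ := cd3 u z h / (A * ‖h‖ ^ β)

lemma LocBound.abs_nd3_le (hloc : LocBound β A d x0 u) (hA : 0 < A) (hh : 0 < ‖h‖)
    (hhd : ‖h‖ ≤ d / 64) {z : Euc n} (hz : ‖z - x0‖ ≤ d / 2) : |nd3 β A u h z| ≤ 16 := by
  have := hloc z hz h (by linarith)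
  rw [nd3, abs_div, abs_of_pos (by positivity : 0 < A * ‖h‖ ^ β), div_le_iff₀ (by positivity)]
  linarith

lemma LocBound.abs_cd3_nd3_le (hloc : LocBound β A d x0 u) (hA : 0 < A) (hh : 0 < ‖h‖)
    (hhd : ‖h‖ ≤ d / 64) {z : Euc n} (hz : ‖z - x0‖ ≤ 3 * d / 8) {k : Euc n} (hk : ‖k‖ ≤ d / 32) :
    |cd3 (nd3 β A u h) z k| ≤ 128 * (‖k‖ / ‖h‖) ^ β := by
  have e : cd3 (nd3 β A u h) z k = cd3 (fun y => cd3 u y h) z k / (A * ‖h‖ ^ β) := by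
    simp only [nd3, cd3]; ring
  have h1 : |cd3 (fun y => cd3 u y k) z h| ≤ 8 * (16 * A * ‖k‖ ^ β) := by
    refine abs_cd3_le fun a ha => hloc _ ?_ k hk
    rw [add_sub_right_comm]
    have : ‖a • h‖ ≤ 3 * ‖h‖ := by rw [norm_smul, Real.norm_eq_abs]; gcongr
    exact (norm_add_le _ _).trans (by linarith)
  rw [e, cd3_comm, abs_div, abs_of_pos (by positivity : 0 < A * ‖h‖ ^ β),
    div_le_iff₀ (by positivity), Real.div_rpow (norm_nonneg k) hh.le]
  calc _ ≤ _ := h1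
    _ = 128 * (‖k‖ ^ β / ‖h‖ ^ β * ‖h‖ ^ β) * A := by
      rw [div_mul_cancel₀ _ (by positivity)]; ring
    _ = _ := by ring

lemma LocBound.abs_cd2_nd3_le (hloc : LocBound β A d x0 u) (hσ : 0 ≤ σ) (hσ2 : σ < 2) (hσβ : σ ≤ β)
    (hA : 0 < A) (hh : 0 < ‖h‖) (hhd : ‖h‖ ≤ d / 64) {z : Euc n} (hz : ‖z - x0‖ ≤ d / 4)
    {k : Euc n} (hk : ‖k‖ ≤ ‖h‖) :
    |cd2 (nd3 β A u h) z k| ≤ 192 * Cd (1 / 4) σ * (‖k‖ / ‖h‖) ^ σ := by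
  have h3 : ∀ x k : Euc n, ‖x - x0‖ ≤ 3 * d / 8 → ‖k‖ ≤ ‖h‖ / 4 →
      |cd3 (nd3 β A u h) x k| ≤ 128 / ‖h‖ ^ σ * ‖k‖ ^ σ := by
    intro x k hx hk
    refine (hloc.abs_cd3_nd3_le hA hh hhd hx (by linarith)).trans ?_
    calc 128 * (‖k‖ / ‖h‖) ^ β ≤ 128 * (‖k‖ / ‖h‖) ^ σ := by
          refine mul_le_mul_of_nonneg_left ?_ (by norm_num)
          exact Real.rpow_le_rpow_of_exponent_ge' (by positivity)
            ((div_le_one hh).mpr (by linarith)) hσ hσβ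
      _ = _ := by rw [Real.div_rpow (norm_nonneg k) hh.le]; ring
  have h2 : ∀ k, ‖k‖ ≤ ‖h‖ → |cd2 (nd3 β A u h) z k| ≤ 64 := by
    intro k hk
    have b := fun x hx => abs_le.mp (hloc.abs_nd3_le (z := x) hA hh hhd hx)
    have b1 := b (z + k) (by
      rw [add_sub_right_comm]; exact (norm_add_le _ _).trans (by linarith))
    have b2 := b (z - k) (by
      rw [sub_right_comm]; exact (norm_sub_le _ _).trans (by linarith))
    have b3 := b z (by linarith)
    unfold cd2
    rw [abs_le]
    constructor <;> linarith [b1.1, b1.2, b2.1, b2.2, b3.1, b3.2]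
  refine (cd2_le_of_cd3 (b := 128 / ‖h‖ ^ σ) hσ hσ2 hh (by positivity) (by norm_num)
    (fun k hk => ⟨?_, ?_⟩) h2 k hk).trans_eq ?_
  · refine h3 _ _ ?_ hk
    rw [add_sub_right_comm]; exact (norm_add_le _ _).trans (by linarith)
  · refine h3 _ _ ?_ hk
    rw [sub_right_comm]; exact (norm_sub_le _ _).trans (by linarith)
  · rw [Real.div_rpow (norm_nonneg k) hh.le]; ring

lemma LocBound.abs_nd3_sub_le (hloc : LocBound β A d x0 u) (hμ : 0 ≤ μ) (hμ1 : μ < 1) (hμσ : μ ≤ σ)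
    (hσ2 : σ < 2) (hσβ : σ ≤ β)
    (hA : 0 < A) (hh : 0 < ‖h‖) (hhd : ‖h‖ ≤ d / 64) {p : Euc n} (hp : ‖p - x0‖ ≤ d / 8)
    {k : Euc n} (hk : ‖k‖ ≤ ‖h‖) :
    |nd3 β A u h (p + k) - nd3 β A u h p| ≤
      Cd (1 / 2) μ * (32 + 192 * Cd (1 / 4) σ) * (‖k‖ / ‖h‖) ^ μ := by
  have hC : 0 < Cd (1 / 4) σ := Cd_pos (quarter_mul_two_rpow_lt hσ2)
  have hn : ∀ k : Euc n, ‖k‖ ≤ ‖h‖ → ‖p + k - x0‖ ≤ d / 4 := by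
    intro k hk
    rw [add_sub_right_comm]; exact (norm_add_le _ _).trans (by linarith)
  refine (diff_le_of_cd2 (b := 192 * Cd (1 / 4) σ / ‖h‖ ^ μ) (B := 32) hμ hμ1 hh (by positivity)
    (by norm_num) (fun k hk => ?_) (fun k hk => ?_) k hk).trans_eq ?_
  · refine (hloc.abs_cd2_nd3_le (hμ.trans hμσ) hσ2 hσβ hA hh hhd (hn k (by linarith))
      (by linarith)).trans ?_
    calc 192 * Cd (1 / 4) σ * (‖k‖ / ‖h‖) ^ σ ≤ 192 * Cd (1 / 4) σ * (‖k‖ / ‖h‖) ^ μ := by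
          refine mul_le_mul_of_nonneg_left ?_ (by positivity)
          exact Real.rpow_le_rpow_of_exponent_ge' (by positivity)
            ((div_le_one hh).mpr (by linarith)) hμ hμσ
      _ = _ := by rw [Real.div_rpow (norm_nonneg k) hh.le]; ring
  · have b := fun x hx => abs_le.mp (hloc.abs_nd3_le (z := x) hA hh hhd hx)
    have b1 := b (p + k) ((hn k hk).trans (by linarith))
    have b3 := b p (by linarith)
    rw [abs_le]
    constructor <;> linarith [b1.1, b1.2, b3.1, b3.2]
  · rw [Real.div_rpow (norm_nonneg k) hh.le]; ring

end ThirdDifference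

section Improvement

/-- Weighted interior bound for third differences in the unit ball. -/
def WeightedBound (β Q : ℝ) (u : Euc n → ℝ) : Prop :=
  ∀ x h : Euc n, ‖x‖ < 1 → 16 * ‖h‖ ≤ 1 - ‖x‖ → (1 - ‖x‖) ^ 4 * |cd3 u x h| ≤ Q * ‖h‖ ^ β

lemma WeightedBound.abs_cd3_le {β Q t : ℝ} {u : Euc n → ℝ} (hQ : WeightedBound β Q u)
    {x h : Euc n} (ht : 0 < t) (htx : t ≤ 1 - ‖x‖) (hh : 16 * ‖h‖ ≤ t) :
    |cd3 u x h| ≤ Q / t ^ 4 * ‖h‖ ^ β := by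
  rw [div_mul_eq_mul_div, le_div_iff₀ (by positivity), mul_comm]
  refine le_trans ?_ (hQ x h (by linarith) (by linarith))
  gcongr

lemma one_sub_norm_ge {x0 x : Euc n} {e : ℝ} (h : ‖x - x0‖ ≤ e) : 1 - ‖x0‖ - e ≤ 1 - ‖x‖ := by
  have := norm_sub_norm_le x x0
  linarith

lemma WeightedBound.locBound {β Q : ℝ} {u : Euc n → ℝ} (hQ : WeightedBound β Q u)
    {x0 : Euc n} (hx0 : ‖x0‖ < 1) : LocBound β (Q / (1 - ‖x0‖) ^ 4) (1 - ‖x0‖) x0 u := by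
  intro x hx h hh
  have := one_sub_norm_ge hx
  refine (hQ.abs_cd3_le (t := (1 - ‖x0‖) / 2) (by linarith) (by linarith) (by linarith)).trans_eq ?_
  rw [div_pow, div_div_eq_mul_div]
  ring

lemma pow_mul_le_cd3 (u : Euc n → ℝ) (h : Euc n) {b : ℝ} (m : ℕ) : ∀ x : Euc n,
    (∀ p, ‖p - x‖ ≤ 3 * 2 ^ m * ‖h‖ → b ≤ cd3 u p h) → 8 ^ m * b ≤ cd3 u x ((2 : ℝ) ^ m • h) := by
  induction m with
  | zero => intro x hx; simpa using hx x (by simp)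
  | succ m ih =>
    intro x hx
    have key : ∀ t : ℝ, |t| ≤ 3 → 8 ^ m * b ≤ cd3 u (x + t • (2 : ℝ) ^ m • h) ((2 : ℝ) ^ m • h) := by
      intro t ht
      refine ih _ fun p hp => hx p ?_
      have e : p - x = (p - (x + t • (2 : ℝ) ^ m • h)) + t • (2 : ℝ) ^ m • h := by abel
      have e2 : ‖t • (2 : ℝ) ^ m • h‖ ≤ 3 * (2 ^ m * ‖h‖) := by
        rw [norm_smul, norm_smul, Real.norm_eq_abs, Real.norm_of_nonneg (by positivity)]
        gcongr
      rw [e, pow_succ]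
      exact (norm_add_le _ _).trans (by linarith)
    have k1 := key 3 (by norm_num)
    have k2 := key 1 (by norm_num)
    have k3 := key (-1) (by norm_num)
    have k4 := key (-3) (by norm_num)
    rw [one_smul] at k2
    rw [neg_one_smul, ← sub_eq_add_neg] at k3
    rw [neg_smul, ← sub_eq_add_neg] at k4
    rw [pow_succ' (2 : ℝ) m, pow_succ (8 : ℝ) m, mul_smul, cd3_two_smul]
    linarith

lemma WeightedBound.nd3_le {β Q δ : ℝ} {u : Euc n → ℝ} (hQ : WeightedBound β Q u) (hQ0 : 0 < Q)
    {x0 h0 x : Euc n} (hx0 : ‖x0‖ < 1) (hρ : 0 < ‖h0‖) (hδ : 0 < δ) (hδ4 : δ ≤ 1 / 4)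
    (hρ64 : ‖h0‖ ≤ (1 - ‖x0‖) / 64) (hx : ‖x - x0‖ ≤ δ / 8 * (1 - ‖x0‖)) :
    nd3 β (Q / (1 - ‖x0‖) ^ 4) u h0 x ≤ 1 + δ := by
  have h1 := one_sub_norm_ge hx
  set d := 1 - ‖x0‖ with hd
  have hd0 : 0 < d := by linarith
  set A := Q / d ^ 4 with hA
  have hA0 : 0 < A := by positivity
  have hN : 0 < A * ‖h0‖ ^ β := by positivity
  have hθ : 0 < 1 - δ / 8 := by linarith
  have hδd : δ / 8 * d ≤ 1 / 32 * d := by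
    have : δ / 8 ≤ 1 / 32 := by linarith
    gcongr
  have h2 := hQ.abs_cd3_le (x := x) (h := h0) (t := (1 - δ / 8) * d) (by positivity)
    (by linarith) (by linarith)
  rw [nd3, div_le_iff₀ hN]
  refine (le_abs_self _).trans (h2.trans ?_)
  have h3 : Q / ((1 - δ / 8) * d) ^ 4 = A / (1 - δ / 8) ^ 4 := by
    rw [hA, div_div, mul_pow, mul_comm]
  rw [h3, ← mul_assoc]
  refine mul_le_mul_of_nonneg_right ?_ (by positivity)
  rw [div_le_iff₀ (by positivity)]
  have h4 : 1 ≤ (1 + δ) * (1 - δ / 8) ^ 4 := by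
    have := one_add_mul_le_pow (a := -(δ / 8)) (by linarith) 4
    push_cast at this
    rw [← sub_eq_add_neg] at this
    calc 1 ≤ (1 + δ) * (1 + 4 * -(δ / 8)) := by nlinarith
      _ ≤ _ := by gcongr
  calc A = A * 1 := (mul_one A).symm
    _ ≤ A * ((1 + δ) * (1 - δ / 8) ^ 4) := by gcongr
    _ = _ := by ring

lemma WeightedBound.nearMax {P : SchauderParams} {K : Euc n → Measure (Euc n)} {u f : Euc n → ℝ}
    {D Q δ κ R C : ℝ} (hWB : WeightedBound (2 * P.s + P.α) Q u) (hP : SchauderProblem P K u f D)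
    (hQ : 0 < Q) {x0 h0 : Euc n} (hx0 : ‖x0‖ < 1) (hρ : 0 < ‖h0‖) (hδ : 0 < δ) (hδ4 : δ ≤ 1 / 4)
    (hR : 2 * (R * ‖h0‖) ≤ δ / 16 * (1 - ‖x0‖)) (hρ64 : ‖h0‖ ≤ (1 - ‖x0‖) / 64)
    (hρκ : ‖h0‖ ≤ κ * (1 - ‖x0‖) / 8) (hκ : 0 < κ)
    (hκd2 : κ * (1 - ‖x0‖) ≤ δ / 32 * (1 - ‖x0‖))
    (hκC : C * κ ^ (P.σ - 2 * P.s) ≤ δ / 2) (hQC : 2 * C / (δ * κ ^ 4) * D ≤ Q)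
    (hop : ∀ z, ‖z - x0‖ ≤ (1 - ‖x0‖) / 16 →
      Integrable (fun y => (1 - chi (κ * (1 - ‖x0‖)) y) *
        (2 * cd3 u z h0 - cd3 u (z + y) h0 - cd3 u (z - y) h0)) (K z) ∧
      (0 ≤ cd3 u z h0 →
        (1 / 2) * ∫ y, (1 - chi (κ * (1 - ‖x0‖)) y) *
          (2 * cd3 u z h0 - cd3 u (z + y) h0 - cd3 u (z - y) h0) ∂(K z) ≤
        C * ‖h0‖ ^ P.α * (κ ^ (P.σ - 2 * P.s) * (Q / (1 - ‖x0‖) ^ 4) +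
          D * ((κ * (1 - ‖x0‖)) ^ 4)⁻¹))) :
    NearMax P.s P.σ P.Lam P.c P.c' (192 * Cd (1 / 4) P.σ) K
      (fun y => 1 - chi (κ * (1 - ‖x0‖)) y) (nd3 (2 * P.s + P.α) (Q / (1 - ‖x0‖) ^ 4) u h0) x0
      (2 * (R * ‖h0‖)) ‖h0‖ δ := by
  have hσ := P.lt_σ
  have hs := P.s_pos
  have hWup := fun x => hWB.nd3_le hQ (x := x) hx0 hρ hδ hδ4 hρ64
  have hloc := hWB.locBound hx0
  set β := 2 * P.s + P.α with hβ
  set d := 1 - ‖x0‖ with hd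
  have hd0 : 0 < d := by linarith
  set A := Q / d ^ 4 with hA
  have hA0 : 0 < A := by positivity
  have hN : 0 < A * ‖h0‖ ^ β := by positivity
  have hκd : 0 < κ * d := by positivity
  have hδd : δ / 16 * d ≤ 1 / 64 * d := by
    have : δ / 16 ≤ 1 / 64 := by linarith
    gcongr
  have hz : ∀ z ∈ closedBall x0 (2 * (R * ‖h0‖)), ‖z - x0‖ ≤ δ / 16 * d := by
    intro z hz
    rw [mem_closedBall, dist_eq_norm] at hz
    linarith
  have hη : ∀ y : Euc n, 1 - chi (κ * d) y ≠ 0 → ‖y‖ ≤ 2 * (κ * d) := by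
    intro y hy
    by_contra! h
    exact hy (by rw [chi_eq_one hκd h.le, sub_self])
  have hg : ∀ z, (fun y => (1 - chi (κ * d) y) *
      (2 * nd3 β A u h0 z - nd3 β A u h0 (z + y) - nd3 β A u h0 (z - y))) =
      fun y => (A * ‖h0‖ ^ β)⁻¹ * ((1 - chi (κ * d) y) *
        (2 * cd3 u z h0 - cd3 u (z + y) h0 - cd3 u (z - y) h0)) := by
    intro z
    ext y
    simp only [nd3]
    ring
  constructor
  · exact fun z _ => hP.upper z
  · exact fun z _ => hP.cone z
  · exact fun y => sub_nonneg.mpr (chi_le_one _ _)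
  · exact fun y => by linarith [chi_nonneg (κ * d) y]
  · intro y hy
    rw [chi_eq_zero hκd (by linarith), sub_zero]
  · intro z hz1 y hy
    refine hWup _ ?_
    rw [add_sub_right_comm]
    exact (norm_add_le _ _).trans (by linarith [hz z hz1, hη y hy])
  · intro z hz1 y hy
    refine hWup _ ?_
    rw [sub_right_comm]
    exact (norm_sub_le _ _).trans (by linarith [hz z hz1, hη y hy])
  · intro z hz1 y hy
    exact hloc.abs_cd2_nd3_le (by linarith) P.σ_lt_two P.σ_le hA0 hρ hρ64 (by linarith [hz z hz1]) hy
  · intro z hz1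
    rw [hg]
    exact (hop z (by linarith [hz z hz1])).1.const_mul _
  · intro z hz1 hW
    rw [hg, integral_const_mul, mul_left_comm]
    have h1 := (hop z (by linarith [hz z hz1])).2 (by
      rw [nd3] at hW
      by_contra! hneg
      exact absurd hW (not_le.mpr (div_neg_of_neg_of_pos hneg hN)))
    have e1 : C * (D * ((κ * d) ^ 4)⁻¹) ≤ δ / 2 * A := by
      rw [div_mul_eq_mul_div, div_le_iff₀ (by positivity)] at hQC
      rw [hA, mul_pow, ← div_eq_mul_inv, ← mul_div_assoc, ← mul_div_assoc, ← div_div,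
        div_le_div_iff_of_pos_right (by positivity), div_le_iff₀ (by positivity)]
      linarith
    have e2 : ‖h0‖ ^ P.α = ‖h0‖ ^ β * ‖h0‖ ^ (-(2 * P.s)) := by
      rw [← Real.rpow_add hρ, hβ]; congr 1; ring
    have e3 : C * (κ ^ (P.σ - 2 * P.s) * A + D * ((κ * d) ^ 4)⁻¹) ≤ δ * A := by
      have := mul_le_mul_of_nonneg_right hκC hA0.le
      linarith
    rw [inv_mul_le_iff₀ hN]
    refine h1.trans ?_
    calc _ = C * (κ ^ (P.σ - 2 * P.s) * A + D * ((κ * d) ^ 4)⁻¹) * ‖h0‖ ^ P.α := by ring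
      _ ≤ δ * A * ‖h0‖ ^ P.α := by gcongr
      _ = _ := by rw [e2]; ring

/-- If the weighted bound holds with a constant much larger than the data, it improves. -/
lemma exists_improvement (n : ℕ) (P : SchauderParams) :
    ∃ C > 0, ∃ δ > 0, δ ≤ 1 / 4 ∧ ∀ (K : Euc n → Measure (Euc n)) (u f : Euc n → ℝ) (D : ℝ),
      SchauderProblem P K u f D → ∀ Q > 0, C * D ≤ Q → WeightedBound (2 * P.s + P.α) Q u →
        WeightedBound (2 * P.s + P.α) ((1 - δ) * Q) u := by
  set β := 2 * P.s + P.α with hβ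
  have hs := P.s_pos
  have hs1 := P.s_lt_one
  have hα := P.α_pos
  have hα1 := P.α_le_one
  have hσ := P.lt_σ
  have hσ2 := P.σ_lt_two
  have hσβ := P.σ_le
  have hβ0 : 0 < β := by positivity
  have hβ3 : β < 3 := by linarith
  have hC1 : 0 < Cd (1 / 4) P.σ := Cd_pos (quarter_mul_two_rpow_lt hσ2)
  have hC2 : 0 < Cd (1 / 2) P.s := Cd_pos (half_mul_two_rpow_lt hs1)
  obtain ⟨m, hm⟩ := exists_pow_lt_of_lt_one (by norm_num : (0 : ℝ) < 1 / 2)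
    (by
      rw [div_lt_one (by norm_num)]
      calc (2 : ℝ) ^ β < 2 ^ (3 : ℝ) := Real.rpow_lt_rpow_of_exponent_lt (by norm_num) hβ3
        _ = 8 := by norm_num : (2 : ℝ) ^ β / 8 < 1)
  set R : ℝ := 3 * 2 ^ m with hR
  have hR0 : 0 < R := by positivity
  obtain ⟨δ, hδ, hδ4, hprop⟩ := exists_propagation n (C0 := 192 * Cd (1 / 4) P.σ)
    (C1 := Cd (1 / 2) P.s * (32 + 192 * Cd (1 / 4) P.σ)) (R := R) hs hσ P.Lam_pos P.c_pos P.c'_pos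
    (by positivity) (by positivity) hs
  obtain ⟨C3, hC3, hop⟩ := exists_truncated_op_bound n P
  obtain ⟨κ, hκ, hκle, hκC⟩ := exists_mul_rpow_le (p := P.σ - 2 * P.s) (by linarith)
    (by positivity : 0 < δ / 2) hC3 (by positivity : 0 < min (1 / 32) (δ / 32))
  have hκ1 := hκle.trans (min_le_left _ _)
  have hκ2 := hκle.trans (min_le_right _ _)
  set c0 := min (1 / 64) (min (κ / 8) (min (δ / 8 / (4 * R)) (1 / (16 * 2 ^ m)))) with hc0
  have hc0pos : 0 < c0 := by positivity
  have hc01 : c0 ≤ 1 / 64 := min_le_left _ _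
  have hc02 : c0 ≤ κ / 8 := (min_le_right _ _).trans (min_le_left _ _)
  have hc03 : 4 * R * c0 ≤ δ / 8 := by
    have : c0 ≤ δ / 8 / (4 * R) :=
      (min_le_right _ _).trans ((min_le_right _ _).trans (min_le_left _ _))
    rw [le_div_iff₀ (by positivity)] at this
    linarith
  have hc04 : 16 * 2 ^ m * c0 ≤ 1 := by
    have : c0 ≤ 1 / (16 * 2 ^ m) :=
      (min_le_right _ _).trans ((min_le_right _ _).trans (min_le_right _ _))
    rw [le_div_iff₀ (by positivity)] at this
    linarith
  refine ⟨max (11 / c0 ^ 3) (2 * C3 / (δ * κ ^ 4)), by positivity, δ, hδ, hδ4, ?_⟩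
  intro K u f D hP Q hQ hCQ hWB x0 h1 hx0 hh1
  have hD := hP.nonneg
  by_contra! hlt
  obtain ⟨h0, hh0, hlt0⟩ : ∃ h0 : Euc n, ‖h0‖ = ‖h1‖ ∧
      (1 - δ) * Q * ‖h0‖ ^ β < (1 - ‖x0‖) ^ 4 * cd3 u x0 h0 := by
    rcases abs_cases (cd3 u x0 h1) with ⟨e, -⟩ | ⟨e, -⟩
    · exact ⟨h1, rfl, by rwa [e] at hlt⟩
    · exact ⟨-h1, norm_neg _, by rwa [norm_neg, cd3_neg, ← e]⟩
  have h0ne : h0 ≠ 0 := by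
    rintro rfl
    rw [cd3_zero, norm_zero, Real.zero_rpow hβ0.ne'] at hlt0
    simp at hlt0
  have hρ : 0 < ‖h0‖ := norm_pos_iff.mpr h0ne
  set d := 1 - ‖x0‖ with hd
  have hd0 : 0 < d := by linarith
  have hd1 : d ≤ 1 := by linarith [norm_nonneg x0]
  have hQC1 : 11 / c0 ^ 3 * D ≤ Q := le_trans (by gcongr; exact le_max_left _ _) hCQ
  have hQC2 : 2 * C3 / (δ * κ ^ 4) * D ≤ Q := le_trans (by gcongr; exact le_max_right _ _) hCQ
  rcases le_or_gt (c0 * d) ‖h0‖ with hbig | hsmall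
  · have e1 : |cd3 u x0 h0| ≤ 8 * D := abs_cd3_le fun a _ => hP.bdd _
    have e2 : c0 ^ 3 * d ^ 3 ≤ ‖h0‖ ^ β := by
      calc c0 ^ 3 * d ^ 3 = (c0 * d) ^ (3 : ℝ) := by
            rw [← mul_pow]; norm_cast
        _ ≤ (c0 * d) ^ β := Real.rpow_le_rpow_of_exponent_ge (by positivity)
            (mul_le_one₀ (by linarith) hd0.le hd1) hβ3.le
        _ ≤ _ := by gcongr
    have e3 : d ^ 4 * cd3 u x0 h0 ≤ d ^ 3 * (8 * D) := by
      have : d ^ 4 ≤ d ^ 3 := pow_le_pow_of_le_one hd0.le hd1 (by norm_num)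
      calc _ ≤ d ^ 4 * (8 * D) := by gcongr; exact (le_abs_self _).trans e1
        _ ≤ _ := by gcongr
    have e4 : 3 / 4 * Q * (c0 ^ 3 * d ^ 3) ≤ (1 - δ) * Q * ‖h0‖ ^ β := by
      have h1δ : 3 / 4 ≤ 1 - δ := by linarith
      have : 0 ≤ 1 - δ := by linarith
      gcongr
    have e5 : 11 * D ≤ Q * c0 ^ 3 := by
      rwa [div_mul_eq_mul_div, div_le_iff₀ (by positivity)] at hQC1
    have e6 : d ^ 3 * (3 / 4 * (Q * c0 ^ 3)) < d ^ 3 * (8 * D) := by linarith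
    have e7 := lt_of_mul_lt_mul_left e6 (by positivity)
    have : 0 < Q * c0 ^ 3 := by positivity
    linarith
  have hloc := hWB.locBound hx0
  rw [← hd] at hloc
  set A := Q / d ^ 4 with hA
  have hA0 : 0 < A := by positivity
  have hRc : 4 * R * ‖h0‖ ≤ δ / 8 * d := by
    calc 4 * R * ‖h0‖ ≤ 4 * R * (c0 * d) := by gcongr
      _ = 4 * R * c0 * d := by ring
      _ ≤ _ := by gcongr
  have hδd : δ / 8 * d ≤ 1 / 32 * d := by
    have : δ / 8 ≤ 1 / 32 := by linarith
    gcongr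
  have hρ64 : ‖h0‖ ≤ d / 64 := by
    calc ‖h0‖ ≤ c0 * d := hsmall.le
      _ ≤ 1 / 64 * d := by gcongr
      _ = _ := by ring
  have hρκ : ‖h0‖ ≤ κ * d / 8 := by
    calc ‖h0‖ ≤ c0 * d := hsmall.le
      _ ≤ κ / 8 * d := by gcongr
      _ = _ := by ring
  have hκd2 : κ * d ≤ δ / 32 * d := by gcongr
  have hball : ∀ x, ‖x - x0‖ ≤ d / 2 → x ∈ ball (0 : Euc n) 1 := by
    intro x hx
    have := one_sub_norm_ge hx
    rw [mem_ball_zero_iff]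
    linarith
  have hN : 0 < A * ‖h0‖ ^ β := by positivity
  have hnear := hWB.nearMax hP hQ hx0 hρ hδ hδ4 (R := R) (by linarith) hρ64 hρκ hκ (by linarith)
    hκC hQC2 fun z hz => hop K u f D hP x0 d A κ hd0 hd1 hball hA0.le hloc hκ hκ1 h0 z hρκ hz
  have hW0 : 1 - δ ≤ nd3 β A u h0 x0 := by
    rw [nd3, le_div_iff₀ hN, hA, div_mul_eq_mul_div, ← mul_div_assoc, div_le_iff₀ (by positivity)]
    linarith
  have hhalf := hprop K _ _ x0 ‖h0‖ hρ hnear hW0 (fun p hp k hk => by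
    rw [mem_closedBall, dist_eq_norm] at hp
    exact hloc.abs_nd3_sub_le hs.le hs1 (by linarith) hσ2 hσβ hA0 hρ hρ64 (by linarith) hk)
  have hlow := pow_mul_le_cd3 u h0 (b := 1 / 2 * (A * ‖h0‖ ^ β)) m x0 fun p hp => by
    have := hhalf p (by rw [mem_closedBall, dist_eq_norm]; exact hp)
    rwa [nd3, le_div_iff₀ hN] at this
  have hnorm : ‖(2 : ℝ) ^ m • h0‖ = 2 ^ m * ‖h0‖ := by
    rw [norm_smul, Real.norm_of_nonneg (by positivity)]
  have hup := hWB.abs_cd3_le (x := x0) (h := (2 : ℝ) ^ m • h0) hd0 le_rfl (by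
    rw [hnorm]
    calc 16 * (2 ^ m * ‖h0‖) ≤ 16 * (2 ^ m * (c0 * d)) := by gcongr
      _ = 16 * 2 ^ m * c0 * d := by ring
      _ ≤ 1 * d := by gcongr
      _ = d := one_mul d)
  rw [hnorm, Real.mul_rpow (by positivity) hρ.le, ← hA] at hup
  have hcmp := hlow.trans ((le_abs_self _).trans hup)
  have e1 : ((2 : ℝ) ^ m) ^ β = (2 ^ β) ^ m := by
    rw [← Real.rpow_natCast, ← Real.rpow_natCast, ← Real.rpow_mul (by norm_num),
      ← Real.rpow_mul (by norm_num), mul_comm]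
  rw [e1] at hcmp
  have e2 : (8 : ℝ) ^ m * (1 / 2) ≤ (2 ^ β) ^ m := by
    refine le_of_mul_le_mul_right ?_ hN
    linarith
  rw [div_pow, div_lt_iff₀ (by positivity)] at hm
  linarith

end Improvement

section APriori

lemma WeightedBound.mono {β Q Q' : ℝ} {u : Euc n → ℝ} (hQ : WeightedBound β Q u) (h : Q ≤ Q') :
    WeightedBound β Q' u := fun x k hx hk => (hQ x k hx hk).trans (by gcongr)

lemma weightedBound_of_forall_pos {β Q : ℝ} {u : Euc n → ℝ}
    (h : ∀ ε > 0, WeightedBound β (Q + ε) u) : WeightedBound β Q u := by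
  intro x k hx hk
  have ht : Filter.Tendsto (fun ε : ℝ => (Q + ε) * ‖k‖ ^ β) (𝓝[>] 0) (𝓝 ((Q + 0) * ‖k‖ ^ β)) := by
    refine tendsto_nhdsWithin_of_tendsto_nhds ?_
    exact (Continuous.tendsto (by fun_prop) 0)
  rw [add_zero] at ht
  exact ge_of_tendsto ht (by filter_upwards [self_mem_nhdsWithin] with ε hε using h ε hε x k hx hk)

/-- Solutions with a finite weighted norm satisfy the bound with a universal constant. -/
lemma exists_weightedBound (n : ℕ) (P : SchauderParams) :
    ∃ C > 0, ∀ (K : Euc n → Measure (Euc n)) (u f : Euc n → ℝ) (D Q : ℝ),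
      SchauderProblem P K u f D → WeightedBound (2 * P.s + P.α) Q u →
        WeightedBound (2 * P.s + P.α) (C * D) u := by
  obtain ⟨C, hC, δ, hδ, hδ4, himp⟩ := exists_improvement n P
  refine ⟨C, hC, fun K u f D Q hP hQ => weightedBound_of_forall_pos fun ε hε => ?_⟩
  have hD := hP.nonneg
  have hCD : 0 < C * D + ε := by positivity
  have key : ∀ k : ℕ, WeightedBound (2 * P.s + P.α) (max (C * D + ε) ((1 - δ) ^ k * |Q|)) u := by
    intro k
    induction k with
    | zero => exact hQ.mono (by simpa using Or.inr (le_abs_self Q))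
    | succ k ih =>
      refine (himp K u f D hP _ (lt_max_of_lt_left hCD)
        (le_max_of_le_left (by linarith)) ih).mono ?_
      rw [mul_max_of_nonneg _ _ (by linarith), pow_succ', mul_assoc]
      exact max_le_max_right _ (by nlinarith)
  have ht : Filter.Tendsto (fun k : ℕ => (1 - δ) ^ k * |Q|) Filter.atTop (𝓝 (0 * |Q|)) :=
    (tendsto_pow_atTop_nhds_zero_of_lt_one (by linarith) (by linarith)).mul_const _
  rw [zero_mul] at ht
  obtain ⟨k, hk⟩ := (ht.eventually_lt_const hCD).exists
  have := key k
  rwa [max_eq_left hk.le] at this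

end APriori

section Qualitative

/-- Third central difference of a function of one variable. -/
def third (φ : ℝ → ℝ) : ℝ := φ 3 - 3 * φ 1 + 3 * φ (-1) - φ (-3)

lemma abs_third_le_of_osc {φ : ℝ → ℝ} {ε : ℝ}
    (h : ∀ a ∈ Icc (-3 : ℝ) 3, ∀ b ∈ Icc (-3 : ℝ) 3, |φ a - φ b| ≤ ε) : |third φ| ≤ 4 * ε := by
  have h1 := abs_le.mp (h 3 (by norm_num) 1 (by norm_num))
  have h2 := abs_le.mp (h 1 (by norm_num) (-1) (by norm_num))
  have h3 := abs_le.mp (h (-1) (by norm_num) (-3) (by norm_num))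
  rw [third, abs_le]
  constructor <;> linarith

lemma osc_sub_mul_le {φ φ' : ℝ → ℝ} {ε : ℝ}
    (hd : ∀ t ∈ Icc (-3 : ℝ) 3, HasDerivAt φ (φ' t) t)
    (h : ∀ a ∈ Icc (-3 : ℝ) 3, ∀ b ∈ Icc (-3 : ℝ) 3, |φ' a - φ' b| ≤ ε) :
    ∀ a ∈ Icc (-3 : ℝ) 3, ∀ b ∈ Icc (-3 : ℝ) 3,
      |(φ a - φ' 0 * a) - (φ b - φ' 0 * b)| ≤ 6 * ε := by
  intro a ha b hb
  have hε : 0 ≤ ε := (abs_nonneg _).trans (h a ha b hb)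
  have := (convex_Icc (-3 : ℝ) 3).norm_image_sub_le_of_norm_hasDerivWithin_le
    (f := fun t => φ t - φ' 0 * t) (f' := fun t => φ' t - φ' 0) (C := ε)
    (fun t ht => by
      have h1 := (hd t ht).sub ((hasDerivAt_id t).const_mul (φ' 0))
      rw [mul_one] at h1
      exact h1.hasDerivWithinAt)
    (fun t ht => h t ht 0 (by norm_num)) hb ha
  refine this.trans ?_
  rw [mul_comm]
  gcongr
  rw [Real.norm_eq_abs, abs_le]
  constructor <;> linarith [ha.1, ha.2, hb.1, hb.2]

lemma abs_third_le_of_deriv_osc {φ φ' : ℝ → ℝ} {ε : ℝ}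
    (hd : ∀ t ∈ Icc (-3 : ℝ) 3, HasDerivAt φ (φ' t) t)
    (h : ∀ a ∈ Icc (-3 : ℝ) 3, ∀ b ∈ Icc (-3 : ℝ) 3, |φ' a - φ' b| ≤ ε) :
    |third φ| ≤ 24 * ε := by
  have := abs_third_le_of_osc (osc_sub_mul_le hd h)
  have e : third (fun t => φ t - φ' 0 * t) = third φ := by simp only [third]; ring
  rw [e] at this
  linarith

lemma abs_third_le_of_deriv2_osc {φ φ' φ'' : ℝ → ℝ} {ε : ℝ}
    (hd : ∀ t ∈ Icc (-3 : ℝ) 3, HasDerivAt φ (φ' t) t)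
    (hd' : ∀ t ∈ Icc (-3 : ℝ) 3, HasDerivAt φ' (φ'' t) t)
    (h : ∀ a ∈ Icc (-3 : ℝ) 3, ∀ b ∈ Icc (-3 : ℝ) 3, |φ'' a - φ'' b| ≤ ε) :
    |third φ| ≤ 144 * ε := by
  have := abs_third_le_of_deriv_osc (φ := fun t => φ t - φ'' 0 * t ^ 2 / 2)
    (φ' := fun t => φ' t - φ'' 0 * t) (fun t ht => by
      have h1 := (hd t ht).sub ((((hasDerivAt_id t).pow 2).const_mul (φ'' 0)).div_const 2)
      exact h1.congr_deriv (by simp; ring)) (osc_sub_mul_le hd' h)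
  have e : third (fun t => φ t - φ'' 0 * t ^ 2 / 2) = third φ := by simp only [third]; ring
  rw [e] at this
  linarith

lemma hDeg_bounds {β : ℝ} (hβ : 0 < β) (hβ3 : β ≤ 3) (hβn : ∀ k : ℕ, β ≠ k) :
    (hDeg β : ℝ) < β ∧ β < hDeg β + 1 ∧ hDeg β ≤ 2 := by
  have h1 : 0 < ⌈β⌉₊ := Nat.ceil_pos.mpr hβ
  have h2 : ⌈β⌉₊ ≤ 3 := Nat.ceil_le.mpr (by exact_mod_cast hβ3)
  have e : hDeg β + 1 = ⌈β⌉₊ := by unfold hDeg; omega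
  refine ⟨?_, ?_, by omega⟩
  · rw [← Nat.lt_ceil]
    omega
  · refine lt_of_le_of_ne ?_ (by exact_mod_cast hβn (hDeg β + 1))
    have := Nat.le_ceil β
    rw [← e] at this
    exact_mod_cast this

lemma hasDerivAt_iteratedFDeriv_line {u : Euc n → ℝ} {Ω : Set (Euc n)} (hΩ : IsOpen Ω) {m j : ℕ}
    (hu : ContDiffOn ℝ m u Ω) (hj : j < m) {x h : Euc n} {t : ℝ} (hx : x + t • h ∈ Ω) :
    HasDerivAt (fun t : ℝ => iteratedFDeriv ℝ j u (x + t • h) (fun _ => h))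
      (iteratedFDeriv ℝ (j + 1) u (x + t • h) (fun _ => h)) t := by
  have h1 : DifferentiableAt ℝ (iteratedFDeriv ℝ j u) (x + t • h) :=
    (hu.contDiffAt (hΩ.mem_nhds hx)).differentiableAt_iteratedFDeriv (by exact_mod_cast hj)
  have h2 : HasDerivAt (fun t : ℝ => x + t • h) h t := by
    simpa using ((hasDerivAt_id t).smul_const h).const_add x
  have h3 := h1.hasFDerivAt.comp_hasDerivAt t h2
  have h4 := ((ContinuousMultilinearMap.apply ℝ (fun _ : Fin j => Euc n) ℝ
    (fun _ => h)).hasFDerivAt).comp_hasDerivAt t h3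
  rw [iteratedFDeriv_succ_apply_left]
  exact h4

lemma abs_cd3_le_of_iteratedFDeriv {u : Euc n → ℝ} {Ω : Set (Euc n)} (hΩ : IsOpen Ω) {m : ℕ}
    (hm : m ≤ 2) {θ N : ℝ} (hθ : 0 < θ) (hθ1 : θ ≤ 1) (hN : 0 ≤ N) (hu : ContDiffOn ℝ m u Ω)
    (hN' : ∀ x ∈ Ω, ∀ y ∈ Ω, ‖iteratedFDeriv ℝ m u x - iteratedFDeriv ℝ m u y‖ ≤ N * ‖x - y‖ ^ θ)
    {x h : Euc n} (hx : ∀ t ∈ Icc (-3 : ℝ) 3, x + t • h ∈ Ω) :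
    |cd3 u x h| ≤ 864 * N * ‖h‖ ^ (m + θ) := by
  set F : ℕ → ℝ → ℝ := fun j t => iteratedFDeriv ℝ j u (x + t • h) (fun _ => h) with hF
  have hd : ∀ j < m, ∀ t ∈ Icc (-3 : ℝ) 3, HasDerivAt (F j) (F (j + 1) t) t :=
    fun j hj t ht => hasDerivAt_iteratedFDeriv_line hΩ hu hj (hx t ht)
  have hosc : ∀ a ∈ Icc (-3 : ℝ) 3, ∀ b ∈ Icc (-3 : ℝ) 3,
      |F m a - F m b| ≤ 6 * N * ‖h‖ ^ (m + θ) := by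
    intro a ha b hb
    have e1 : ‖x + a • h - (x + b • h)‖ ≤ 6 * ‖h‖ := by
      rw [add_sub_add_left_eq_sub, ← sub_smul, norm_smul, Real.norm_eq_abs]
      gcongr
      rw [abs_le]
      constructor <;> linarith [ha.1, ha.2, hb.1, hb.2]
    have e2 : (6 : ℝ) ^ θ ≤ 6 := by
      calc (6 : ℝ) ^ θ ≤ 6 ^ (1 : ℝ) := Real.rpow_le_rpow_of_exponent_le (by norm_num) hθ1
        _ = 6 := Real.rpow_one 6
    have e3 : ‖h‖ ^ (m + θ) = ‖h‖ ^ θ * ‖h‖ ^ m := by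
      rw [add_comm, Real.rpow_add_of_nonneg (norm_nonneg _) hθ.le (by positivity),
        Real.rpow_natCast]
    calc |F m a - F m b|
        = ‖(iteratedFDeriv ℝ m u (x + a • h) - iteratedFDeriv ℝ m u (x + b • h)) fun _ => h‖ := rfl
      _ ≤ ‖iteratedFDeriv ℝ m u (x + a • h) - iteratedFDeriv ℝ m u (x + b • h)‖ * ‖h‖ ^ m := by
          refine (ContinuousMultilinearMap.le_opNorm _ _).trans_eq ?_
          simp
      _ ≤ N * (6 * ‖h‖) ^ θ * ‖h‖ ^ m := by
          gcongr
          exact (hN' _ (hx a ha) _ (hx b hb)).trans (by gcongr)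
      _ = N * (6 ^ θ * ‖h‖ ^ θ) * ‖h‖ ^ m := by rw [Real.mul_rpow (by norm_num) (norm_nonneg _)]
      _ ≤ N * (6 * ‖h‖ ^ θ) * ‖h‖ ^ m := by gcongr
      _ = _ := by rw [e3]; ring
  have e : cd3 u x h = third (F 0) := by
    simp only [hF, third, cd3, iteratedFDeriv_zero_apply, neg_smul, one_smul, sub_eq_add_neg]
  have hnn : 0 ≤ N * ‖h‖ ^ (m + θ) := by positivity
  rw [e]
  have hm' : m = 0 ∨ m = 1 ∨ m = 2 := by omega
  rcases hm' with rfl | rfl | rfl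
  · exact (abs_third_le_of_osc hosc).trans (by linarith)
  · exact (abs_third_le_of_deriv_osc (hd 0 (by norm_num)) hosc).trans (by linarith)
  · exact (abs_third_le_of_deriv2_osc (hd 0 (by norm_num)) (hd 1 (by norm_num)) hosc).trans
      (by linarith)

lemma HolderMem.exists_weightedBound {β : ℝ} (hβ : 0 < β) (hβ3 : β ≤ 3) (hβn : ∀ k : ℕ, β ≠ k)
    {u : Euc n → ℝ} (hu : HolderMem β (ball 0 1) u) : ∃ Q, WeightedBound β Q u := by
  obtain ⟨h1, h2, h3⟩ := hDeg_bounds hβ hβ3 hβn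
  obtain ⟨hc, hN⟩ := hu
  have hsemi : hSemi β (ball 0 1) u ≠ ⊤ := ne_top_of_le_ne_top hN le_add_self
  refine ⟨864 * (hSemi β (ball 0 1) u).toReal, fun x h hx hh => ?_⟩
  have key := abs_cd3_le_of_iteratedFDeriv (x := x) (h := h) isOpen_ball h3 (θ := β - hDeg β)
    (N := (hSemi β (ball 0 1) u).toReal)
    (by linarith) (by linarith) ENNReal.toReal_nonneg hc (fun y hy z hz => by
      rcases eq_or_ne y z with rfl | hyz
      · rw [sub_self, norm_zero]; positivity
      have e1 := (le_iSup₂_of_le (f := fun (x : ball (0 : Euc n) 1) (y : ball (0 : Euc n) 1) =>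
        ENNReal.ofReal (‖iteratedFDerivWithin ℝ (hDeg β) u (ball 0 1) ↑x -
          iteratedFDerivWithin ℝ (hDeg β) u (ball 0 1) ↑y‖ /
          ‖(x : Euc n) - (y : Euc n)‖ ^ (β - (hDeg β : ℝ)))) ⟨y, hy⟩ ⟨z, hz⟩ le_rfl).trans_eq
        (ENNReal.ofReal_toReal hsemi).symm
      rw [ENNReal.ofReal_le_ofReal_iff ENNReal.toReal_nonneg] at e1
      have hpos : 0 < ‖y - z‖ := norm_pos_iff.mpr (sub_ne_zero.mpr hyz)
      rw [div_le_iff₀ (by positivity)] at e1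
      simpa only [iteratedFDerivWithin_of_isOpen _ isOpen_ball hy,
        iteratedFDerivWithin_of_isOpen _ isOpen_ball hz] using e1)
    (fun t ht => by
      rw [mem_ball_zero_iff]
      have : ‖t • h‖ ≤ 3 * ‖h‖ := by
        rw [norm_smul]
        gcongr
        exact abs_le.mpr ht
      linarith [norm_add_le x (t • h), norm_nonneg h])
  rw [add_sub_cancel] at key
  have h4 : (1 - ‖x‖) ^ 4 ≤ 1 := pow_le_one₀ (by linarith) (by linarith [norm_nonneg x])
  calc _ ≤ 1 * |cd3 u x h| := by gcongr
    _ ≤ _ := by rw [one_mul]; exact key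

end Qualitative

section Regularity

lemma exists_deriv_le_of_third_difference {β : ℝ} (hβ : 1 < β) :
    ∃ C > 0, ∀ (w : ℝ → ℝ) (w' τ b B : ℝ), 0 < τ → 0 ≤ b → HasDerivAt w w' 0 →
      (∀ ρ, 0 < ρ → ρ ≤ τ → |w (3 * ρ) - 3 * w ρ + 3 * w (-ρ) - w (-(3 * ρ))| ≤ b * ρ ^ β) →
      |w τ| ≤ B → |w (-τ)| ≤ B → |w'| ≤ B / τ + C * b * τ ^ (β - 1) := by
  set r : ℝ := (1 / 3) ^ (β - 1) with hr
  have hr0 : 0 < r := by positivity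
  have hr1 : r < 1 := Real.rpow_lt_one (by norm_num) (by norm_num) (by linarith)
  have h1r : 0 < 1 - r := by linarith
  refine ⟨1 / (1 - r), by positivity, fun w w' τ b B hτ hb hw h3 hB1 hB2 => ?_⟩
  set ρ : ℕ → ℝ := fun k => τ * (1 / 3) ^ k with hρ
  have hρ0 : ∀ k, 0 < ρ k := fun k => by positivity
  have hρ1 : ∀ k, 3 * ρ (k + 1) = ρ k := fun k => by simp only [hρ, pow_succ]; ring
  have hρτ : ∀ k, ρ k ≤ τ := fun k =>
    mul_le_of_le_one_right hτ.le (pow_le_one₀ (by norm_num) (by norm_num))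
  have hρr : ∀ k, ρ k ^ (β - 1) = τ ^ (β - 1) * r ^ k := fun k => by
    rw [hρ, Real.mul_rpow hτ.le (by positivity), hr, ← Real.rpow_natCast, ← Real.rpow_natCast,
      ← Real.rpow_mul (by norm_num), ← Real.rpow_mul (by norm_num), mul_comm (k : ℝ)]
  have hlim : Filter.Tendsto ρ Filter.atTop (𝓝[≠] 0) := by
    refine tendsto_nhdsWithin_iff.mpr ⟨?_, .of_forall fun k => (hρ0 k).ne'⟩
    have := (tendsto_pow_atTop_nhds_zero_of_lt_one (r := (1 / 3 : ℝ)) (by norm_num)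
      (by norm_num)).const_mul τ
    rwa [mul_zero] at this
  have hD : HasDerivAt (fun t => w t - w (-t)) (w' + w') 0 := by
    have h1 : HasDerivAt (fun t => w (-t)) (-w') 0 := by
      rw [← neg_zero] at hw
      have h2 := hw.comp (0 : ℝ) (hasDerivAt_neg (0 : ℝ))
      rw [mul_neg_one] at h2
      exact h2
    have h2 := hw.sub h1
    rw [sub_neg_eq_add] at h2
    exact h2
  have hq : Filter.Tendsto (fun k => (ρ k)⁻¹ * (w (ρ k) - w (-ρ k))) Filter.atTop (𝓝 (w' + w')) := by
    have := (hasDerivAt_iff_tendsto_slope_zero.mp hD).comp hlim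
    refine this.congr fun k => ?_
    simp
  have key := dist_le_of_le_geometric_of_tendsto₀ r (b * τ ^ (β - 1)) hr1 (fun k => ?_) hq
  · rw [Real.dist_eq] at key
    have e0 : ρ 0 = τ := by simp [hρ]
    rw [e0] at key
    have k1 := abs_le.mp key
    have k2 : |τ⁻¹ * (w τ - w (-τ))| ≤ 2 * (B / τ) := by
      rw [abs_mul, abs_of_pos (inv_pos.mpr hτ), inv_mul_eq_div, ← mul_div_assoc]
      gcongr
      exact (abs_sub _ _).trans (by linarith)
    have k3 := abs_le.mp k2
    have k4 : 0 ≤ b * τ ^ (β - 1) / (1 - r) := by positivity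
    have e1 : 1 / (1 - r) * b * τ ^ (β - 1) = b * τ ^ (β - 1) / (1 - r) := by ring
    rw [e1, abs_le]
    constructor <;> linarith
  · have hp := hρ0 (k + 1)
    have h4 := h3 (ρ (k + 1)) hp (hρτ _)
    have e1 : (ρ k)⁻¹ * (w (ρ k) - w (-ρ k)) - (ρ (k + 1))⁻¹ * (w (ρ (k + 1)) - w (-ρ (k + 1))) =
        (3 * ρ (k + 1))⁻¹ * (w (3 * ρ (k + 1)) - 3 * w (ρ (k + 1)) + 3 * w (-ρ (k + 1)) -
          w (-(3 * ρ (k + 1)))) := by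
      rw [← hρ1 k]
      field_simp
      ring
    have e2 : ρ (k + 1) ^ β = ρ (k + 1) ^ (β - 1) * ρ (k + 1) := by
      rw [← Real.rpow_add_one hp.ne']; congr 1; ring
    have e3 : r ^ (k + 1) ≤ r ^ k := pow_le_pow_of_le_one hr0.le hr1.le (Nat.le_succ k)
    rw [Real.dist_eq, e1, abs_mul, abs_of_pos (by positivity), inv_mul_le_iff₀ (by positivity)]
    refine h4.trans ?_
    rw [e2, hρr]
    have h5 : 0 ≤ b * τ ^ (β - 1) * ρ (k + 1) := by positivity
    calc _ = b * τ ^ (β - 1) * ρ (k + 1) * r ^ (k + 1) := by ring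
      _ ≤ b * τ ^ (β - 1) * ρ (k + 1) * r ^ k := by gcongr
      _ ≤ 3 * (b * τ ^ (β - 1) * ρ (k + 1) * r ^ k) := by
          have : 0 ≤ b * τ ^ (β - 1) * ρ (k + 1) * r ^ k := by positivity
          linarith
      _ = _ := by ring

/-- Bound on `g` and its third differences of order `μ` on the ball of radius `R`. -/
structure ThirdBound (μ A R : ℝ) (g : Euc n → ℝ) : Prop where
  third : ∀ z h : Euc n, ‖z‖ < R → ‖h‖ ≤ 1 / 64 → |cd3 g z h| ≤ A * ‖h‖ ^ μ
  sup : ∀ z : Euc n, ‖z‖ < R → |g z| ≤ A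

lemma norm_add_lt_of_le {z v : Euc n} {R a b : ℝ} (hz : ‖z‖ < R - a) (hv : ‖v‖ ≤ b) (hab : b ≤ a) :
    ‖z + v‖ < R := by
  linarith [norm_add_le z v]

lemma ThirdBound.exists_fderiv (n : ℕ) {β : ℝ} (hβ : 1 < β) :
    ∃ C > 0, ∀ (A R : ℝ) (g : Euc n → ℝ), 0 ≤ A → ThirdBound β A R g →
      (∀ z, ‖z‖ < R → DifferentiableAt ℝ g z) → ∀ e : Euc n, ‖e‖ ≤ 1 →
      ThirdBound (β - 1) (C * A) (R - 1 / 16) (fun z => fderiv ℝ g z e) := by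
  obtain ⟨C, hC, h1d⟩ := exists_deriv_le_of_third_difference hβ
  refine ⟨64 + 8 * C, by positivity, fun A R g hA hg hdiff e he => ?_⟩
  have hline : ∀ p, ‖p‖ < R → HasDerivAt (fun t : ℝ => g (p + t • e)) (fderiv ℝ g p e) 0 := by
    intro p hp
    have h2 : HasDerivAt (fun t : ℝ => p + t • e) e 0 := by
      simpa using ((hasDerivAt_id (0 : ℝ)).smul_const e).const_add p
    have h1 : HasFDerivAt g (fderiv ℝ g p) (p + (0 : ℝ) • e) := by
      simpa using (hdiff p hp).hasFDerivAt
    exact h1.comp_hasDerivAt (0 : ℝ) h2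
  have hte : ∀ t : ℝ, ‖t • e‖ ≤ |t| := fun t => by
    rw [norm_smul, Real.norm_eq_abs]
    exact mul_le_of_le_one_right (abs_nonneg t) he
  have h3e : ∀ (ρ : ℝ) (q : Euc n → ℝ) (z : Euc n),
      q (z + (3 * ρ) • e) - 3 * q (z + ρ • e) + 3 * q (z + (-ρ) • e) - q (z + (-(3 * ρ)) • e) =
        cd3 q z (ρ • e) := by
    intro ρ q z
    simp only [cd3, mul_smul, neg_smul, sub_eq_add_neg]
  have hcd : ∀ p, ‖p‖ < R → ∀ ρ, 0 < ρ → ρ ≤ 1 / 64 → |cd3 g p (ρ • e)| ≤ A * ρ ^ β := by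
    intro p hp ρ hρ hρ1
    have h1 := hte ρ
    rw [abs_of_pos hρ] at h1
    exact (hg.third p _ hp (h1.trans hρ1)).trans (by gcongr)
  constructor
  · intro z h hz hh
    rcases eq_or_ne h 0 with rfl | hh0
    · rw [cd3_zero, norm_zero, Real.zero_rpow (by linarith)]; simp
    have hτ : 0 < ‖h‖ := norm_pos_iff.mpr hh0
    have hnear : ∀ a : ℝ, |a| ≤ 3 → ‖z + a • h‖ < R := by
      intro a ha
      refine norm_add_lt_of_le hz (b := 3 * ‖h‖) ?_ (by linarith)
      rw [norm_smul, Real.norm_eq_abs]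
      gcongr
    have hw : HasDerivAt (fun t : ℝ => cd3 g (z + t • e) h)
        (cd3 (fun z => fderiv ℝ g z e) z h) 0 := by
      have a1 := hline _ (hnear 3 (by norm_num))
      have a2 := hline _ (hnear 1 (by norm_num))
      have a3 := hline _ (hnear (-1) (by norm_num))
      have a4 := hline _ (hnear (-3) (by norm_num))
      have := ((a1.sub (a2.const_mul 3)).add (a3.const_mul 3)).sub a4
      simp only [one_smul, neg_smul, ← sub_eq_add_neg] at this
      refine this.congr_of_eventuallyEq (.of_forall fun t => ?_)
      simp only [cd3, Pi.sub_apply, Pi.add_apply, add_right_comm, sub_add_eq_add_sub]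
    have hend : ∀ t : ℝ, |t| ≤ ‖h‖ → |cd3 g (z + t • e) h| ≤ A * ‖h‖ ^ β := by
      intro t ht
      exact hg.third _ _ (norm_add_lt_of_le hz (hte t) (by linarith)) hh
    have key := h1d _ _ ‖h‖ (8 * A) (A * ‖h‖ ^ β) hτ (by positivity) hw (fun ρ hρ hρh => by
      rw [h3e ρ (fun p => cd3 g p h), cd3_comm]
      have := abs_cd3_le (g := fun p => cd3 g p (ρ • e)) (x := z) (h := h) (B := A * ρ ^ β)
        fun a ha => hcd _ (hnear a ha) ρ hρ (by linarith)
      linarith) (hend _ (abs_norm h).le) (hend _ (by rw [abs_neg, abs_norm]))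
    refine key.trans ?_
    have e1 : ‖h‖ ^ β = ‖h‖ ^ (β - 1) * ‖h‖ := by
      rw [← Real.rpow_add_one hτ.ne']; congr 1; ring
    have e2 : A * ‖h‖ ^ β / ‖h‖ = A * ‖h‖ ^ (β - 1) := by
      rw [e1]; field_simp
    rw [e2]
    have : 0 ≤ A * ‖h‖ ^ (β - 1) := by positivity
    linarith
  · intro z hz
    have key := h1d _ _ (1 / 64) A A (by norm_num) hA (hline z (by linarith)) (fun ρ hρ hρh => by
      rw [h3e ρ g]
      exact hcd z (by linarith) ρ hρ hρh)
      (hg.sup _ (norm_add_lt_of_le hz (hte _) (by rw [abs_of_pos] <;> norm_num)))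
      (hg.sup _ (norm_add_lt_of_le hz (hte _) (by rw [abs_neg, abs_of_pos] <;> norm_num)))
    refine key.trans ?_
    have : (1 / 64 : ℝ) ^ (β - 1) ≤ 1 := Real.rpow_le_one (by norm_num) (by norm_num) (by linarith)
    calc A / (1 / 64) + C * A * (1 / 64) ^ (β - 1) ≤ A / (1 / 64) + C * A * 1 := by gcongr
      _ ≤ _ := by
        have : 0 ≤ C * A := by positivity
        linarith

lemma ThirdBound.exists_holder (n : ℕ) {μ : ℝ} (hμ : 0 < μ) (hμ1 : μ < 1) :
    ∃ C > 0, ∀ (A R : ℝ) (g : Euc n → ℝ), 0 ≤ A → ThirdBound μ A R g →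
      ∀ x y, ‖x‖ < R - 1 / 16 → ‖y‖ < R - 1 / 16 → |g x - g y| ≤ C * A * ‖x - y‖ ^ μ := by
  have hC1 : 0 < Cd (1 / 4) μ := Cd_pos (quarter_mul_two_rpow_lt (by linarith))
  have hC2 : 0 < Cd (1 / 2) μ := Cd_pos (half_mul_two_rpow_lt hμ1)
  set c1 := Cd (1 / 4) μ * (4 / (1 / 64) ^ μ + 1) with hc1
  set c2 := Cd (1 / 2) μ * (2 / (1 / 64) ^ μ + c1) with hc2
  have hc1pos : 0 < c1 := by positivity
  have hc2pos : 0 < c2 := by positivity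
  refine ⟨c2 + 128, by positivity, fun A R g hA hg x y hx hy => ?_⟩
  have hnn : 0 ≤ A * ‖x - y‖ ^ μ := by positivity
  rcases le_or_gt ‖x - y‖ (1 / 64) with hxy | hxy
  · have hsup : ∀ k : Euc n, ‖k‖ ≤ 1 / 16 → |g (y + k)| ≤ A := fun k hk =>
      hg.sup _ (norm_add_lt_of_le hy hk le_rfl)
    have hsum : ∀ k l : Euc n, ‖k‖ ≤ 1 / 64 / 2 → ‖l‖ ≤ 1 / 64 → ‖k + l‖ ≤ 1 / 16 := fun k l hk hl =>
      (norm_add_le _ _).trans (by linarith)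
    have h2 : ∀ k : Euc n, ‖k‖ ≤ 1 / 64 / 2 → |cd2 g (y + k) k| ≤ c1 * A * ‖k‖ ^ μ := by
      intro k hk
      have := cd2_le_of_cd3 (g := g) (x := y + k) (σ := μ) (τ := 1 / 64) (b := A) (B := 4 * A) hμ.le
        (by linarith) (by norm_num) hA (by positivity) (fun h hh => by
          constructor
          · refine hg.third _ _ ?_ (by linarith)
            rw [add_assoc]
            exact norm_add_lt_of_le hy (hsum k h hk (by linarith)) le_rfl
          · refine hg.third _ _ ?_ (by linarith)
            rw [add_sub_assoc, sub_eq_add_neg]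
            exact norm_add_lt_of_le hy (hsum k (-h) hk (by rw [norm_neg]; linarith)) le_rfl)
        (fun l hl => by
          have a1 := hsup (k + l) (hsum k l hk hl)
          have a2 := hsup (k + -l) (hsum k (-l) hk (by rwa [norm_neg]))
          have a3 := hsup k (by linarith)
          rw [← add_assoc] at a1 a2
          rw [← sub_eq_add_neg] at a2
          rw [abs_le] at a1 a2 a3
          rw [cd2, abs_le]
          constructor <;> linarith) k (by linarith)
      refine this.trans_eq ?_
      rw [hc1]
      ring
    have := diff_le_of_cd2 (g := g) (x := y) (μ := μ) (τ := 1 / 64) (b := c1 * A) (B := 2 * A) hμ.le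
      hμ1 (by norm_num) (by positivity) (by positivity) h2 (fun k hk => by
        have a1 := abs_le.mp (hsup k (by linarith))
        have a2 := abs_le.mp (hg.sup y (by linarith))
        rw [abs_le]
        constructor <;> linarith) (x - y) hxy
    rw [add_sub_cancel] at this
    calc _ ≤ _ := this
      _ = c2 * (A * ‖x - y‖ ^ μ) := by rw [hc2]; ring
      _ ≤ _ := by linarith
  · have a1 := abs_le.mp (hg.sup x (by linarith))
    have a2 := abs_le.mp (hg.sup y (by linarith))
    have a3 : 1 ≤ 64 * ‖x - y‖ ^ μ := by
      calc (1 : ℝ) ≤ (64 * ‖x - y‖) ^ μ := Real.one_le_rpow (by linarith) hμ.le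
        _ = 64 ^ μ * ‖x - y‖ ^ μ := Real.mul_rpow (by norm_num) (norm_nonneg _)
        _ ≤ 64 ^ (1 : ℝ) * ‖x - y‖ ^ μ := by gcongr; norm_num
        _ = _ := by rw [Real.rpow_one]
    have a4 : 2 * A ≤ 128 * (A * ‖x - y‖ ^ μ) := by nlinarith
    have a5 : 0 ≤ c2 * (A * ‖x - y‖ ^ μ) := by positivity
    rw [abs_le]
    constructor <;> linarith

end Regularity

section Conclusion

lemma ThirdBound.congr {μ A R : ℝ} {g g' : Euc n → ℝ} (hg : ThirdBound μ A (R - 1 / 16) g)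
    (h : ∀ z, ‖z‖ < R → g z = g' z) : ThirdBound μ A (R - 1 / 16) g' := by
  constructor
  · intro z k hz hk
    have key : ∀ a : ℝ, |a| ≤ 3 → g (z + a • k) = g' (z + a • k) := by
      intro a ha
      refine h _ (norm_add_lt_of_le hz (b := 3 * ‖k‖) ?_ (by linarith))
      rw [norm_smul, Real.norm_eq_abs]
      gcongr
    have e : cd3 g' z k = cd3 g z k := by
      have a1 := key 3 (by norm_num)
      have a2 := key 1 (by norm_num)
      have a3 := key (-1) (by norm_num)
      have a4 := key (-3) (by norm_num)
      simp only [one_smul, neg_smul, ← sub_eq_add_neg] at a1 a2 a3 a4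
      simp only [cd3, a1, a2, a3, a4]
    rw [e]
    exact hg.third z k hz hk
  · intro z hz
    rw [← h z (by linarith)]
    exact hg.sup z hz

lemma ThirdBound.exists_iteratedFDeriv (n : ℕ) {β : ℝ} (j : ℕ) (hj : (j : ℝ) < β) :
    ∃ C > 0, ∀ (A R : ℝ) (u : Euc n → ℝ), 0 ≤ A → ThirdBound β A R u →
      ContDiffOn ℝ j u (ball 0 R) → ∀ e : Fin j → Euc n, (∀ i, ‖e i‖ ≤ 1) →
      ThirdBound (β - j) (C * A) (R - j / 16) (fun z => iteratedFDeriv ℝ j u z e) := by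
  induction j with
  | zero =>
    refine ⟨1, one_pos, fun A R u hA hu _ e _ => ?_⟩
    simpa using hu
  | succ j ih =>
    push_cast at hj
    obtain ⟨C, hC, hind⟩ := ih (by linarith)
    obtain ⟨C', hC', hstep⟩ := ThirdBound.exists_fderiv n (β := β - j) (by linarith)
    refine ⟨C' * C, by positivity, fun A R u hA hu hc e he => ?_⟩
    have h1 := hind A R u hA hu (hc.of_le (by exact_mod_cast Nat.le_succ j)) (Fin.tail e)
      fun i => he _
    have hd : ∀ z : Euc n, ‖z‖ < R - j / 16 → DifferentiableAt ℝ (iteratedFDeriv ℝ j u) z := by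
      intro z hz
      have hj0 : (0 : ℝ) ≤ j / 16 := by positivity
      refine (hc.contDiffAt (isOpen_ball.mem_nhds ?_)).differentiableAt_iteratedFDeriv
        (by exact_mod_cast Nat.lt_succ_self j)
      rw [mem_ball_zero_iff]
      linarith
    have hfd : ∀ z : Euc n, ‖z‖ < R - j / 16 →
        HasFDerivAt (fun z => iteratedFDeriv ℝ j u z (Fin.tail e))
          ((ContinuousMultilinearMap.apply ℝ (fun _ : Fin j => Euc n) ℝ (Fin.tail e)).comp
            (fderiv ℝ (iteratedFDeriv ℝ j u) z)) z := fun z hz =>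
      ((ContinuousMultilinearMap.apply ℝ (fun _ : Fin j => Euc n) ℝ
        (Fin.tail e)).hasFDerivAt).comp z (hd z hz).hasFDerivAt
    have h2 := hstep _ _ _ (by positivity) h1 (fun z hz => (hfd z hz).differentiableAt) (e 0) (he 0)
    have h3 := h2.congr (g' := fun z => iteratedFDeriv ℝ (j + 1) u z e) fun z hz => by
      rw [(hfd z hz).fderiv, iteratedFDeriv_succ_apply_left]
      rfl
    push_cast
    rw [← sub_sub, add_div, ← sub_sub, mul_assoc]
    exact h3

lemma opNorm_le_of_forall_norm_le_one {j : ℕ}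
    {T : ContinuousMultilinearMap ℝ (fun _ : Fin j => Euc n) ℝ}
    {S : ℝ} (hS : 0 ≤ S) (h : ∀ e : Fin j → Euc n, (∀ i, ‖e i‖ ≤ 1) → |T e| ≤ S) : ‖T‖ ≤ S := by
  refine ContinuousMultilinearMap.opNorm_le_bound hS fun m => ?_
  by_cases h0 : ∃ i, m i = 0
  · obtain ⟨i, hi⟩ := h0
    rw [T.map_coord_zero i hi, norm_zero]
    positivity
  push Not at h0
  have h1 := h (fun i => ‖m i‖⁻¹ • m i) fun i => by
    rw [norm_smul, norm_inv, norm_norm, inv_mul_cancel₀ (norm_ne_zero_iff.mpr (h0 i))]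
  have hp : 0 < ∏ i, ‖m i‖ := Finset.prod_pos fun i _ => norm_pos_iff.mpr (h0 i)
  rwa [T.map_smul_univ, smul_eq_mul, abs_mul, Finset.prod_inv_distrib, abs_of_pos (by positivity),
    inv_mul_le_iff₀ hp, mul_comm] at h1

lemma ThirdBound.exists_hNorm_le (n : ℕ) {β : ℝ} (hβ : 0 < β) (hβ3 : β ≤ 3)
    (hβn : ∀ k : ℕ, β ≠ k) :
    ∃ C > 0, ∀ (A : ℝ) (u : Euc n → ℝ), 0 ≤ A → ThirdBound β A (3 / 4) u →
      ContDiffOn ℝ (hDeg β) u (ball 0 1) →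
      hNorm β (ball 0 (1 / 2)) u ≤ ENNReal.ofReal (C * A) := by
  obtain ⟨h1, h2, h3⟩ := hDeg_bounds hβ hβ3 hβn
  set m := hDeg β with hm
  have hC : ∀ j : ℕ, ∃ C > 0, j ≤ m → ∀ (A R : ℝ) (u : Euc n → ℝ), 0 ≤ A → ThirdBound β A R u →
      ContDiffOn ℝ j u (ball 0 R) → ∀ e : Fin j → Euc n, (∀ i, ‖e i‖ ≤ 1) →
      ThirdBound (β - j) (C * A) (R - j / 16) (fun z => iteratedFDeriv ℝ j u z e) := by
    intro j
    by_cases hj : j ≤ m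
    · have hj' : (j : ℝ) ≤ m := by exact_mod_cast hj
      obtain ⟨C, hC, hC'⟩ := ThirdBound.exists_iteratedFDeriv n (β := β) j (by linarith)
      exact ⟨C, hC, fun _ => hC'⟩
    · exact ⟨1, one_pos, fun h => absurd h hj⟩
  choose C hC0 hC using hC
  obtain ⟨C', hC', hhol⟩ := ThirdBound.exists_holder n (μ := β - m) (by linarith) (by linarith)
  have hCs : 0 < ∑ j ∈ Finset.range (m + 1), C j :=
    Finset.sum_pos (fun j _ => hC0 j) ⟨0, by simp⟩
  have hCm := hC0 m
  refine ⟨(∑ j ∈ Finset.range (m + 1), C j) + C' * C m, by positivity, fun A u hA hu hc => ?_⟩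
  have hR : ∀ j : ℕ, j ≤ m → (j : ℝ) / 16 ≤ 1 / 8 := by
    intro j hj
    have : (j : ℝ) ≤ 2 := by exact_mod_cast hj.trans h3
    linarith
  have hcd : ∀ j : ℕ, j ≤ m → ContDiffOn ℝ j u (ball 0 (3 / 4)) := fun j hj =>
    (hc.mono (ball_subset_ball (by norm_num))).of_le (by exact_mod_cast hj)
  rw [add_mul, ENNReal.ofReal_add (by positivity) (by positivity), Finset.sum_mul,
    ENNReal.ofReal_sum_of_nonneg fun j _ => mul_nonneg (hC0 j).le hA]
  refine add_le_add (Finset.sum_le_sum fun j hj => iSup_le fun x => ENNReal.ofReal_le_ofReal ?_)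
    (iSup₂_le fun x y => ENNReal.ofReal_le_ofReal ?_)
  · have hjm : j ≤ m := Finset.mem_range_succ_iff.mp hj
    have := hR j hjm
    rw [iteratedFDerivWithin_of_isOpen _ isOpen_ball x.2]
    refine opNorm_le_of_forall_norm_le_one (mul_nonneg (hC0 j).le hA) fun e he => ?_
    have hx := mem_ball_zero_iff.mp x.2
    exact (hC j hjm A _ u hA hu (hcd j hjm) e he).sup x (by linarith)
  · have := hR m le_rfl
    rw [← hm, iteratedFDerivWithin_of_isOpen _ isOpen_ball x.2,
      iteratedFDerivWithin_of_isOpen _ isOpen_ball y.2]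
    refine div_le_of_le_mul₀ (by positivity) (by positivity) ?_
    refine opNorm_le_of_forall_norm_le_one (by positivity) fun e he => ?_
    have hx := mem_ball_zero_iff.mp x.2
    have hy := mem_ball_zero_iff.mp y.2
    rw [sub_apply, mul_assoc C']
    exact hhol _ _ _ (by positivity) (hC m le_rfl A _ u hA hu (hcd m le_rfl) e he) x y
      (by linarith) (by linarith)

lemma WeightedBound.thirdBound {β Q D : ℝ} {u : Euc n → ℝ} (hQ : WeightedBound β Q u)
    (hQ0 : 0 ≤ Q) (hD : 0 ≤ D) (hu : ∀ x, |u x| ≤ D) : ThirdBound β (256 * Q + D) (3 / 4) u := by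
  constructor
  · intro z h hz hh
    refine (hQ.abs_cd3_le (t := 1 / 4) (by norm_num) (by linarith) (by linarith)).trans ?_
    gcongr
    rw [div_le_iff₀ (by norm_num)]
    linarith
  · exact fun z _ => (hu z).trans (by linarith)

end Conclusion

section Main

lemma abs_le_of_hNorm_le {σ D : ℝ} {Ω : Set (Euc n)} {u : Euc n → ℝ} (hD : 0 ≤ D)
    (h : hNorm σ Ω u ≤ ENNReal.ofReal D) {x : Euc n} (hx : x ∈ Ω) : |u x| ≤ D := by
  have h1 : ENNReal.ofReal ‖iteratedFDerivWithin ℝ 0 u Ω x‖ ≤ hNorm σ Ω u :=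
    le_add_right ((le_iSup (fun x : Ω => ENNReal.ofReal ‖iteratedFDerivWithin ℝ 0 u Ω ↑x‖)
      ⟨x, hx⟩).trans (Finset.single_le_sum (f := fun j => ⨆ x : Ω,
        ENNReal.ofReal ‖iteratedFDerivWithin ℝ j u Ω ↑x‖) (fun _ _ => zero_le) (by simp)))
  have h2 := h1.trans h
  rwa [ENNReal.ofReal_le_ofReal_iff hD, norm_iteratedFDerivWithin_zero, Real.norm_eq_abs] at h2

end Main

/-- **Schauder estimate in non-divergence form** (Theorem B).
For a family of symmetric Lévy measures, uniformly elliptic of order `2s`, whose coefficients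
are `C^α` in the weighted Kantorovich sense (with weight `C^γ`), and (if `α > γ`) whose kernels
are `C^{α-γ}` in the `y`-variable, any solution `u ∈ C^{2s+α}(B₁) ∩ C^γ(ℝⁿ)` of `L(u,x) = f`
with `f ∈ C^α(B₁)` satisfies `‖u‖_{C^{2s+α}(B_{1/2})} ≤ C (‖f‖_{C^α(B₁)} + ‖u‖_{C^γ(ℝⁿ)})`. -/
theorem stmt1 (n : ℕ) (s γ α lam Lam M : ℝ)
    (hs : s ∈ Set.Ioo (0 : ℝ) 1) (hγ : γ ∈ Set.Ico (0 : ℝ) 1) (hγs : γ < 2 * s)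
    (hα : α ∈ Set.Ioc (0 : ℝ) 1) (hαs : ∀ k : ℕ, 2 * s + α ≠ k)
    (hlam : 0 < lam) (hlamLam : lam ≤ Lam) (hM : 0 < M) :
    ∃ C > (0 : ℝ),
      ∀ K : Euc n → Measure (Euc n),
        (∀ x, IsLevyMeasure (K x)) →
        (∀ x, UnifElliptic s lam Lam (K x)) →
        (∀ x x' : Euc n, KantCond s γ (K x) (K x') (M * ‖x - x'‖ ^ α)) →
        (γ < α → ∀ x ∈ ball (0 : Euc n) 1, kernelHolder s (α - γ) (K x) ≤ ENNReal.ofReal M) →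
        ∀ u f : Euc n → ℝ,
          HolderMem α (ball 0 1) f →
          HolderMem (2 * s + α) (ball 0 1) u →
          HolderMem γ Set.univ u →
          SolvesPtwise K u f (ball 0 1) →
          hNorm (2 * s + α) (ball 0 (1 / 2)) u ≤
            ENNReal.ofReal C * (hNorm α (ball 0 1) f + hNorm γ Set.univ u) := by
  obtain ⟨hs0, hs1⟩ := hs
  obtain ⟨hγ0, hγ1⟩ := hγ
  obtain ⟨hα0, hα1⟩ := hα
  have hL : 0 < Lam := by linarith
  obtain ⟨c, hc, c', hc', hcone⟩ := exists_cone_mass n hs0 hs1 hlam hL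
  have hmin : 0 < min (1 - s) α := lt_min (by linarith) hα0
  have hmin1 : min (1 - s) α ≤ 1 - s := min_le_left _ _
  have hmin2 : min (1 - s) α ≤ α := min_le_right _ _
  let P : SchauderParams := ⟨s, γ, α, 2 * s + min (1 - s) α, Lam, M, c, c', hs0, hs1, hγ0, hγ1, hγs,
    hα0, hα1, by linarith, by linarith, by linarith, hL, hM, hc, hc'⟩
  have hβ : 0 < 2 * s + α := by positivity
  have hβ3 : 2 * s + α ≤ 3 := by linarith
  obtain ⟨C1, hC1, hbound⟩ := exists_weightedBound n P
  obtain ⟨C2, hC2, hreg⟩ := ThirdBound.exists_hNorm_le n hβ hβ3 hαs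
  refine ⟨C2 * (256 * C1 + 1), by positivity, fun K hK hKe hKα hKγ u f hf hu huγ hsol => ?_⟩
  set N := hNorm α (ball 0 1) f + hNorm γ Set.univ u with hN
  have hNtop : N ≠ ⊤ := ENNReal.add_ne_top.mpr ⟨hf.2, huγ.2⟩
  set D := N.toReal with hD
  have hD0 : 0 ≤ D := ENNReal.toReal_nonneg
  have hDN : ENNReal.ofReal D = N := ENNReal.ofReal_toReal hNtop
  have hfD : hNorm α (ball 0 1) f ≤ ENNReal.ofReal D := hDN ▸ le_self_add
  have huD : hNorm γ Set.univ u ≤ ENNReal.ofReal D := hDN ▸ le_add_self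
  have hbdd : ∀ x, |u x| ≤ D := fun x => abs_le_of_hNorm_le hD0 huD (mem_univ x)
  have hprob : SchauderProblem P K u f D :=
    { symm := fun x => (hK x).2.2
      zero := fun x => (hK x).1
      upper := fun x => (hKe x).1
      cone := fun x => hcone (K x) (hK x).2.2 (hKe x)
      kant := hKα
      kernel := hKγ
      cont := (contDiffOn_univ.mp huγ.1).continuous
      bdd := hbdd
      holder := fun x y => abs_sub_le_of_hSemi_le hγ1.le hD0 (le_trans le_add_self huD)
        (mem_univ x) (mem_univ y)
      rhs := fun x hx y hy => abs_sub_le_of_hSemi_le hα1 hD0 (le_trans le_add_self hfD) hx hy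
      eq := fun x hx => (hsol x hx).2 }
  obtain ⟨Q, hQ⟩ := hu.exists_weightedBound hβ hβ3 hαs
  have hW := hbound K u f D Q hprob hQ
  have hT := hW.thirdBound (by positivity) hD0 hbdd
  refine (hreg _ u (by positivity) hT hu.1).trans_eq ?_
  rw [← hDN, ← ENNReal.ofReal_mul (by positivity)]
  congr 1
  ring

end
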